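/- In the appendix-C setting below, suppose in addition that a ≡ ā, b₂ ≡ b̄ and f ≡ f̄ are constants, and that the equation a φ(x_n) ∂_t u − div(A∇u) + ℓ² b₁ u + ℓ^{p+1} b₂ φ(x_n) u = ℓ^{p+1} φ(x_n) f holds pointwise in Q_R for some 0 < R < 1/2. Then there is a constant C > 0, depending only on n, λ, Λ, |b̄| and the C²-norms of A and b₁ on closure(B₁) (but not on ℓ), such that for all 0 < ρ ≤ R one has ∫_{Q_ρ} |∂_t u − (∂_t u)_ρ|² dx dt ≤ C (ρ/R)^{n+4} [ ∫_{Q_R} |∂_t u − (∂_t u)_R|² dx dt + ℓ⁴ R² ∫_{Q_R} |∂_t u|² dx dt ]. -/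

import Mathlib

open MeasureTheory Real Set

noncomputable section

/-- The last coordinate of a point of `ℝⁿ`. -/
def lastC {n : ℕ} (x : EuclideanSpace ℝ (Fin n)) : ℝ :=
  if h : 0 < n then x ⟨n - 1, by omega⟩ else 0

/-- Partial derivative in the `i`-th coordinate direction. -/
def pderiv' {n : ℕ} (i : Fin n) (f : EuclideanSpace ℝ (Fin n) → ℝ)
    (x : EuclideanSpace ℝ (Fin n)) : ℝ :=
  fderiv ℝ f x (EuclideanSpace.single i 1)

/-- The parabolic cylinder `Q_R = B_R × (-R², 0]`. -/
def cylQ (n : ℕ) (R : ℝ) : Set (EuclideanSpace ℝ (Fin n) × ℝ) :=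
  Metric.ball (0 : EuclideanSpace ℝ (Fin n)) R ×ˢ Set.Ioc (-(R ^ 2)) 0

/-- `div (A ∇u)` for a time-independent matrix of coefficients `A`. -/
def divAgrad {n : ℕ} (A : EuclideanSpace ℝ (Fin n) → Matrix (Fin n) (Fin n) ℝ)
    (u : EuclideanSpace ℝ (Fin n) × ℝ → ℝ)
    (z : EuclideanSpace ℝ (Fin n) × ℝ) : ℝ :=
  ∑ i, pderiv' i
    (fun y => ∑ j, A y i j * pderiv' j (fun y' => u (y', z.2)) y) z.1

/-- Regularity of a classical solution on `closure Q_R`:  `u`, `∂ₜu`, `D_x u` and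
`D_x² u` are continuous on `closure Q_R`, `u(·,t)` is `C²` in `x` on `B_R`, and
`ut` is the time derivative of `u` in `Q_R`. -/
def RegSol {n : ℕ} (R : ℝ) (u ut : EuclideanSpace ℝ (Fin n) × ℝ → ℝ) : Prop :=
  ContinuousOn u (closure (cylQ n R)) ∧
  ContinuousOn ut (closure (cylQ n R)) ∧
  (∀ t ∈ Set.Ioc (-(R ^ 2)) 0,
    ContDiffOn ℝ 2 (fun x => u (x, t)) (Metric.ball (0 : EuclideanSpace ℝ (Fin n)) R)) ∧
  (∀ i : Fin n, ContinuousOn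
    (fun z : EuclideanSpace ℝ (Fin n) × ℝ => pderiv' i (fun x => u (x, z.2)) z.1)
    (closure (cylQ n R))) ∧
  (∀ i j : Fin n, ContinuousOn
    (fun z : EuclideanSpace ℝ (Fin n) × ℝ =>
      pderiv' i (pderiv' j fun x => u (x, z.2)) z.1)
    (closure (cylQ n R))) ∧
  (∀ z ∈ cylQ n R,
    HasDerivWithinAt (fun s => u (z.1, s)) (ut z) (Set.Ioc (-(R ^ 2)) 0) z.2)

section

open Filter Topology

/-! ### Second-order jets of functions of one real variable -/

/-- `f` is differentiable near `0`, its derivative is differentiable at `0`, and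
`f 0 = a`, `f' 0 = b`, `f'' 0 = c`. -/
def HasTwoJet (f : ℝ → ℝ) (a b c : ℝ) : Prop :=
  f 0 = a ∧ ∃ f' : ℝ → ℝ, (∀ᶠ s in 𝓝 0, HasDerivAt f (f' s) s) ∧ f' 0 = b ∧ HasDerivAt f' c 0

namespace HasTwoJet

variable {f g : ℝ → ℝ} {a b c a' b' c' : ℝ}

lemma const (a : ℝ) : HasTwoJet (fun _ => a) a 0 0 :=
  ⟨rfl, fun _ => 0, .of_forall fun s => hasDerivAt_const s a, rfl, hasDerivAt_const _ _⟩

lemma add (hf : HasTwoJet f a b c) (hg : HasTwoJet g a' b' c') :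
    HasTwoJet (fun s => f s + g s) (a + a') (b + b') (c + c') := by
  obtain ⟨hf0, f', hf1, hf2, hf3⟩ := hf
  obtain ⟨hg0, g', hg1, hg2, hg3⟩ := hg
  refine ⟨by simp [hf0, hg0], fun s => f' s + g' s, ?_, by simp [hf2, hg2], hf3.add hg3⟩
  filter_upwards [hf1, hg1] with s h1 h2 using h1.add h2

lemma mul (hf : HasTwoJet f a b c) (hg : HasTwoJet g a' b' c') :
    HasTwoJet (fun s => f s * g s) (a * a') (b * a' + a * b')
      (c * a' + 2 * (b * b') + a * c') := by
  obtain ⟨hf0, f', hf1, hf2, hf3⟩ := hf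
  obtain ⟨hg0, g', hg1, hg2, hg3⟩ := hg
  refine ⟨by simp [hf0, hg0], fun s => f' s * g s + f s * g' s, ?_,
    by simp only [hf0, hg0, hf2, hg2], ?_⟩
  · filter_upwards [hf1, hg1] with s h1 h2 using h1.mul h2
  · refine ((hf3.mul hg1.self_of_nhds).add (hf1.self_of_nhds.mul hg3)).congr_deriv ?_
    rw [hf0, hg0, hf2, hg2]
    ring

lemma const_mul (k : ℝ) (hf : HasTwoJet f a b c) :
    HasTwoJet (fun s => k * f s) (k * a) (k * b) (k * c) := by
  simpa using (const k).mul hf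

lemma sum {ι : Type*} (S : Finset ι) {f : ι → ℝ → ℝ} {a b c : ι → ℝ}
    (h : ∀ i, HasTwoJet (f i) (a i) (b i) (c i)) :
    HasTwoJet (fun s => ∑ i ∈ S, f i s) (∑ i ∈ S, a i) (∑ i ∈ S, b i) (∑ i ∈ S, c i) := by
  classical
  induction S using Finset.induction_on with
  | empty => simpa using const 0
  | insert i S hi ih => simpa only [Finset.sum_insert hi] using (h i).add ih

lemma eq_zero_of_isLocalMax (hf : HasTwoJet f a b c) (hm : IsLocalMax f 0) : b = 0 := by
  obtain ⟨-, f', hf1, rfl, -⟩ := hf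
  exact hm.hasDerivAt_eq_zero hf1.self_of_nhds

lemma nonpos_of_isLocalMax (hf : HasTwoJet f a b c) (hm : IsLocalMax f 0) : c ≤ 0 := by
  have hb := hf.eq_zero_of_isLocalMax hm
  obtain ⟨-, f', hf1, hf2, hf3⟩ := hf
  by_contra! hc
  have hd : deriv f =ᶠ[𝓝 0] f' := hf1.mono fun s hs => hs.deriv
  have hmin : IsLocalMin f 0 := by
    apply isLocalMin_of_deriv_deriv_pos
    · rwa [hd.deriv_eq, hf3.deriv]
    · rw [hd.self_of_nhds, hf2, hb]
    · exact hf1.self_of_nhds.continuousAt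
  have hconst : f =ᶠ[𝓝 0] fun _ => f 0 := by
    filter_upwards [hm, hmin] with s h1 h2 using le_antisymm h1 h2
  have h0 : deriv f =ᶠ[𝓝 0] fun _ => 0 := by
    filter_upwards [hconst.eventuallyEq_nhds] with s hs
    rw [hs.deriv_eq, deriv_const]
  have := (h0.symm.trans hd).deriv_eq
  rw [hf3.deriv, deriv_const] at this
  exact hc.ne this

end HasTwoJet

/-- At a left maximum the left derivative is nonnegative. -/
lemma nonneg_of_hasDerivWithinAt_Iic {f : ℝ → ℝ} {d t : ℝ}
    (hf : HasDerivWithinAt f d (Iic t) t) (hm : ∀ᶠ s in 𝓝[<] t, f s ≤ f t) : 0 ≤ d := by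
  have h := (hasDerivWithinAt_iff_tendsto_slope' self_notMem_Iio).1 (hf.mono Iio_subset_Iic_self)
  refine ge_of_tendsto h ?_
  filter_upwards [hm, self_mem_nhdsWithin] with s h1 h2
  rw [slope_def_field]
  exact div_nonneg_of_nonpos (by linarith) (by linarith [mem_Iio.1 h2])

/-! ### Classical solutions of linear parabolic equations -/

/-- `f` is bounded by `C` and `C`-Lipschitz on `S`. -/
def BddLip {E : Type*} [NormedAddCommGroup E] (S : Set E) (C : ℝ) (f : E → ℝ) : Prop :=
  (∀ x ∈ S, |f x| ≤ C) ∧ ∀ x ∈ S, ∀ y ∈ S, |f x - f y| ≤ C * ‖x - y‖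

/-- Uniform ellipticity and Lipschitz bounds for the coefficients of the operator
`∂ₜ - α : D² - β · D + γ`. -/
structure CoeffBound {n : ℕ} (S : Set (EuclideanSpace ℝ (Fin n))) (lam Γ : ℝ)
    (α : EuclideanSpace ℝ (Fin n) → Matrix (Fin n) (Fin n) ℝ)
    (β : EuclideanSpace ℝ (Fin n) → Fin n → ℝ) (γ : EuclideanSpace ℝ (Fin n) → ℝ) : Prop where
  symm : ∀ x ∈ S, ∀ i j, α x i j = α x j i
  ellip : ∀ x ∈ S, ∀ ξ : Fin n → ℝ, lam * ∑ i, ξ i ^ 2 ≤ ∑ i, ∑ j, α x i j * ξ i * ξ j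
  bddA : ∀ i j, BddLip S Γ fun x => α x i j
  bddB : ∀ j, BddLip S Γ fun x => β x j
  bddC : BddLip S Γ γ

/-- `v` is a classical solution of `∂ₜv = α : D²v + β · Dv - γ v + g` on `cylQ n r`, with time
derivative `vt`, spatial gradient `P` and spatial Hessian `H`. -/
structure IsClassicalSol {n : ℕ} (r : ℝ)
    (α : EuclideanSpace ℝ (Fin n) → Matrix (Fin n) (Fin n) ℝ)
    (β : EuclideanSpace ℝ (Fin n) → Fin n → ℝ) (γ g : EuclideanSpace ℝ (Fin n) → ℝ)
    (v vt : EuclideanSpace ℝ (Fin n) × ℝ → ℝ)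
    (P : Fin n → EuclideanSpace ℝ (Fin n) × ℝ → ℝ)
    (H : Fin n → Fin n → EuclideanSpace ℝ (Fin n) × ℝ → ℝ) : Prop where
  cont : ContinuousOn v (cylQ n r)
  cont_t : ContinuousOn vt (cylQ n r)
  cont_P : ∀ i, ContinuousOn (P i) (cylQ n r)
  cont_H : ∀ i j, ContinuousOn (H i j) (cylQ n r)
  hasP : ∀ z ∈ cylQ n r, ∀ σ : EuclideanSpace ℝ (Fin n),
    HasDerivAt (fun s : ℝ => v (z.1 + s • σ, z.2)) (∑ j, σ j * P j z) 0
  hasH : ∀ i, ∀ z ∈ cylQ n r, ∀ σ : EuclideanSpace ℝ (Fin n),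
    HasDerivAt (fun s : ℝ => P i (z.1 + s • σ, z.2)) (∑ j, σ j * H i j z) 0
  has_t : ∀ z ∈ cylQ n r, HasDerivWithinAt (fun s => v (z.1, s)) (vt z) (Iic 0) z.2
  eqn : ∀ z ∈ cylQ n r, vt z =
    ∑ i, ∑ j, α z.1 i j * H i j z + ∑ j, β z.1 j * P j z - γ z.1 * v z + g z.1

lemma mem_cylQ {n : ℕ} {r : ℝ} {z : EuclideanSpace ℝ (Fin n) × ℝ} :
    z ∈ cylQ n r ↔ ‖z.1‖ < r ∧ -(r ^ 2) < z.2 ∧ z.2 ≤ 0 := by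
  simp [cylQ, Set.mem_prod]

/-- A directional derivative at every point of a segment. -/
lemma hasDerivAt_line {E : Type*} [NormedAddCommGroup E] [NormedSpace ℝ E] {f : E → ℝ}
    {x σ : E} {s d : ℝ} (h : HasDerivAt (fun s' : ℝ => f (x + s • σ + s' • σ)) d 0) :
    HasDerivAt (fun s' : ℝ => f (x + s' • σ)) d s := by
  have h' : HasDerivAt (fun s' : ℝ => f (x + s • σ + s' • σ)) d (s - s) := by simpa using h
  have := h'.comp_sub_const s s
  refine this.congr_of_eventuallyEq (.of_forall fun s' => ?_)
  beta_reduce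
  congr 1
  rw [add_assoc, ← add_smul]
  simp

namespace IsClassicalSol

variable {n : ℕ} {r : ℝ} {α : EuclideanSpace ℝ (Fin n) → Matrix (Fin n) (Fin n) ℝ}
  {β : EuclideanSpace ℝ (Fin n) → Fin n → ℝ} {γ g : EuclideanSpace ℝ (Fin n) → ℝ}
  {v vt : EuclideanSpace ℝ (Fin n) × ℝ → ℝ}
  {P : Fin n → EuclideanSpace ℝ (Fin n) × ℝ → ℝ}
  {H : Fin n → Fin n → EuclideanSpace ℝ (Fin n) × ℝ → ℝ}

lemma hasTwoJet (h : IsClassicalSol r α β γ g v vt P H) {z : EuclideanSpace ℝ (Fin n) × ℝ}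
    (hz : z ∈ cylQ n r) (σ : EuclideanSpace ℝ (Fin n)) :
    HasTwoJet (fun s : ℝ => v (z.1 + s • σ, z.2)) (v z) (∑ j, σ j * P j z)
      (∑ i, ∑ j, σ i * σ j * H i j z) := by
  refine ⟨by simp, fun s => ∑ j, σ j * P j (z.1 + s • σ, z.2), ?_, by simp, ?_⟩
  · have hc : Continuous fun s : ℝ => ‖z.1 + s • σ‖ := by fun_prop
    have : ∀ᶠ s : ℝ in 𝓝 0, ‖z.1 + s • σ‖ < r :=
      hc.continuousAt.eventually_lt continuousAt_const (by simpa using (mem_cylQ.1 hz).1)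
    filter_upwards [this] with s hs
    refine hasDerivAt_line (f := fun x => v (x, z.2)) ?_
    exact h.hasP (z.1 + s • σ, z.2) (mem_cylQ.2 ⟨hs, (mem_cylQ.1 hz).2⟩) σ
  · have := HasDerivAt.fun_sum (u := Finset.univ) fun i _ => (h.hasH i z hz σ).const_mul (σ i)
    refine this.congr_deriv (Finset.sum_congr rfl fun i _ => ?_)
    rw [Finset.mul_sum]
    exact Finset.sum_congr rfl fun j _ => by ring

end IsClassicalSol

open scoped MatrixOrder Matrix.Norms.L2Operator in
lemma exists_sum_mul_eq_of_nonneg {n : ℕ} {a : Matrix (Fin n) (Fin n) ℝ}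
    (hs : ∀ i j, a i j = a j i) (hp : ∀ ξ : Fin n → ℝ, 0 ≤ ∑ i, ∑ j, a i j * ξ i * ξ j) :
    ∃ σ : Fin n → EuclideanSpace ℝ (Fin n), ∀ i j, a i j = ∑ k, σ k i * σ k j := by
  have hps : a.PosSemidef := by
    refine Matrix.PosSemidef.of_dotProduct_mulVec_nonneg ?_ fun ξ => ?_
    · ext i j
      simp [Matrix.conjTranspose_apply, hs j i]
    · refine (hp ξ).trans_eq ?_
      simp only [dotProduct, Matrix.mulVec, Finset.mul_sum]
      refine Finset.sum_congr rfl fun i _ => Finset.sum_congr rfl fun j _ => ?_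
      rw [Pi.star_apply, star_trivial]
      ring
  obtain ⟨B, hB⟩ := CStarAlgebra.nonneg_iff_eq_star_mul_self.1 hps.nonneg
  refine ⟨fun k => WithLp.toLp 2 (B k), fun i j => ?_⟩
  rw [hB, Matrix.mul_apply]
  simp [Matrix.star_apply]

/-! ### Parabolic jets and the maximum principle -/

/-- `f` has left time derivative `ft` at `z`, and second-order jets along all spatial lines
through `z`, with first and second derivatives `f₁ σ`, `f₂ σ` in the direction `σ`. -/
def HasParJet {n : ℕ} (f : EuclideanSpace ℝ (Fin n) × ℝ → ℝ) (z : EuclideanSpace ℝ (Fin n) × ℝ)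
    (ft : ℝ) (f₁ f₂ : EuclideanSpace ℝ (Fin n) → ℝ) : Prop :=
  HasDerivWithinAt (fun s => f (z.1, s)) ft (Iic 0) z.2 ∧
    ∀ σ, HasTwoJet (fun s : ℝ => f (z.1 + s • σ, z.2)) (f z) (f₁ σ) (f₂ σ)

/-- The operator `∂ₜ - ∑ₖ D²(σₖ, σₖ) - D(b)` evaluated on a parabolic jet. -/
def parOp {n : ℕ} (σ : Fin n → EuclideanSpace ℝ (Fin n)) (b : EuclideanSpace ℝ (Fin n))
    (ft : ℝ) (f₁ f₂ : EuclideanSpace ℝ (Fin n) → ℝ) : ℝ :=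
  ft - ∑ k, f₂ (σ k) - f₁ b

/-- The weight `1 + t - |x|²`, which vanishes on the parabolic boundary of a paraboloid. -/
def parWeight {n : ℕ} (z : EuclideanSpace ℝ (Fin n) × ℝ) : ℝ := 1 + z.2 - ‖z.1‖ ^ 2

/-- The paraboloid `{|x|² ≤ 1 + t, t ≤ 0}`. -/
def paraboloid (n : ℕ) : Set (EuclideanSpace ℝ (Fin n) × ℝ) := {z | 0 ≤ parWeight z ∧ z.2 ≤ 0}

namespace HasParJet

variable {n : ℕ} {f g : EuclideanSpace ℝ (Fin n) × ℝ → ℝ} {z : EuclideanSpace ℝ (Fin n) × ℝ}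
  {ft gt : ℝ} {f₁ f₂ g₁ g₂ : EuclideanSpace ℝ (Fin n) → ℝ}

lemma add (hf : HasParJet f z ft f₁ f₂) (hg : HasParJet g z gt g₁ g₂) :
    HasParJet (fun z => f z + g z) z (ft + gt) (fun σ => f₁ σ + g₁ σ) (fun σ => f₂ σ + g₂ σ) :=
  ⟨hf.1.add hg.1, fun σ => (hf.2 σ).add (hg.2 σ)⟩

lemma mul (hf : HasParJet f z ft f₁ f₂) (hg : HasParJet g z gt g₁ g₂) :
    HasParJet (fun z => f z * g z) z (ft * g z + f z * gt) (fun σ => f₁ σ * g z + f z * g₁ σ)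
      (fun σ => f₂ σ * g z + 2 * (f₁ σ * g₁ σ) + f z * g₂ σ) :=
  ⟨hf.1.mul hg.1, fun σ => (hf.2 σ).mul (hg.2 σ)⟩

lemma const_mul (k : ℝ) (hf : HasParJet f z ft f₁ f₂) :
    HasParJet (fun z => k * f z) z (k * ft) (fun σ => k * f₁ σ) (fun σ => k * f₂ σ) :=
  ⟨hf.1.const_mul k, fun σ => (hf.2 σ).const_mul k⟩

lemma sum {ι : Type*} (S : Finset ι) {f : ι → EuclideanSpace ℝ (Fin n) × ℝ → ℝ} {ft : ι → ℝ}
    {f₁ f₂ : ι → EuclideanSpace ℝ (Fin n) → ℝ} (h : ∀ i, HasParJet (f i) z (ft i) (f₁ i) (f₂ i)) :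
    HasParJet (fun z => ∑ i ∈ S, f i z) z (∑ i ∈ S, ft i) (fun σ => ∑ i ∈ S, f₁ i σ)
      (fun σ => ∑ i ∈ S, f₂ i σ) :=
  ⟨HasDerivWithinAt.fun_sum fun i _ => (h i).1, fun σ => HasTwoJet.sum S fun i => (h i).2 σ⟩

lemma congr {gt : ℝ} {g₁ g₂ : EuclideanSpace ℝ (Fin n) → ℝ} (hf : HasParJet f z ft f₁ f₂)
    (ht : ft = gt) (h₁ : ∀ σ, f₁ σ = g₁ σ) (h₂ : ∀ σ, f₂ σ = g₂ σ) :
    HasParJet f z gt g₁ g₂ := by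
  obtain rfl := ht
  obtain rfl := funext h₁
  obtain rfl := funext h₂
  exact hf

lemma weight (z : EuclideanSpace ℝ (Fin n) × ℝ) :
    HasParJet parWeight z 1 (fun σ => -2 * inner ℝ z.1 σ) (fun σ => -2 * ‖σ‖ ^ 2) := by
  refine ⟨?_, fun σ => ?_⟩
  · have h : HasDerivAt (fun s : ℝ => 1 + s - ‖z.1‖ ^ 2) 1 z.2 :=
      ((hasDerivAt_id z.2).const_add 1).sub_const _
    exact h.hasDerivWithinAt
  · have he : ∀ s : ℝ, parWeight (z.1 + s • σ, z.2) =
        1 + z.2 - ‖z.1‖ ^ 2 + s * (-2 * inner ℝ z.1 σ) + s ^ 2 * (-‖σ‖ ^ 2) := by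
      intro s
      simp only [parWeight]
      rw [norm_add_sq_real, inner_smul_right, norm_smul, mul_pow, Real.norm_eq_abs, sq_abs]
      ring
    refine ⟨by simp, fun s => -2 * inner ℝ z.1 σ + 2 * s * (-‖σ‖ ^ 2), ?_, by simp, ?_⟩
    · refine .of_forall fun s => ?_
      simp only [he]
      have h := (((hasDerivAt_id s).mul_const (-2 * inner ℝ z.1 σ)).const_add
        (1 + z.2 - ‖z.1‖ ^ 2)).add (((hasDerivAt_id s).pow 2).mul_const (-‖σ‖ ^ 2))
      refine h.congr_deriv ?_
      simp
    · have h := (((hasDerivAt_id (0 : ℝ)).const_mul 2).mul_const (-‖σ‖ ^ 2)).const_add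
        (-2 * inner ℝ z.1 σ)
      refine h.congr_deriv ?_
      ring

lemma weight_pow_four_mul_sq (hf : HasParJet f z ft f₁ f₂) :
    HasParJet (fun z => parWeight z ^ 4 * f z ^ 2) z
      (4 * parWeight z ^ 3 * f z ^ 2 + 2 * parWeight z ^ 4 * f z * ft)
      (fun σ => -8 * parWeight z ^ 3 * inner ℝ z.1 σ * f z ^ 2
        + 2 * parWeight z ^ 4 * f z * f₁ σ)
      (fun σ => (48 * parWeight z ^ 2 * inner ℝ z.1 σ ^ 2
          - 8 * parWeight z ^ 3 * ‖σ‖ ^ 2) * f z ^ 2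
        - 32 * parWeight z ^ 3 * inner ℝ z.1 σ * f z * f₁ σ
        + 2 * parWeight z ^ 4 * (f₁ σ ^ 2 + f z * f₂ σ)) := by
  have h2 := (weight z).mul (weight z)
  have h := (h2.mul h2).mul (hf.mul hf)
  have he : (fun z => parWeight z ^ 4 * f z ^ 2) =
      fun z => parWeight z * parWeight z * (parWeight z * parWeight z) * (f z * f z) := by
    funext z; ring
  rw [he]
  exact h.congr (by ring) (fun σ => by ring) (fun σ => by ring)

lemma weight_sq_mul_sq (hf : HasParJet f z ft f₁ f₂) :
    HasParJet (fun z => parWeight z ^ 2 * f z ^ 2) z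
      (2 * parWeight z * f z ^ 2 + 2 * parWeight z ^ 2 * f z * ft)
      (fun σ => -4 * parWeight z * inner ℝ z.1 σ * f z ^ 2
        + 2 * parWeight z ^ 2 * f z * f₁ σ)
      (fun σ => (8 * inner ℝ z.1 σ ^ 2 - 4 * parWeight z * ‖σ‖ ^ 2) * f z ^ 2
        - 16 * parWeight z * inner ℝ z.1 σ * f z * f₁ σ
        + 2 * parWeight z ^ 2 * (f₁ σ ^ 2 + f z * f₂ σ)) := by
  have h := ((weight z).mul (weight z)).mul (hf.mul hf)
  have he : (fun z => parWeight z ^ 2 * f z ^ 2) =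
      fun z => parWeight z * parWeight z * (f z * f z) := by
    funext z; ring
  rw [he]
  exact h.congr (by ring) (fun σ => by ring) (fun σ => by ring)

lemma sq (hf : HasParJet f z ft f₁ f₂) :
    HasParJet (fun z => f z ^ 2) z (2 * f z * ft) (fun σ => 2 * f z * f₁ σ)
      (fun σ => 2 * (f₁ σ ^ 2 + f z * f₂ σ)) := by
  have he : (fun z => f z ^ 2) = fun z => f z * f z := by funext z; ring
  rw [he]
  exact (hf.mul hf).congr (by ring) (fun σ => by ring) (fun σ => by ring)

/-- The maximum principle: at an interior maximum over the paraboloid, the parabolic operator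
is nonnegative. -/
lemma parOp_nonneg (hf : HasParJet f z ft f₁ f₂) (hz : 0 < parWeight z) (hz0 : z.2 ≤ 0)
    (hm : ∀ w ∈ paraboloid n, f w ≤ f z) (σ : Fin n → EuclideanSpace ℝ (Fin n))
    (b : EuclideanSpace ℝ (Fin n)) : 0 ≤ parOp σ b ft f₁ f₂ := by
  have hline : ∀ τ : EuclideanSpace ℝ (Fin n),
      IsLocalMax (fun s : ℝ => f (z.1 + s • τ, z.2)) 0 := by
    intro τ
    have hc : Continuous fun s : ℝ => parWeight (z.1 + s • τ, z.2) := by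
      unfold parWeight; fun_prop
    have : ∀ᶠ s : ℝ in 𝓝 0, 0 < parWeight (z.1 + s • τ, z.2) :=
      continuousAt_const.eventually_lt hc.continuousAt (by simpa using hz)
    filter_upwards [this] with s hs
    simpa using hm (z.1 + s • τ, z.2) ⟨hs.le, hz0⟩
  have ht : 0 ≤ ft := by
    refine nonneg_of_hasDerivWithinAt_Iic (hf.1.mono (Iic_subset_Iic.2 hz0)) ?_
    have hc : Continuous fun s : ℝ => parWeight (z.1, s) := by
      unfold parWeight; fun_prop
    have : ∀ᶠ s : ℝ in 𝓝 z.2, 0 < parWeight (z.1, s) :=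
      continuousAt_const.eventually_lt hc.continuousAt hz
    filter_upwards [this.filter_mono nhdsWithin_le_nhds, self_mem_nhdsWithin] with s hs hs'
    exact hm (z.1, s) ⟨hs.le, (mem_Iio.1 hs').le.trans hz0⟩
  have h2 : ∑ k, f₂ (σ k) ≤ 0 :=
    Finset.sum_nonpos fun k _ => (hf.2 (σ k)).nonpos_of_isLocalMax (hline _)
  have h1 : f₁ b = 0 := (hf.2 b).eq_zero_of_isLocalMax (hline _)
  unfold parOp
  linarith

end HasParJet

section WeightedTerms

variable {n : ℕ} {x b : EuclideanSpace ℝ (Fin n)} {σ : Fin n → EuclideanSpace ℝ (Fin n)}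
  {e f ft T B : ℝ} {f₁ f₂ : EuclideanSpace ℝ (Fin n) → ℝ}

lemma inner_sq_le_of_norm_le_one (hx : ‖x‖ ≤ 1) (τ : EuclideanSpace ℝ (Fin n)) :
    inner ℝ x τ ^ 2 ≤ ‖τ‖ ^ 2 := by
  have h := abs_real_inner_le_norm x τ
  rw [← sq_abs]
  gcongr
  nlinarith [norm_nonneg τ]

lemma parOp_weight_pow_four_le (hx : ‖x‖ ≤ 1) (he : 0 ≤ e) (he1 : e ≤ 1)
    (hT : ∑ k, ‖σ k‖ ^ 2 ≤ T) (hB : ‖b‖ ≤ B) :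
    parOp σ b (4 * e ^ 3 * f ^ 2 + 2 * e ^ 4 * f * ft)
      (fun τ => -8 * e ^ 3 * inner ℝ x τ * f ^ 2 + 2 * e ^ 4 * f * f₁ τ)
      (fun τ => (48 * e ^ 2 * inner ℝ x τ ^ 2 - 8 * e ^ 3 * ‖τ‖ ^ 2) * f ^ 2
        - 32 * e ^ 3 * inner ℝ x τ * f * f₁ τ + 2 * e ^ 4 * (f₁ τ ^ 2 + f * f₂ τ)) ≤
    2 * e ^ 4 * f * parOp σ b ft f₁ f₂ + (4 + 136 * T + 8 * B) * (e ^ 2 * f ^ 2) := by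
  have hterm : ∀ k, 2 * e ^ 4 * f * f₂ (σ k) - 136 * (e ^ 2 * f ^ 2) * ‖σ k‖ ^ 2 ≤
      (48 * e ^ 2 * inner ℝ x (σ k) ^ 2 - 8 * e ^ 3 * ‖σ k‖ ^ 2) * f ^ 2
        - 32 * e ^ 3 * inner ℝ x (σ k) * f * f₁ (σ k)
        + 2 * e ^ 4 * (f₁ (σ k) ^ 2 + f * f₂ (σ k)) := by
    intro k
    have h1 := inner_sq_le_of_norm_le_one hx (σ k)
    have h2 : 0 ≤ e ^ 2 * f ^ 2 := by positivity
    have h3 : e ^ 3 * ‖σ k‖ ^ 2 * f ^ 2 ≤ e ^ 2 * ‖σ k‖ ^ 2 * f ^ 2 := by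
      have : e ^ 3 ≤ e ^ 2 := pow_le_pow_of_le_one he he1 (by norm_num)
      gcongr
    nlinarith [sq_nonneg (e ^ 2 * f₁ (σ k) - 8 * (e * inner ℝ x (σ k) * f)),
      mul_le_mul_of_nonneg_left h1 h2, mul_nonneg h2 (sq_nonneg (inner ℝ x (σ k)))]
  have hsum := Finset.sum_le_sum fun k (_ : k ∈ Finset.univ) => hterm k
  rw [Finset.sum_sub_distrib, ← Finset.mul_sum, ← Finset.mul_sum] at hsum
  have hb : |inner ℝ x b| ≤ B :=
    (abs_real_inner_le_norm x b).trans (by nlinarith [norm_nonneg b])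
  have h2 : 0 ≤ e ^ 2 * f ^ 2 := by positivity
  have h4 : e ^ 3 * f ^ 2 ≤ e ^ 2 * f ^ 2 := by
    have : e ^ 3 ≤ e ^ 2 := pow_le_pow_of_le_one he he1 (by norm_num)
    gcongr
  have h5 : e ^ 3 * f ^ 2 * inner ℝ x b ≤ e ^ 2 * f ^ 2 * B := by
    have hB0 : 0 ≤ B := (norm_nonneg b).trans hB
    calc e ^ 3 * f ^ 2 * inner ℝ x b ≤ e ^ 3 * f ^ 2 * B := by
          gcongr
          exact (le_abs_self _).trans hb
      _ ≤ _ := by gcongr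
  have h6 := mul_le_mul_of_nonneg_left hT h2
  simp only [parOp]
  nlinarith

lemma parOp_weight_sq_le (hx : ‖x‖ ≤ 1) (he : 0 ≤ e) (he1 : e ≤ 1)
    (hT : ∑ k, ‖σ k‖ ^ 2 ≤ T) (hB : ‖b‖ ≤ B) :
    parOp σ b (2 * e * f ^ 2 + 2 * e ^ 2 * f * ft)
      (fun τ => -4 * e * inner ℝ x τ * f ^ 2 + 2 * e ^ 2 * f * f₁ τ)
      (fun τ => (8 * inner ℝ x τ ^ 2 - 4 * e * ‖τ‖ ^ 2) * f ^ 2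
        - 16 * e * inner ℝ x τ * f * f₁ τ + 2 * e ^ 2 * (f₁ τ ^ 2 + f * f₂ τ)) ≤
    2 * e ^ 2 * f * parOp σ b ft f₁ f₂ - e ^ 2 * ∑ k, f₁ (σ k) ^ 2
      + (4 + 136 * T + 8 * B) * f ^ 2 := by
  have hterm : ∀ k, 2 * e ^ 2 * f * f₂ (σ k) + e ^ 2 * f₁ (σ k) ^ 2
        - 136 * f ^ 2 * ‖σ k‖ ^ 2 ≤
      (8 * inner ℝ x (σ k) ^ 2 - 4 * e * ‖σ k‖ ^ 2) * f ^ 2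
        - 16 * e * inner ℝ x (σ k) * f * f₁ (σ k)
        + 2 * e ^ 2 * (f₁ (σ k) ^ 2 + f * f₂ (σ k)) := by
    intro k
    have h1 := inner_sq_le_of_norm_le_one hx (σ k)
    have h2 : 0 ≤ f ^ 2 := by positivity
    have h3 : e * ‖σ k‖ ^ 2 * f ^ 2 ≤ 1 * ‖σ k‖ ^ 2 * f ^ 2 := by gcongr
    nlinarith [sq_nonneg (e * f₁ (σ k) - 8 * (inner ℝ x (σ k) * f)),
      mul_le_mul_of_nonneg_left h1 h2, mul_nonneg h2 (sq_nonneg (inner ℝ x (σ k)))]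
  have hsum := Finset.sum_le_sum fun k (_ : k ∈ Finset.univ) => hterm k
  rw [Finset.sum_sub_distrib, Finset.sum_add_distrib, ← Finset.mul_sum, ← Finset.mul_sum,
    ← Finset.mul_sum] at hsum
  have hb : |inner ℝ x b| ≤ B :=
    (abs_real_inner_le_norm x b).trans (by nlinarith [norm_nonneg b])
  have h2 : 0 ≤ f ^ 2 := by positivity
  have hB0 : 0 ≤ B := (norm_nonneg b).trans hB
  have hT0 : 0 ≤ T := (Finset.sum_nonneg fun k _ => sq_nonneg _).trans hT
  have h4 : e * f ^ 2 ≤ 1 * f ^ 2 := by gcongr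
  have h5 : e * f ^ 2 * inner ℝ x b ≤ 1 * f ^ 2 * B := by
    calc e * f ^ 2 * inner ℝ x b ≤ e * f ^ 2 * B := by
          gcongr
          exact (le_abs_self _).trans hb
      _ ≤ _ := by gcongr
  have h6 := mul_le_mul_of_nonneg_left hT h2
  have h7 := mul_nonneg h2 hB0
  simp only [parOp]
  nlinarith

lemma parOp_sq : parOp σ b (2 * f * ft) (fun τ => 2 * f * f₁ τ)
      (fun τ => 2 * (f₁ τ ^ 2 + f * f₂ τ)) =
    2 * f * parOp σ b ft f₁ f₂ - 2 * ∑ k, f₁ (σ k) ^ 2 := by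
  simp only [parOp, ← Finset.mul_sum, Finset.sum_add_distrib]
  ring

end WeightedTerms

/-! ### The Bernstein estimate for difference quotients -/

lemma sq_bernstein_source_le (n : ℕ) (hn : 1 ≤ n) (Γ M N ε : ℝ) (q : Fin n → ℝ)
    (D : Fin n → Fin n → ℝ) :
    (ε + Γ * ∑ i, ∑ j, (|D j i| + ε) + Γ * ∑ j, (|q j| + ε) + Γ * M + N) ^ 2 ≤
      21 * ((1 + Γ ^ 2) * (1 + (n : ℝ) ^ 4)) *
        (∑ k, ∑ j, D k j ^ 2 + ∑ k, q k ^ 2 + (M ^ 2 + N ^ 2 + ε ^ 2)) := by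
  have hn1 : (1 : ℝ) ≤ n := by exact_mod_cast hn
  set m : ℝ := (1 + Γ ^ 2) * (1 + (n : ℝ) ^ 4) with hm
  have hG := sq_nonneg Γ
  have hn4 : 1 ≤ (n : ℝ) ^ 4 := one_le_pow₀ hn1
  have hm1 : 1 ≤ m := by rw [hm]; nlinarith
  have hmΓ : ∀ j ≤ 4, Γ ^ 2 * (n : ℝ) ^ j ≤ m := by
    intro j hj
    calc Γ ^ 2 * (n : ℝ) ^ j ≤ Γ ^ 2 * (n : ℝ) ^ 4 := by gcongr
      _ ≤ m := by rw [hm]; nlinarith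
  set L : ℝ := ∑ i, ∑ j, |D j i| with hL
  set U : ℝ := ∑ j, |q j| with hU
  set X : ℝ := ∑ k, ∑ j, D k j ^ 2 with hX
  set Y : ℝ := ∑ k, q k ^ 2 with hY
  have hX0 : 0 ≤ X := by positivity
  have hY0 : 0 ≤ Y := by positivity
  have hL2 : L ^ 2 ≤ (n : ℝ) ^ 2 * X := by
    have h1 : L ^ 2 ≤ n * ∑ i, (∑ j, |D j i|) ^ 2 := by
      simpa using sq_sum_le_card_mul_sum_sq (s := Finset.univ) (f := fun i => ∑ j, |D j i|)
    have h2 : ∀ i, (∑ j, |D j i|) ^ 2 ≤ n * ∑ j, D j i ^ 2 := fun i => by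
      simpa using sq_sum_le_card_mul_sum_sq (s := Finset.univ) (f := fun j => |D j i|)
    calc L ^ 2 ≤ n * ∑ i, (∑ j, |D j i|) ^ 2 := h1
      _ ≤ n * ∑ i, n * ∑ j, D j i ^ 2 := by gcongr with i; exact h2 i
      _ = (n : ℝ) ^ 2 * X := by
        rw [← Finset.mul_sum, hX, Finset.sum_comm]; ring
  have hU2 : U ^ 2 ≤ (n : ℝ) ^ 1 * Y := by
    simpa using sq_sum_le_card_mul_sum_sq (s := Finset.univ) (f := fun j => |q j|)
  have hFe : ε + Γ * ∑ i, ∑ j, (|D j i| + ε) + Γ * ∑ j, (|q j| + ε) + Γ * M + N =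
      ε + Γ * L + Γ * n ^ 2 * ε + Γ * U + Γ * n * ε + Γ * M + N := by
    simp only [Finset.sum_add_distrib, Finset.sum_const, Finset.card_univ, Fintype.card_fin,
      nsmul_eq_mul]
    ring
  have hseven : ∀ a b c d f g h : ℝ, (a + b + c + d + f + g + h) ^ 2 ≤
      7 * (a ^ 2 + b ^ 2 + c ^ 2 + d ^ 2 + f ^ 2 + g ^ 2 + h ^ 2) := by
    intro a b c d f g h
    have := sq_sum_le_card_mul_sum_sq (s := Finset.univ) (f := ![a, b, c, d, f, g, h])
    simpa [Fin.sum_univ_succ, add_assoc] using this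
  rw [hFe]
  refine (hseven _ _ _ _ _ _ _).trans ?_
  have k1 : ε ^ 2 ≤ m * ε ^ 2 := le_mul_of_one_le_left (sq_nonneg _) hm1
  have k2 : (Γ * L) ^ 2 ≤ m * X := by
    calc (Γ * L) ^ 2 = Γ ^ 2 * L ^ 2 := by ring
      _ ≤ Γ ^ 2 * ((n : ℝ) ^ 2 * X) := by gcongr
      _ = Γ ^ 2 * (n : ℝ) ^ 2 * X := by ring
      _ ≤ m * X := by gcongr; exact hmΓ 2 (by norm_num)
  have k3 : (Γ * n ^ 2 * ε) ^ 2 ≤ m * ε ^ 2 := by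
    calc (Γ * n ^ 2 * ε) ^ 2 = Γ ^ 2 * (n : ℝ) ^ 4 * ε ^ 2 := by ring
      _ ≤ m * ε ^ 2 := by gcongr; exact hmΓ 4 le_rfl
  have k4 : (Γ * U) ^ 2 ≤ m * Y := by
    calc (Γ * U) ^ 2 = Γ ^ 2 * U ^ 2 := by ring
      _ ≤ Γ ^ 2 * ((n : ℝ) ^ 1 * Y) := by gcongr
      _ = Γ ^ 2 * (n : ℝ) ^ 1 * Y := by ring
      _ ≤ m * Y := by gcongr; exact hmΓ 1 (by norm_num)
  have k5 : (Γ * n * ε) ^ 2 ≤ m * ε ^ 2 := by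
    calc (Γ * n * ε) ^ 2 = Γ ^ 2 * (n : ℝ) ^ 2 * ε ^ 2 := by ring
      _ ≤ m * ε ^ 2 := by gcongr; exact hmΓ 2 (by norm_num)
  have k6 : (Γ * M) ^ 2 ≤ m * M ^ 2 := by
    calc (Γ * M) ^ 2 = Γ ^ 2 * (n : ℝ) ^ 0 * M ^ 2 := by ring
      _ ≤ m * M ^ 2 := by gcongr; exact hmΓ 0 (by norm_num)
  have k7 : N ^ 2 ≤ m * N ^ 2 := le_mul_of_one_le_left (sq_nonneg _) hm1
  have k8 : 0 ≤ m * X := by positivity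
  have k9 : 0 ≤ m * Y := by positivity
  have k10 : 0 ≤ m * M ^ 2 := by positivity
  have k11 : 0 ≤ m * N ^ 2 := by positivity
  linarith

set_option maxHeartbeats 2000000 in
/-- The choice of weights in the Bernstein function and the resulting bound at a maximum. -/
lemma exists_bernstein_weights (n : ℕ) (hn : 1 ≤ n) {lam Γ : ℝ} (hlam : 0 < lam) (hΓ : 0 ≤ Γ)
    (A : ℝ) (hA : 0 ≤ A) :
    ∃ μ₁ μ₂ C : ℝ, 1 ≤ μ₁ ∧ 0 ≤ μ₂ ∧ μ₂ ≤ C ∧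
      ∀ (e q₀ S₀ v Sv M N ε : ℝ) (q S p : Fin n → ℝ) (D : Fin n → Fin n → ℝ),
        0 ≤ e → e ≤ 1 → 0 ≤ M → 0 ≤ N → 0 ≤ ε → |v| ≤ M →
        |S₀| ≤ Γ * |q₀| → |Sv| ≤ Γ * M + N → (∀ j, |q j| ≤ |p j| + ε) →
        (∀ k, |S k| ≤ Γ * ∑ i, ∑ j, (|D j i| + ε) + Γ * ∑ j, (|q j| + ε) + Γ * M + Γ * |q k| + N) →
        |q₀| ≤ ε + Γ * ∑ i, ∑ j, (|D j i| + ε) + Γ * ∑ j, (|q j| + ε) + Γ * M + N →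
        0 ≤ 2 * e ^ 4 * q₀ * S₀ + A * (e ^ 2 * q₀ ^ 2)
          + μ₁ * ∑ k, (2 * e ^ 2 * q k * S k - e ^ 2 * (lam * ∑ j, D k j ^ 2) + A * q k ^ 2)
          + μ₂ * (2 * v * Sv - 2 * (lam * ∑ j, p j ^ 2)) →
        e ^ 4 * q₀ ^ 2 + μ₁ * ∑ k, e ^ 2 * q k ^ 2 + μ₂ * v ^ 2 ≤ C * (M ^ 2 + N ^ 2 + ε ^ 2) := by
  have hn' : (0 : ℝ) < n := by exact_mod_cast hn
  obtain ⟨c₀, hc₀⟩ : ∃ a : ℝ, a = 21 * ((1 + Γ ^ 2) * (1 + (n : ℝ) ^ 4)) := ⟨_, rfl⟩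
  have hc₀0 : 0 < c₀ := by rw [hc₀]; positivity
  obtain ⟨κ, hκ⟩ : ∃ a : ℝ, a = lam / (2 * n * c₀) := ⟨_, rfl⟩
  have hκ0 : 0 < κ := by rw [hκ]; positivity
  obtain ⟨c₁, hc₁⟩ : ∃ a : ℝ, a = lam / 2 + 1 / κ + 2 * Γ + A := ⟨_, rfl⟩
  have hc₁0 : 0 ≤ c₁ := by rw [hc₁]; positivity
  obtain ⟨c₂, hc₂⟩ : ∃ a : ℝ, a = (2 * Γ + A) * c₀ := ⟨_, rfl⟩
  have hc₂0 : 0 ≤ c₂ := by rw [hc₂]; positivity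
  obtain ⟨μ₁, hμ₁⟩ : ∃ a : ℝ, a = 2 * (c₂ + 1) / lam + 1 := ⟨_, rfl⟩
  have hμ₁1 : 1 ≤ μ₁ := by
    have : 0 ≤ 2 * (c₂ + 1) / lam := by positivity
    linarith
  have hμ₁l : c₂ + 1 ≤ μ₁ * (lam / 2) := by
    have : 2 * (c₂ + 1) / lam * (lam / 2) = c₂ + 1 := by field_simp
    nlinarith
  obtain ⟨μ₂, hμ₂⟩ : ∃ a : ℝ, a = (c₂ + μ₁ * c₁ + 1) / lam := ⟨_, rfl⟩
  have hμ₂0 : 0 ≤ μ₂ := by rw [hμ₂]; positivity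
  have hμ₂l : μ₂ * lam = c₂ + μ₁ * c₁ + 1 := by rw [hμ₂]; field_simp
  obtain ⟨c₃, hc₃⟩ : ∃ a : ℝ, a = c₂ + μ₁ * (lam / 2) + μ₂ * (2 * Γ + 1 + 2 * lam * n) := ⟨_, rfl⟩
  have hc₃0 : 0 ≤ c₃ := by rw [hc₃]; positivity
  refine ⟨μ₁, μ₂, c₀ * (c₃ + 1) + μ₁ * c₃ + μ₂, hμ₁1, hμ₂0, ?_, ?_⟩
  · have : 0 ≤ c₀ * (c₃ + 1) + μ₁ * c₃ := by positivity
    linarith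
  intro e q₀ S₀ v Sv M N ε q S p D he he1 hM hN hε hv hS₀ hSv hp hS hq₀ hmain
  obtain ⟨X, hX⟩ : ∃ a : ℝ, a = ∑ k, ∑ j, D k j ^ 2 := ⟨_, rfl⟩
  obtain ⟨Y, hY⟩ : ∃ a : ℝ, a = ∑ k, q k ^ 2 := ⟨_, rfl⟩
  obtain ⟨Z, hZ⟩ : ∃ a : ℝ, a = M ^ 2 + N ^ 2 + ε ^ 2 := ⟨_, rfl⟩
  have hX0 : 0 ≤ X := by rw [hX]; positivity
  have hY0 : 0 ≤ Y := by rw [hY]; positivity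
  have hZ0 : 0 ≤ Z := by rw [hZ]; positivity
  obtain ⟨F, hF⟩ : ∃ a : ℝ, a =
      ε + Γ * ∑ i, ∑ j, (|D j i| + ε) + Γ * ∑ j, (|q j| + ε) + Γ * M + N := ⟨_, rfl⟩
  rw [← hF] at hq₀
  have hF0 : 0 ≤ F := by rw [hF]; positivity
  have he2 : e ^ 2 ≤ 1 := pow_le_one₀ he he1
  have hF2 : F ^ 2 ≤ c₀ * (X + Y + Z) := by
    rw [hF, hc₀, hX, hY, hZ]
    exact sq_bernstein_source_le n hn Γ M N ε q D
  have hSF : ∀ k, 2 * q k * S k ≤ κ * F ^ 2 + (1 / κ + 2 * Γ) * q k ^ 2 := by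
    intro k
    have h1 : |S k| ≤ F + Γ * |q k| := (hS k).trans (by rw [hF]; linarith)
    have h2 : q k * S k ≤ |q k| * (F + Γ * |q k|) := by
      refine (le_abs_self _).trans ?_
      rw [abs_mul]
      gcongr
    have h3 : 2 * (|q k| * F) ≤ κ * F ^ 2 + 1 / κ * |q k| ^ 2 := by
      have h4 : κ * F ^ 2 + 1 / κ * |q k| ^ 2 - 2 * (|q k| * F) = 1 / κ * (κ * F - |q k|) ^ 2 := by
        field_simp
        ring
      have h5 : 0 ≤ 1 / κ * (κ * F - |q k|) ^ 2 := by positivity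
      linarith
    rw [← sq_abs (q k)]
    linarith
  have hgrad : ∑ k, (2 * e ^ 2 * q k * S k - e ^ 2 * (lam * ∑ j, D k j ^ 2) + A * q k ^ 2) ≤
      -(lam / 2) * (e ^ 2 * X) + c₁ * Y + lam / 2 * Z := by
    have h1 : ∑ k, (2 * e ^ 2 * q k * S k - e ^ 2 * (lam * ∑ j, D k j ^ 2) + A * q k ^ 2) ≤
        ∑ k, (e ^ 2 * (κ * F ^ 2 + (1 / κ + 2 * Γ) * q k ^ 2)
          - e ^ 2 * (lam * ∑ j, D k j ^ 2) + A * q k ^ 2) := by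
      refine Finset.sum_le_sum fun k _ => ?_
      have := mul_le_mul_of_nonneg_left (hSF k) (sq_nonneg e)
      linarith
    refine h1.trans ?_
    simp only [Finset.sum_add_distrib, Finset.sum_sub_distrib, ← Finset.mul_sum, Finset.sum_const,
      Finset.card_univ, Fintype.card_fin, nsmul_eq_mul]
    rw [← hX, ← hY]
    have h2 : n * (κ * F ^ 2) ≤ lam / 2 * (X + Y + Z) := by
      calc n * (κ * F ^ 2) ≤ n * (κ * (c₀ * (X + Y + Z))) := by gcongr
        _ = lam / 2 * (X + Y + Z) := by rw [hκ]; field_simp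
    have h3 : e ^ 2 * (n * (κ * F ^ 2)) ≤ e ^ 2 * (lam / 2 * (X + Y + Z)) := by gcongr
    have h4 : e ^ 2 * (lam / 2 * Y) ≤ 1 * (lam / 2 * Y) := by gcongr
    have h5 : e ^ 2 * (lam / 2 * Z) ≤ 1 * (lam / 2 * Z) := by gcongr
    have h6 : e ^ 2 * ((1 / κ + 2 * Γ) * Y) ≤ 1 * ((1 / κ + 2 * Γ) * Y) := by gcongr
    rw [hc₁]
    nlinarith
  have hq₀2 : e ^ 2 * q₀ ^ 2 ≤ c₀ * (e ^ 2 * X + Y + Z) := by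
    have h1 : q₀ ^ 2 ≤ F ^ 2 := by
      rw [← sq_abs]; gcongr
    calc e ^ 2 * q₀ ^ 2 ≤ e ^ 2 * (c₀ * (X + Y + Z)) := by gcongr; exact h1.trans hF2
      _ = c₀ * (e ^ 2 * X + e ^ 2 * Y + e ^ 2 * Z) := by ring
      _ ≤ c₀ * (e ^ 2 * X + 1 * Y + 1 * Z) := by gcongr
      _ = _ := by ring
  have htime : 2 * e ^ 4 * q₀ * S₀ + A * (e ^ 2 * q₀ ^ 2) ≤ c₂ * (e ^ 2 * X + Y + Z) := by
    have h1 : q₀ * S₀ ≤ Γ * q₀ ^ 2 := by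
      refine (le_abs_self _).trans ?_
      rw [abs_mul, ← sq_abs q₀]
      nlinarith [mul_le_mul_of_nonneg_left hS₀ (abs_nonneg q₀)]
    have h2 : e ^ 4 * q₀ ^ 2 ≤ e ^ 2 * q₀ ^ 2 := by
      have : e ^ 4 ≤ e ^ 2 := pow_le_pow_of_le_one he he1 (by norm_num)
      gcongr
    have h3 : e ^ 4 * (q₀ * S₀) ≤ Γ * (e ^ 2 * q₀ ^ 2) :=
      calc e ^ 4 * (q₀ * S₀) ≤ e ^ 4 * (Γ * q₀ ^ 2) := by gcongr
        _ = Γ * (e ^ 4 * q₀ ^ 2) := by ring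
        _ ≤ _ := by gcongr
    calc 2 * e ^ 4 * q₀ * S₀ + A * (e ^ 2 * q₀ ^ 2) ≤ (2 * Γ + A) * (e ^ 2 * q₀ ^ 2) := by linarith
      _ ≤ (2 * Γ + A) * (c₀ * (e ^ 2 * X + Y + Z)) := by gcongr
      _ = _ := by rw [hc₂]; ring
  have hzero : 2 * v * Sv - 2 * (lam * ∑ j, p j ^ 2) ≤ (2 * Γ + 1 + 2 * lam * n) * Z - lam * Y := by
    have h1 : v * Sv ≤ M * (Γ * M + N) := by
      refine (le_abs_self _).trans ?_
      rw [abs_mul]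
      gcongr
    have h2 : Y ≤ 2 * ∑ j, p j ^ 2 + 2 * n * ε ^ 2 := by
      have : ∀ j, q j ^ 2 ≤ 2 * p j ^ 2 + 2 * ε ^ 2 := by
        intro j
        rw [← sq_abs (q j), ← sq_abs (p j)]
        nlinarith [hp j, abs_nonneg (q j), sq_nonneg (|p j| - ε),
          pow_le_pow_left₀ (abs_nonneg (q j)) (hp j) 2]
      calc Y ≤ ∑ j, (2 * p j ^ 2 + 2 * ε ^ 2) := by
              rw [hY]
              exact Finset.sum_le_sum fun j _ => this j
        _ = _ := by
          simp only [Finset.sum_add_distrib, ← Finset.mul_sum, Finset.sum_const,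
            Finset.card_univ, Fintype.card_fin, nsmul_eq_mul]
          ring
    have h3 : ε ^ 2 ≤ Z := by rw [hZ]; nlinarith [sq_nonneg M, sq_nonneg N]
    have h4 : 2 * (M * (Γ * M + N)) ≤ (2 * Γ + 1) * Z := by
      rw [hZ]
      linarith [two_mul_le_add_sq M N, mul_nonneg hΓ (sq_nonneg N),
        mul_nonneg hΓ (sq_nonneg ε), sq_nonneg ε]
    have h5 : lam * Y ≤ lam * (2 * ∑ j, p j ^ 2 + 2 * n * ε ^ 2) := by gcongr
    have h6 : lam * (2 * n * ε ^ 2) ≤ lam * (2 * n * Z) := by gcongr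
    linarith
  have hXY : e ^ 2 * X + Y ≤ c₃ * Z := by
    have h1 := mul_le_mul_of_nonneg_left hgrad (zero_le_one.trans hμ₁1)
    have h2 := mul_le_mul_of_nonneg_left hzero hμ₂0
    have h3 : 0 ≤ e ^ 2 * X := by positivity
    have h4 := mul_le_mul_of_nonneg_right hμ₁l h3
    have h5 : μ₂ * (lam * Y) = (c₂ + μ₁ * c₁ + 1) * Y := by rw [← hμ₂l]; ring
    rw [hc₃]
    linarith
  have hX' : 0 ≤ e ^ 2 * X := by positivity
  have hv2 : v ^ 2 ≤ Z := by
    have : v ^ 2 ≤ M ^ 2 := by rw [← sq_abs]; gcongr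
    rw [hZ]; nlinarith [sq_nonneg N, sq_nonneg ε]
  have hfin : e ^ 4 * q₀ ^ 2 ≤ c₀ * (c₃ + 1) * Z := by
    calc e ^ 4 * q₀ ^ 2 ≤ e ^ 2 * q₀ ^ 2 := by
          have : e ^ 4 ≤ e ^ 2 := pow_le_pow_of_le_one he he1 (by norm_num)
          gcongr
      _ ≤ c₀ * (e ^ 2 * X + Y + Z) := hq₀2
      _ ≤ c₀ * (c₃ * Z + Z) := mul_le_mul_of_nonneg_left (by linarith) hc₀0.le
      _ = _ := by ring
  have hfin2 : ∑ k, e ^ 2 * q k ^ 2 ≤ c₃ * Z := by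
    rw [← Finset.mul_sum, ← hY]
    have : e ^ 2 * Y ≤ 1 * Y := by gcongr
    linarith
  have h1 := mul_le_mul_of_nonneg_left hfin2 (zero_le_one.trans hμ₁1)
  have h2 := mul_le_mul_of_nonneg_left hv2 hμ₂0
  rw [← hZ]
  linarith

/-! ### Difference quotients of classical solutions -/

lemma HasParJet.shift {n : ℕ} {f : EuclideanSpace ℝ (Fin n) × ℝ → ℝ}
    {z : EuclideanSpace ℝ (Fin n) × ℝ} {ft : ℝ} {f₁ f₂ : EuclideanSpace ℝ (Fin n) → ℝ}
    {a : EuclideanSpace ℝ (Fin n)} {τ : ℝ} (hτ : τ ≤ 0)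
    (h : HasParJet f (z.1 + a, z.2 + τ) ft f₁ f₂) :
    HasParJet (fun w => f (w.1 + a, w.2 + τ)) z ft f₁ f₂ := by
  refine ⟨?_, fun σ => ?_⟩
  · have h1 : HasDerivWithinAt (fun s : ℝ => s + τ) 1 (Iic 0) z.2 :=
      ((hasDerivAt_id z.2).add_const τ).hasDerivWithinAt
    have hm : MapsTo (fun s : ℝ => s + τ) (Iic 0) (Iic 0) := fun s hs => by
      have := mem_Iic.1 hs
      simp only [mem_Iic]
      linarith
    have h2 := h.1.scomp z.2 h1 hm
    rw [one_smul] at h2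
    exact h2
  · have h1 := h.2 σ
    have he : (fun s : ℝ => f (z.1 + s • σ + a, z.2 + τ)) =
        fun s : ℝ => f (z.1 + a + s • σ, z.2 + τ) := by
      funext s
      rw [add_right_comm]
    simp only [he]
    exact h1

lemma HasParJet.quot {n : ℕ} {f g : EuclideanSpace ℝ (Fin n) × ℝ → ℝ}
    {z : EuclideanSpace ℝ (Fin n) × ℝ} {ft gt : ℝ} {f₁ f₂ g₁ g₂ : EuclideanSpace ℝ (Fin n) → ℝ}
    (c : ℝ) (hf : HasParJet f z ft f₁ f₂) (hg : HasParJet g z gt g₁ g₂) :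
    HasParJet (fun z => c * (f z - g z)) z (c * (ft - gt)) (fun σ => c * (f₁ σ - g₁ σ))
      (fun σ => c * (f₂ σ - g₂ σ)) := by
  have h := (hf.add (hg.const_mul (-1))).const_mul c
  have he : (fun z => c * (f z - g z)) = fun z => c * (f z + -1 * g z) := by
    funext z; ring
  rw [he]
  exact h.congr (by ring) (fun σ => by ring) (fun σ => by ring)

lemma mem_cylQ_two_of_paraboloid {n : ℕ} {z : EuclideanSpace ℝ (Fin n) × ℝ}
    (hz : z ∈ paraboloid n) {a : EuclideanSpace ℝ (Fin n)} {τ : ℝ} (ha : ‖a‖ ≤ 1 / 2)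
    (hτ : |τ| ≤ 1 / 2) (hτ0 : τ ≤ 0) : (z.1 + a, z.2 + τ) ∈ cylQ n 2 := by
  obtain ⟨h1, h2⟩ := hz
  unfold parWeight at h1
  rw [mem_cylQ]
  have h3 := norm_add_le z.1 a
  have h4 : ‖z.1‖ ≤ 1 := by nlinarith [norm_nonneg z.1]
  have h5 := (abs_le.1 hτ).1
  have h6 := sq_nonneg ‖z.1‖
  refine ⟨?_, ?_, ?_⟩ <;> dsimp only <;> linarith

lemma paraboloid_subset_cylQ {n : ℕ} : paraboloid n ⊆ cylQ n 2 := fun z hz => by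
  simpa using mem_cylQ_two_of_paraboloid hz (a := 0) (τ := 0) (by simp) (by simp) le_rfl

lemma isCompact_paraboloid (n : ℕ) : IsCompact (paraboloid n) := by
  have hK : IsCompact (Metric.closedBall (0 : EuclideanSpace ℝ (Fin n)) 1 ×ˢ Icc (-1 : ℝ) 0) :=
    (isCompact_closedBall _ _).prod isCompact_Icc
  refine hK.of_isClosed_subset ?_ ?_
  · have hc : Continuous (parWeight (n := n)) := by unfold parWeight; fun_prop
    exact (isClosed_le continuous_const hc).inter (isClosed_le continuous_snd continuous_const)
  · rintro z ⟨h1, h2⟩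
    unfold parWeight at h1
    have h4 : ‖z.1‖ ≤ 1 := by nlinarith [norm_nonneg z.1]
    have h6 := sq_nonneg ‖z.1‖
    exact ⟨by simpa using h4, by linarith, h2⟩

namespace IsClassicalSol

variable {n : ℕ} {r : ℝ} {α : EuclideanSpace ℝ (Fin n) → Matrix (Fin n) (Fin n) ℝ}
  {β : EuclideanSpace ℝ (Fin n) → Fin n → ℝ} {γ g : EuclideanSpace ℝ (Fin n) → ℝ}
  {v vt : EuclideanSpace ℝ (Fin n) × ℝ → ℝ}
  {P : Fin n → EuclideanSpace ℝ (Fin n) × ℝ → ℝ}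
  {H : Fin n → Fin n → EuclideanSpace ℝ (Fin n) × ℝ → ℝ}

lemma hasParJet (h : IsClassicalSol r α β γ g v vt P H) {z : EuclideanSpace ℝ (Fin n) × ℝ}
    (hz : z ∈ cylQ n r) :
    HasParJet v z (vt z) (fun σ => ∑ j, σ j * P j z) (fun σ => ∑ i, ∑ j, σ i * σ j * H i j z) :=
  ⟨h.has_t z hz, fun σ => h.hasTwoJet hz σ⟩

/-- The jet of a difference quotient of a solution. -/
lemma hasParJet_quot (h : IsClassicalSol r α β γ g v vt P H) (c : ℝ)
    {z : EuclideanSpace ℝ (Fin n) × ℝ} {a a' : EuclideanSpace ℝ (Fin n)} {τ τ' : ℝ} (hτ : τ ≤ 0)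
    (hτ' : τ' ≤ 0) (hz : (z.1 + a, z.2 + τ) ∈ cylQ n r) (hz' : (z.1 + a', z.2 + τ') ∈ cylQ n r) :
    HasParJet (fun w => c * (v (w.1 + a, w.2 + τ) - v (w.1 + a', w.2 + τ'))) z
      (c * (vt (z.1 + a, z.2 + τ) - vt (z.1 + a', z.2 + τ')))
      (fun σ => ∑ j, σ j * (c * (P j (z.1 + a, z.2 + τ) - P j (z.1 + a', z.2 + τ'))))
      (fun σ => ∑ i, ∑ j, σ i * σ j *
        (c * (H i j (z.1 + a, z.2 + τ) - H i j (z.1 + a', z.2 + τ')))) := by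
  refine (((h.hasParJet hz).shift hτ).quot c ((h.hasParJet hz').shift hτ')).congr rfl
    (fun σ => ?_) (fun σ => ?_)
  · rw [← Finset.sum_sub_distrib, Finset.mul_sum]
    exact Finset.sum_congr rfl fun i _ => by ring
  · rw [← Finset.sum_sub_distrib, Finset.mul_sum]
    refine Finset.sum_congr rfl fun i _ => ?_
    rw [← Finset.sum_sub_distrib, Finset.mul_sum]
    exact Finset.sum_congr rfl fun j _ => by ring

end IsClassicalSol

section Quadratic

variable {n : ℕ} {a : Matrix (Fin n) (Fin n) ℝ} {σ : Fin n → EuclideanSpace ℝ (Fin n)}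

lemma sum_sum_mul_eq_of_factor (hσ : ∀ i j, a i j = ∑ k, σ k i * σ k j)
    (X : Fin n → Fin n → ℝ) :
    ∑ k, ∑ i, ∑ j, σ k i * σ k j * X i j = ∑ i, ∑ j, a i j * X i j := by
  rw [Finset.sum_comm]
  refine Finset.sum_congr rfl fun i _ => ?_
  rw [Finset.sum_comm]
  refine Finset.sum_congr rfl fun j _ => ?_
  rw [hσ, Finset.sum_mul]

lemma sum_sq_eq_of_factor (hσ : ∀ i j, a i j = ∑ k, σ k i * σ k j) (p : Fin n → ℝ) :
    ∑ k, (∑ j, σ k j * p j) ^ 2 = ∑ i, ∑ j, a i j * p i * p j := by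
  have := sum_sum_mul_eq_of_factor hσ fun i j => p i * p j
  simp only [← mul_assoc] at this
  rw [← this]
  refine Finset.sum_congr rfl fun k _ => ?_
  rw [sq, Finset.sum_mul_sum]
  exact Finset.sum_congr rfl fun i _ => Finset.sum_congr rfl fun j _ => by ring

lemma sum_norm_sq_eq_of_factor (hσ : ∀ i j, a i j = ∑ k, σ k i * σ k j) :
    ∑ k, ‖σ k‖ ^ 2 = ∑ i, a i i := by
  simp only [EuclideanSpace.norm_sq_eq, Real.norm_eq_abs, sq_abs]
  rw [Finset.sum_comm]
  exact Finset.sum_congr rfl fun i _ => by rw [hσ]; exact Finset.sum_congr rfl fun k _ => by ring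

end Quadratic

lemma parOp_eq_of_factor {n : ℕ} {a : Matrix (Fin n) (Fin n) ℝ}
    {σ : Fin n → EuclideanSpace ℝ (Fin n)} (hσ : ∀ i j, a i j = ∑ k, σ k i * σ k j)
    (b : Fin n → ℝ) (ft : ℝ) (p : Fin n → ℝ) (X : Fin n → Fin n → ℝ) :
    parOp σ (WithLp.toLp 2 b) ft (fun τ => ∑ j, τ j * p j) (fun τ => ∑ i, ∑ j, τ i * τ j * X i j) =
      ft - ∑ i, ∑ j, a i j * X i j - ∑ j, b j * p j := by
  simp only [parOp]
  rw [sum_sum_mul_eq_of_factor hσ]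

lemma norm_toLp_le_mul {n : ℕ} {b : Fin n → ℝ} {Γ : ℝ} (hΓ : 0 ≤ Γ) (hb : ∀ j, |b j| ≤ Γ) :
    ‖WithLp.toLp 2 b‖ ≤ n * Γ := by
  have h1 : ‖WithLp.toLp 2 b‖ ^ 2 ≤ n * Γ ^ 2 := by
    rw [EuclideanSpace.norm_sq_eq]
    calc ∑ i, ‖b i‖ ^ 2 ≤ ∑ _i : Fin n, Γ ^ 2 := by
          refine Finset.sum_le_sum fun i _ => ?_
          rw [Real.norm_eq_abs]
          gcongr
          exact hb i
      _ = n * Γ ^ 2 := by simp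
  rcases Nat.eq_zero_or_pos n with rfl | hn
  · simp [Subsingleton.elim (WithLp.toLp 2 b) 0]
  have hn1 : (1 : ℝ) ≤ n := by exact_mod_cast hn
  refine le_of_sq_le_sq ?_ (by positivity)
  nlinarith [mul_nonneg (sub_nonneg.2 hn1) (mul_nonneg (zero_le_one.trans hn1) (sq_nonneg Γ))]

/-- The backward difference quotient in time. -/
def timeQuot {n : ℕ} (h : ℝ) (v : EuclideanSpace ℝ (Fin n) × ℝ → ℝ)
    (z : EuclideanSpace ℝ (Fin n) × ℝ) : ℝ := h⁻¹ * (v z - v (z.1, z.2 - h))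

/-- The forward difference quotient in the `k`-th coordinate direction. -/
def spaceQuot {n : ℕ} (h : ℝ) (k : Fin n) (v : EuclideanSpace ℝ (Fin n) × ℝ → ℝ)
    (z : EuclideanSpace ℝ (Fin n) × ℝ) : ℝ :=
  h⁻¹ * (v (z.1 + h • EuclideanSpace.single k 1, z.2) - v z)

lemma continuousOn_timeQuot {n : ℕ} {v : EuclideanSpace ℝ (Fin n) × ℝ → ℝ}
    {S T : Set (EuclideanSpace ℝ (Fin n) × ℝ)} (hv : ContinuousOn v S)
    {s : ℝ} (h1 : T ⊆ S) (h2 : ∀ z ∈ T, (z.1, z.2 - s) ∈ S) : ContinuousOn (timeQuot s v) T := by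
  unfold timeQuot
  exact continuousOn_const.mul ((hv.mono h1).sub
    (hv.comp (f := fun z : EuclideanSpace ℝ (Fin n) × ℝ => (z.1, z.2 - s)) (by fun_prop) h2))

lemma continuousOn_spaceQuot {n : ℕ} {v : EuclideanSpace ℝ (Fin n) × ℝ → ℝ}
    {S T : Set (EuclideanSpace ℝ (Fin n) × ℝ)} (hv : ContinuousOn v S)
    {s : ℝ} {k : Fin n} (h1 : T ⊆ S)
    (h2 : ∀ z ∈ T, (z.1 + s • EuclideanSpace.single k 1, z.2) ∈ S) :
    ContinuousOn (spaceQuot s k v) T := by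
  unfold spaceQuot
  exact continuousOn_const.mul ((hv.comp (f := fun z : EuclideanSpace ℝ (Fin n) × ℝ =>
    (z.1 + s • EuclideanSpace.single k (1 : ℝ), z.2)) (by fun_prop) h2).sub (hv.mono h1))

lemma parOp_comb {n : ℕ} {ι : Type*} (s : Finset ι) (σ : Fin n → EuclideanSpace ℝ (Fin n))
    (b : EuclideanSpace ℝ (Fin n)) (μ₁ μ₂ a c : ℝ) (d : ι → ℝ)
    (a₁ a₂ c₁ c₂ : EuclideanSpace ℝ (Fin n) → ℝ) (d₁ d₂ : ι → EuclideanSpace ℝ (Fin n) → ℝ) :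
    parOp σ b (a + μ₁ * ∑ k ∈ s, d k + μ₂ * c)
      (fun τ => a₁ τ + μ₁ * ∑ k ∈ s, d₁ k τ + μ₂ * c₁ τ)
      (fun τ => a₂ τ + μ₁ * ∑ k ∈ s, d₂ k τ + μ₂ * c₂ τ) =
    parOp σ b a a₁ a₂ + μ₁ * ∑ k ∈ s, parOp σ b (d k) (d₁ k) (d₂ k)
      + μ₂ * parOp σ b c c₁ c₂ := by
  simp only [parOp, Finset.sum_add_distrib, Finset.sum_sub_distrib, ← Finset.mul_sum]
  rw [Finset.sum_comm (s := Finset.univ)]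
  ring

lemma abs_quot_source_le {n : ℕ} {S : Set (EuclideanSpace ℝ (Fin n))} {lam Γ N h : ℝ}
    {α : EuclideanSpace ℝ (Fin n) → Matrix (Fin n) (Fin n) ℝ}
    {β : EuclideanSpace ℝ (Fin n) → Fin n → ℝ} {γ g : EuclideanSpace ℝ (Fin n) → ℝ}
    (hc : CoeffBound S lam Γ α β γ) (hg : ∀ x ∈ S, ∀ y ∈ S, |g x - g y| ≤ N * ‖x - y‖)
    (hh : 0 < h) {x y : EuclideanSpace ℝ (Fin n)} (hx : x ∈ S) (hy : y ∈ S) (hxy : ‖y - x‖ = h)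
    {t₁ t₀ v₁ v₀ : ℝ} {P₁ P₀ : Fin n → ℝ} {H₁ H₀ : Fin n → Fin n → ℝ}
    (e₁ : t₁ = ∑ i, ∑ j, α y i j * H₁ i j + ∑ j, β y j * P₁ j - γ y * v₁ + g y)
    (e₀ : t₀ = ∑ i, ∑ j, α x i j * H₀ i j + ∑ j, β x j * P₀ j - γ x * v₀ + g x) :
    |h⁻¹ * (t₁ - t₀) - ∑ i, ∑ j, α x i j * (h⁻¹ * (H₁ i j - H₀ i j))
        - ∑ j, β x j * (h⁻¹ * (P₁ j - P₀ j))| ≤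
      Γ * ∑ i, ∑ j, |H₁ i j| + Γ * ∑ j, |P₁ j| + Γ * |v₁| + Γ * |h⁻¹ * (v₁ - v₀)| + N := by
  have hq : ∀ {C : ℝ} {f : EuclideanSpace ℝ (Fin n) → ℝ},
      (∀ x ∈ S, ∀ y ∈ S, |f x - f y| ≤ C * ‖x - y‖) → |h⁻¹ * (f y - f x)| ≤ C := by
    intro C f hf
    rw [abs_mul, abs_of_pos (inv_pos.2 hh), inv_mul_le_iff₀ hh, mul_comm h, ← hxy]
    exact hf y hy x hx
  have hsplit : h⁻¹ * (t₁ - t₀) - ∑ i, ∑ j, α x i j * (h⁻¹ * (H₁ i j - H₀ i j))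
        - ∑ j, β x j * (h⁻¹ * (P₁ j - P₀ j)) =
      ∑ i, ∑ j, h⁻¹ * (α y i j - α x i j) * H₁ i j + ∑ j, h⁻¹ * (β y j - β x j) * P₁ j
        - h⁻¹ * (γ y - γ x) * v₁ - γ x * (h⁻¹ * (v₁ - v₀)) + h⁻¹ * (g y - g x) := by
    rw [e₁, e₀]
    have h1 : ∑ i, ∑ j, α x i j * (h⁻¹ * (H₁ i j - H₀ i j)) =
        h⁻¹ * (∑ i, ∑ j, α x i j * H₁ i j - ∑ i, ∑ j, α x i j * H₀ i j) := by
      simp only [← Finset.sum_sub_distrib, Finset.mul_sum]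
      exact Finset.sum_congr rfl fun i _ => Finset.sum_congr rfl fun j _ => by ring
    have h2 : ∑ i, ∑ j, h⁻¹ * (α y i j - α x i j) * H₁ i j =
        h⁻¹ * (∑ i, ∑ j, α y i j * H₁ i j - ∑ i, ∑ j, α x i j * H₁ i j) := by
      simp only [← Finset.sum_sub_distrib, Finset.mul_sum]
      exact Finset.sum_congr rfl fun i _ => Finset.sum_congr rfl fun j _ => by ring
    have h3 : ∑ j, β x j * (h⁻¹ * (P₁ j - P₀ j)) =
        h⁻¹ * (∑ j, β x j * P₁ j - ∑ j, β x j * P₀ j) := by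
      simp only [← Finset.sum_sub_distrib, Finset.mul_sum]
      exact Finset.sum_congr rfl fun j _ => by ring
    have h4 : ∑ j, h⁻¹ * (β y j - β x j) * P₁ j =
        h⁻¹ * (∑ j, β y j * P₁ j - ∑ j, β x j * P₁ j) := by
      simp only [← Finset.sum_sub_distrib, Finset.mul_sum]
      exact Finset.sum_congr rfl fun j _ => by ring
    rw [h1, h2, h3, h4]
    ring
  have k1 : |∑ i, ∑ j, h⁻¹ * (α y i j - α x i j) * H₁ i j| ≤ Γ * ∑ i, ∑ j, |H₁ i j| := by
    simp only [Finset.mul_sum]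
    refine (Finset.abs_sum_le_sum_abs _ _).trans (Finset.sum_le_sum fun i _ => ?_)
    refine (Finset.abs_sum_le_sum_abs _ _).trans (Finset.sum_le_sum fun j _ => ?_)
    rw [abs_mul]
    gcongr
    exact hq (hc.bddA i j).2
  have k2 : |∑ j, h⁻¹ * (β y j - β x j) * P₁ j| ≤ Γ * ∑ j, |P₁ j| := by
    simp only [Finset.mul_sum]
    refine (Finset.abs_sum_le_sum_abs _ _).trans (Finset.sum_le_sum fun j _ => ?_)
    rw [abs_mul]
    gcongr
    exact hq (hc.bddB j).2
  have k3 : |h⁻¹ * (γ y - γ x) * v₁| ≤ Γ * |v₁| := by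
    rw [abs_mul]
    gcongr
    exact hq hc.bddC.2
  have k4 : |γ x * (h⁻¹ * (v₁ - v₀))| ≤ Γ * |h⁻¹ * (v₁ - v₀)| := by
    rw [abs_mul]
    gcongr
    exact hc.bddC.1 x hx
  have k5 := hq hg
  rw [hsplit]
  rw [abs_le] at *
  constructor <;> linarith

namespace IsClassicalSol

variable {n : ℕ} {r : ℝ} {α : EuclideanSpace ℝ (Fin n) → Matrix (Fin n) (Fin n) ℝ}
  {β : EuclideanSpace ℝ (Fin n) → Fin n → ℝ} {γ g : EuclideanSpace ℝ (Fin n) → ℝ}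
  {v vt : EuclideanSpace ℝ (Fin n) × ℝ → ℝ}
  {P : Fin n → EuclideanSpace ℝ (Fin n) × ℝ → ℝ}
  {H : Fin n → Fin n → EuclideanSpace ℝ (Fin n) × ℝ → ℝ}

lemma hasParJet_timeQuot (h : IsClassicalSol r α β γ g v vt P H) {s : ℝ} (hs : 0 ≤ s)
    {z : EuclideanSpace ℝ (Fin n) × ℝ} (hz : z ∈ cylQ n r) (hz' : (z.1, z.2 - s) ∈ cylQ n r) :
    HasParJet (timeQuot s v) z (timeQuot s vt z) (fun σ => ∑ j, σ j * timeQuot s (P j) z)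
      (fun σ => ∑ i, ∑ j, σ i * σ j * timeQuot s (H i j) z) := by
  have := h.hasParJet_quot s⁻¹ (z := z) (a := 0) (a' := 0) (τ := 0) (τ' := -s) le_rfl
    (by linarith) (by simpa using hz) (by simpa [sub_eq_add_neg] using hz')
  simp only [add_zero, Prod.mk.eta, ← sub_eq_add_neg] at this
  exact this

lemma hasParJet_spaceQuot (h : IsClassicalSol r α β γ g v vt P H) (s : ℝ) (k : Fin n)
    {z : EuclideanSpace ℝ (Fin n) × ℝ} (hz : z ∈ cylQ n r)
    (hz' : (z.1 + s • EuclideanSpace.single k 1, z.2) ∈ cylQ n r) :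
    HasParJet (spaceQuot s k v) z (spaceQuot s k vt z)
      (fun σ => ∑ j, σ j * spaceQuot s k (P j) z)
      (fun σ => ∑ i, ∑ j, σ i * σ j * spaceQuot s k (H i j) z) := by
  have := h.hasParJet_quot s⁻¹ (z := z) (a := s • EuclideanSpace.single k 1) (a' := 0) (τ := 0)
    (τ' := 0) le_rfl le_rfl (by simpa using hz') (by simpa using hz)
  simp only [add_zero, Prod.mk.eta] at this
  exact this

end IsClassicalSol

section FixedStep

variable {n : ℕ} {lam Γ : ℝ} {α : EuclideanSpace ℝ (Fin n) → Matrix (Fin n) (Fin n) ℝ}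
  {β : EuclideanSpace ℝ (Fin n) → Fin n → ℝ} {γ g : EuclideanSpace ℝ (Fin n) → ℝ}
  {v vt : EuclideanSpace ℝ (Fin n) × ℝ → ℝ}
  {P : Fin n → EuclideanSpace ℝ (Fin n) × ℝ → ℝ}
  {H : Fin n → Fin n → EuclideanSpace ℝ (Fin n) × ℝ → ℝ}

/-- The difference quotients of step `h` are `ε`-close to the derivatives on the paraboloid. -/
structure QuotApprox (h ε : ℝ) (v vt : EuclideanSpace ℝ (Fin n) × ℝ → ℝ)
    (P : Fin n → EuclideanSpace ℝ (Fin n) × ℝ → ℝ)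
    (H : Fin n → Fin n → EuclideanSpace ℝ (Fin n) × ℝ → ℝ) : Prop where
  hess : ∀ z ∈ paraboloid n, ∀ a, ‖a‖ ≤ h → ∀ i j,
    |spaceQuot h j (P i) z - H i j (z.1 + a, z.2)| ≤ ε
  grad : ∀ z ∈ paraboloid n, ∀ a, ‖a‖ ≤ h → ∀ j,
    |spaceQuot h j v z - P j (z.1 + a, z.2)| ≤ ε
  time : ∀ z ∈ paraboloid n, |timeQuot h v z - vt z| ≤ ε

lemma abs_eqn_le {S : Set (EuclideanSpace ℝ (Fin n))} {M N : ℝ} (hΓ : 0 ≤ Γ)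
    (hc : CoeffBound S lam Γ α β γ) {x : EuclideanSpace ℝ (Fin n)} (hx : x ∈ S)
    (hg : |g x| ≤ N) {t₀ v₀ : ℝ} (hv : |v₀| ≤ M) {p : Fin n → ℝ} {X : Fin n → Fin n → ℝ}
    (e : t₀ = ∑ i, ∑ j, α x i j * X i j + ∑ j, β x j * p j - γ x * v₀ + g x) :
    |t₀| ≤ Γ * ∑ i, ∑ j, |X i j| + Γ * ∑ j, |p j| + Γ * M + N := by
  have k1 : |∑ i, ∑ j, α x i j * X i j| ≤ Γ * ∑ i, ∑ j, |X i j| := by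
    simp only [Finset.mul_sum]
    refine (Finset.abs_sum_le_sum_abs _ _).trans (Finset.sum_le_sum fun i _ => ?_)
    refine (Finset.abs_sum_le_sum_abs _ _).trans (Finset.sum_le_sum fun j _ => ?_)
    rw [abs_mul]
    gcongr
    exact (hc.bddA i j).1 x hx
  have k2 : |∑ j, β x j * p j| ≤ Γ * ∑ j, |p j| := by
    simp only [Finset.mul_sum]
    refine (Finset.abs_sum_le_sum_abs _ _).trans (Finset.sum_le_sum fun j _ => ?_)
    rw [abs_mul]
    gcongr
    exact (hc.bddB j).1 x hx
  have k3 : |γ x * v₀| ≤ Γ * M := by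
    rw [abs_mul]
    gcongr
    exact hc.bddC.1 x hx
  rw [e]
  rw [abs_le] at *
  constructor <;> linarith

lemma exists_quot_bound (n : ℕ) (hn : 1 ≤ n) (hlam : 0 < lam) (hΓ : 0 ≤ Γ) :
    ∃ C : ℝ, ∀ (α : EuclideanSpace ℝ (Fin n) → Matrix (Fin n) (Fin n) ℝ)
      (β : EuclideanSpace ℝ (Fin n) → Fin n → ℝ) (γ g : EuclideanSpace ℝ (Fin n) → ℝ)
      (v vt : EuclideanSpace ℝ (Fin n) × ℝ → ℝ)
      (P : Fin n → EuclideanSpace ℝ (Fin n) × ℝ → ℝ)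
      (H : Fin n → Fin n → EuclideanSpace ℝ (Fin n) × ℝ → ℝ) (M N h ε : ℝ),
      CoeffBound (Metric.ball 0 2) lam Γ α β γ → IsClassicalSol 2 α β γ g v vt P H →
      BddLip (Metric.ball 0 2) N g → (∀ z ∈ cylQ n 2, |v z| ≤ M) →
      0 < h → h ≤ 1 / 2 → 0 ≤ ε → QuotApprox h ε v vt P H →
      ∀ z ∈ paraboloid n, parWeight z ^ 4 * timeQuot h v z ^ 2
        + ∑ k, parWeight z ^ 2 * spaceQuot h k v z ^ 2 ≤ C * (M ^ 2 + N ^ 2 + ε ^ 2) := by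
  have hn' : (0 : ℝ) < n := by exact_mod_cast hn
  obtain ⟨μ₁, μ₂, C, hμ₁, hμ₂, hμC, hmain⟩ := exists_bernstein_weights n hn hlam hΓ
    (4 + 136 * (n * Γ) + 8 * (n * Γ)) (by positivity)
  refine ⟨C, fun α β γ g v vt P H M N h ε hc hs hg hM hh hh2 hε ha => ?_⟩
  have hC0 : 0 ≤ C := hμ₂.trans hμC
  have h00 : (0 : EuclideanSpace ℝ (Fin n) × ℝ) ∈ cylQ n 2 := by simp [mem_cylQ]
  have hM0 : 0 ≤ M := (abs_nonneg _).trans (hM 0 h00)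
  have hN0 : 0 ≤ N := (abs_nonneg _).trans (hg.1 0 (by simp))
  have hek : ∀ k : Fin n, ‖h • EuclideanSpace.single k (1 : ℝ)‖ = h := fun k => by
    simp [norm_smul, abs_of_pos hh]
  have hshift : ∀ z ∈ paraboloid n, ∀ k : Fin n,
      (z.1 + h • EuclideanSpace.single k (1 : ℝ), z.2) ∈ cylQ n 2 := fun z hz k => by
    simpa using mem_cylQ_two_of_paraboloid hz (a := h • EuclideanSpace.single k (1 : ℝ)) (τ := 0)
      ((hek k).trans_le hh2) (by simp) le_rfl
  have htime : ∀ z ∈ paraboloid n, (z.1, z.2 - h) ∈ cylQ n 2 := fun z hz => by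
    simpa [sub_eq_add_neg] using mem_cylQ_two_of_paraboloid hz (a := 0) (τ := -h) (by simp)
      (by simpa [abs_of_pos hh] using hh2) (by linarith)
  obtain ⟨W, hW⟩ : ∃ W : EuclideanSpace ℝ (Fin n) × ℝ → ℝ, W = fun z =>
      parWeight z ^ 4 * timeQuot h v z ^ 2
        + μ₁ * ∑ k, parWeight z ^ 2 * spaceQuot h k v z ^ 2 + μ₂ * v z ^ 2 := ⟨_, rfl⟩
  have hcw : Continuous (parWeight (n := n)) := by unfold parWeight; fun_prop
  have hWc : ContinuousOn W (paraboloid n) := by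
    have c1 := continuousOn_timeQuot hs.cont paraboloid_subset_cylQ htime
    have c2 : ∀ k, ContinuousOn (spaceQuot h k v) (paraboloid n) := fun k =>
      continuousOn_spaceQuot hs.cont paraboloid_subset_cylQ fun z hz => hshift z hz k
    have c3 := hs.cont.mono (paraboloid_subset_cylQ (n := n))
    rw [hW]
    exact (((hcw.continuousOn.pow 4).mul (c1.pow 2)).add (continuousOn_const.mul
      (continuousOn_finsetSum _ fun k _ => (hcw.continuousOn.pow 2).mul ((c2 k).pow 2)))).add
      (continuousOn_const.mul (c3.pow 2))
  have hne : (paraboloid n).Nonempty := ⟨0, by simp [paraboloid, parWeight]⟩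
  obtain ⟨z, hz, hzm⟩ := (isCompact_paraboloid n).exists_isMaxOn hne hWc
  have hz2 := paraboloid_subset_cylQ hz
  have hWz : W z ≤ C * (M ^ 2 + N ^ 2 + ε ^ 2) := by
    have hv2 : v z ^ 2 ≤ M ^ 2 := by
      rw [← sq_abs]
      gcongr
      exact hM z hz2
    rcases hz.1.eq_or_lt with h0 | hpos
    · have : W z = μ₂ * v z ^ 2 := by simp [hW, ← h0]
      rw [this]
      calc μ₂ * v z ^ 2 ≤ C * M ^ 2 := by gcongr
        _ ≤ _ := by
          gcongr
          linarith [sq_nonneg N, sq_nonneg ε]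
    have hxS : z.1 ∈ Metric.ball (0 : EuclideanSpace ℝ (Fin n)) 2 := by
      simpa using (mem_cylQ.1 hz2).1
    obtain ⟨σ, hσ⟩ := exists_sum_mul_eq_of_nonneg (hc.symm z.1 hxS) fun ξ =>
      (by positivity : 0 ≤ lam * ∑ i, ξ i ^ 2).trans (hc.ellip z.1 hxS ξ)
    have hx1 : ‖z.1‖ ≤ 1 := by
      have := hz.1
      unfold parWeight at this
      nlinarith [norm_nonneg z.1, hz.2]
    have he1 : parWeight z ≤ 1 := by
      unfold parWeight
      linarith [hz.2, sq_nonneg ‖z.1‖]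
    have hT : ∑ k, ‖σ k‖ ^ 2 ≤ n * Γ := by
      rw [sum_norm_sq_eq_of_factor hσ]
      calc ∑ i, α z.1 i i ≤ ∑ _i : Fin n, Γ :=
            Finset.sum_le_sum fun i _ => (le_abs_self _).trans ((hc.bddA i i).1 z.1 hxS)
        _ = n * Γ := by simp
    have hB : ‖WithLp.toLp 2 (β z.1)‖ ≤ n * Γ :=
      norm_toLp_le_mul hΓ fun j => (hc.bddB j).1 z.1 hxS
    have j0 := hs.hasParJet_timeQuot hh.le hz2 (htime z hz)
    have jk := fun k => hs.hasParJet_spaceQuot h k hz2 (hshift z hz k)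
    have jv := hs.hasParJet hz2
    have jW := (j0.weight_pow_four_mul_sq.add ((HasParJet.sum Finset.univ
      fun k => (jk k).weight_sq_mul_sq).const_mul μ₁)).add (jv.sq.const_mul μ₂)
    have hop := jW.parOp_nonneg hpos hz.2 (fun w hw => by
      have := hzm hw
      rw [hW] at this
      exact this) σ
      (WithLp.toLp 2 (β z.1))
    rw [parOp_comb, parOp_sq] at hop
    have k0 := parOp_weight_pow_four_le (f := timeQuot h v z) (ft := timeQuot h vt z)
      (f₁ := fun τ => ∑ j, τ j * timeQuot h (P j) z)
      (f₂ := fun τ => ∑ i, ∑ j, τ i * τ j * timeQuot h (H i j) z) hx1 hpos.le he1 hT hB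
    have kk := fun k => parOp_weight_sq_le (f := spaceQuot h k v z) (ft := spaceQuot h k vt z)
      (f₁ := fun τ => ∑ j, τ j * spaceQuot h k (P j) z)
      (f₂ := fun τ => ∑ i, ∑ j, τ i * τ j * spaceQuot h k (H i j) z) hx1 hpos.le he1 hT hB
    rw [parOp_eq_of_factor hσ] at k0 hop
    simp only [parOp_eq_of_factor hσ, sum_sq_eq_of_factor hσ] at kk hop
    obtain ⟨S₀, hS₀⟩ : ∃ a : ℝ, a = timeQuot h vt z - ∑ i, ∑ j, α z.1 i j * timeQuot h (H i j) z
      - ∑ j, β z.1 j * timeQuot h (P j) z := ⟨_, rfl⟩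
    obtain ⟨S, hS⟩ : ∃ a : Fin n → ℝ, ∀ k, a k = spaceQuot h k vt z
      - ∑ i, ∑ j, α z.1 i j * spaceQuot h k (H i j) z
      - ∑ j, β z.1 j * spaceQuot h k (P j) z := ⟨_, fun k => rfl⟩
    obtain ⟨Sv, hSv⟩ : ∃ a : ℝ, a = vt z - ∑ i, ∑ j, α z.1 i j * H i j z
      - ∑ j, β z.1 j * P j z := ⟨_, rfl⟩
    rw [← hS₀] at k0
    simp only [← hS] at kk
    rw [← hSv] at hop
    have hdist : ∀ {a b : ℝ}, |a - b| ≤ ε → |b| ≤ |a| + ε := fun {a b} hab => by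
      have := abs_sub_abs_le_abs_sub b a
      rw [abs_sub_comm] at this
      linarith
    have hHsum : ∀ a, ‖a‖ ≤ h → Γ * ∑ i, ∑ j, |H i j (z.1 + a, z.2)| ≤
        Γ * ∑ i, ∑ j, (|spaceQuot h j (P i) z| + ε) := fun a hle => by
      gcongr with i _ j _
      exact hdist (ha.hess z hz a hle i j)
    have hPsum : ∀ a, ‖a‖ ≤ h → Γ * ∑ j, |P j (z.1 + a, z.2)| ≤
        Γ * ∑ j, (|spaceQuot h j v z| + ε) := fun a hle => by
      gcongr with j _
      exact hdist (ha.grad z hz a hle j)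
    have hH0 := hHsum 0 (by simpa using hh.le)
    have hP0 := hPsum 0 (by simpa using hh.le)
    simp only [add_zero, Prod.mk.eta] at hH0 hP0
    have hSvb : Sv = -(γ z.1 * v z) + g z.1 := by
      rw [hSv, hs.eqn z hz2]
      ring
    have hS₀b : S₀ = -(γ z.1 * timeQuot h v z) := by
      rw [hS₀]
      simp only [timeQuot]
      rw [hs.eqn z hz2, hs.eqn _ (htime z hz)]
      have h1 : ∑ i, ∑ j, α z.1 i j * (h⁻¹ * (H i j z - H i j (z.1, z.2 - h))) =
          h⁻¹ * (∑ i, ∑ j, α z.1 i j * H i j z - ∑ i, ∑ j, α z.1 i j * H i j (z.1, z.2 - h)) := by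
        simp only [← Finset.sum_sub_distrib, Finset.mul_sum]
        exact Finset.sum_congr rfl fun i _ => Finset.sum_congr rfl fun j _ => by ring
      have h2 : ∑ j, β z.1 j * (h⁻¹ * (P j z - P j (z.1, z.2 - h))) =
          h⁻¹ * (∑ j, β z.1 j * P j z - ∑ j, β z.1 j * P j (z.1, z.2 - h)) := by
        simp only [← Finset.sum_sub_distrib, Finset.mul_sum]
        exact Finset.sum_congr rfl fun j _ => by ring
      rw [h1, h2]
      ring
    have hSb : ∀ k, |S k| ≤ Γ * ∑ i, ∑ j, |H i j (z.1 + h • EuclideanSpace.single k 1, z.2)|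
        + Γ * ∑ j, |P j (z.1 + h • EuclideanSpace.single k 1, z.2)|
        + Γ * |v (z.1 + h • EuclideanSpace.single k 1, z.2)| + Γ * |spaceQuot h k v z| + N := by
      intro k
      rw [hS k]
      exact abs_quot_source_le hc hg.2 hh hxS
        (by simpa using (mem_cylQ.1 (hshift z hz k)).1) (by simpa using hek k)
        (hs.eqn _ (hshift z hz k)) (hs.eqn z hz2)
    have hell : ∀ ξ : Fin n → ℝ, lam * ∑ j, ξ j ^ 2 ≤ ∑ i, ∑ j, α z.1 i j * ξ i * ξ j :=
      hc.ellip z.1 hxS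
    have hfin := hmain (parWeight z) (timeQuot h v z) S₀ (v z) Sv M N ε
      (fun k => spaceQuot h k v z) S (fun j => P j z) (fun k j => spaceQuot h k (P j) z)
      hpos.le he1 hM0 hN0 hε (hM z hz2) ?_ ?_ ?_ ?_ ?_ ?_
    · rw [hW]
      exact hfin
    · rw [hS₀b, abs_neg, abs_mul]
      gcongr
      exact hc.bddC.1 z.1 hxS
    · rw [hSvb]
      refine (abs_add_le _ _).trans ?_
      rw [abs_neg, abs_mul]
      gcongr
      · exact hc.bddC.1 z.1 hxS
      · exact hM z hz2
      · exact hg.1 z.1 hxS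
    · intro j
      have := ha.grad z hz 0 (by simpa using hh.le) j
      rw [abs_sub_comm] at this
      simpa using hdist this
    · intro k
      have h1 := hHsum _ (hek k).le
      have h2 := hPsum _ (hek k).le
      have h3 := mul_le_mul_of_nonneg_left (hM _ (hshift z hz k)) hΓ
      exact (hSb k).trans (by linarith)
    · have h1 := ha.time z hz
      rw [abs_sub_comm] at h1
      have h2 := abs_eqn_le hΓ hc hxS (hg.1 z.1 hxS) (hM z hz2) (hs.eqn z hz2)
      have h3 := hdist h1
      linarith
    · have h1 := hell fun j => P j z
      have h2 := mul_le_mul_of_nonneg_left h1 hμ₂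
      have h3 := Finset.sum_le_sum fun k (_ : k ∈ Finset.univ) => (kk k).trans (show _ ≤
          2 * parWeight z ^ 2 * spaceQuot h k v z * S k - parWeight z ^ 2 *
            (lam * ∑ j, spaceQuot h k (P j) z ^ 2)
          + (4 + 136 * (n * Γ) + 8 * (n * Γ)) * spaceQuot h k v z ^ 2 by
        have := mul_le_mul_of_nonneg_left (hell fun j => spaceQuot h k (P j) z)
          (sq_nonneg (parWeight z))
        linarith)
      have h4 := mul_le_mul_of_nonneg_left h3 (zero_le_one.trans hμ₁)
      linarith
  intro w hw
  have hw1 : W w ≤ W z := hzm hw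
  have h1 : 0 ≤ ∑ k, parWeight w ^ 2 * spaceQuot h k v w ^ 2 := by positivity
  have h2 := mul_le_mul_of_nonneg_right hμ₁ h1
  have h3 : 0 ≤ μ₂ * v w ^ 2 := by positivity
  have h4 := hw1.trans hWz
  rw [hW] at h4
  linarith

end FixedStep

section Limit

variable {n : ℕ}

lemma exists_spaceQuot_eq {w Q : EuclideanSpace ℝ (Fin n) × ℝ → ℝ} {k : Fin n} {h : ℝ}
    (hh : 0 < h) {z : EuclideanSpace ℝ (Fin n) × ℝ}
    (hw : ∀ s ∈ Icc 0 h, HasDerivAt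
      (fun s' : ℝ => w (z.1 + s • EuclideanSpace.single k 1 + s' • EuclideanSpace.single k 1, z.2))
      (Q (z.1 + s • EuclideanSpace.single k 1, z.2)) 0) :
    ∃ θ ∈ Ioo 0 h, spaceQuot h k w z = Q (z.1 + θ • EuclideanSpace.single k 1, z.2) := by
  have hd : ∀ s ∈ Icc 0 h, HasDerivAt (fun s : ℝ => w (z.1 + s • EuclideanSpace.single k 1, z.2))
      (Q (z.1 + s • EuclideanSpace.single k 1, z.2)) s := fun s hs =>
    hasDerivAt_line (f := fun x => w (x, z.2)) (hw s hs)
  obtain ⟨θ, hθ, he⟩ := exists_hasDerivAt_eq_slope _ _ hh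
    (fun s hs => (hd s hs).continuousAt.continuousWithinAt) fun s hs => hd s (Ioo_subset_Icc_self hs)
  refine ⟨θ, hθ, ?_⟩
  rw [he]
  simp [spaceQuot, div_eq_inv_mul]

lemma exists_timeQuot_eq {w Q : EuclideanSpace ℝ (Fin n) × ℝ → ℝ} {h : ℝ}
    (hh : 0 < h) {z : EuclideanSpace ℝ (Fin n) × ℝ} (hz : z.2 ≤ 0)
    (hw : ∀ s ∈ Icc (z.2 - h) z.2,
      HasDerivWithinAt (fun s => w (z.1, s)) (Q (z.1, s)) (Iic 0) s) :
    ∃ θ ∈ Ioo 0 h, timeQuot h w z = Q (z.1, z.2 - θ) := by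
  obtain ⟨θ, hθ, he⟩ := exists_hasDerivAt_eq_slope (fun s => w (z.1, s)) (fun s => Q (z.1, s))
    (sub_lt_self z.2 hh)
    (fun s hs => (hw s hs).continuousWithinAt.mono fun s hs => hs.2.trans hz)
    fun s hs => (hw s (Ioo_subset_Icc_self hs)).hasDerivAt (Iic_mem_nhds (hs.2.trans_le hz))
  refine ⟨z.2 - θ, ⟨by linarith [hθ.2], by linarith [hθ.1]⟩, ?_⟩
  rw [sub_sub_cancel, he]
  simp [timeQuot, div_eq_inv_mul]

lemma eventually_abs_sub_le {f : EuclideanSpace ℝ (Fin n) × ℝ → ℝ} {K S : Set _}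
    (hf : ContinuousOn f S) (hK : IsCompact K) (hKS : K ⊆ S) {ε : ℝ} (hε : 0 < ε) :
    ∀ᶠ h in 𝓝[>] (0 : ℝ), ∀ z ∈ K, ∀ w ∈ K, ‖z.1 - w.1‖ ≤ 2 * h → |z.2 - w.2| ≤ 2 * h →
      |f z - f w| ≤ ε := by
  have hu := hK.uniformContinuousOn_of_continuous (hf.mono hKS)
  obtain ⟨δ, hδ, hfδ⟩ := Metric.uniformContinuousOn_iff.1 hu ε hε
  filter_upwards [Ioo_mem_nhdsGT (half_pos hδ)] with h hh z hz w hw h1 h2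
  refine (hfδ z hz w hw ?_).le
  rw [Prod.dist_eq, max_lt_iff, dist_eq_norm, Real.dist_eq]
  constructor <;> linarith [hh.2]

variable {lam Γ : ℝ} {α : EuclideanSpace ℝ (Fin n) → Matrix (Fin n) (Fin n) ℝ}
  {β : EuclideanSpace ℝ (Fin n) → Fin n → ℝ} {γ g : EuclideanSpace ℝ (Fin n) → ℝ}
  {v vt : EuclideanSpace ℝ (Fin n) × ℝ → ℝ}
  {P : Fin n → EuclideanSpace ℝ (Fin n) × ℝ → ℝ}
  {H : Fin n → Fin n → EuclideanSpace ℝ (Fin n) × ℝ → ℝ}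

lemma IsClassicalSol.eventually_quotApprox (hs : IsClassicalSol 2 α β γ g v vt P H) {ε : ℝ}
    (hε : 0 < ε) : ∀ᶠ h in 𝓝[>] (0 : ℝ), QuotApprox h ε v vt P H := by
  have hK : IsCompact (Metric.closedBall (0 : EuclideanSpace ℝ (Fin n)) (3 / 2) ×ˢ
      Icc (-2 : ℝ) 0) := (isCompact_closedBall _ _).prod isCompact_Icc
  have hKS : Metric.closedBall (0 : EuclideanSpace ℝ (Fin n)) (3 / 2) ×ˢ Icc (-2 : ℝ) 0 ⊆
      cylQ n 2 := by
    rintro z ⟨h1, h2, h3⟩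
    rw [mem_closedBall_zero_iff] at h1
    exact mem_cylQ.2 ⟨by linarith, by linarith, h3⟩
  have hmem : ∀ z ∈ paraboloid n, ∀ (a : EuclideanSpace ℝ (Fin n)) (τ : ℝ), ‖a‖ ≤ 1 / 2 →
      0 ≤ τ → τ ≤ 1 / 2 → (z.1 + a, z.2 - τ) ∈
        Metric.closedBall (0 : EuclideanSpace ℝ (Fin n)) (3 / 2) ×ˢ Icc (-2 : ℝ) 0 := by
    rintro z ⟨h1, h2⟩ a τ ha h0 hτ
    unfold parWeight at h1
    have h3 := norm_add_le z.1 a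
    have h4 : ‖z.1‖ ≤ 1 := by nlinarith [norm_nonneg z.1]
    have h5 := sq_nonneg ‖z.1‖
    refine ⟨?_, ?_, ?_⟩
    · rw [mem_closedBall_zero_iff]
      dsimp only
      linarith
    · dsimp only
      linarith
    · dsimp only
      linarith
  filter_upwards [Ioo_mem_nhdsGT (show (0 : ℝ) < 1 / 2 by norm_num),
    eventually_abs_sub_le hs.cont_t hK hKS hε,
    eventually_all.2 fun j => eventually_abs_sub_le (hs.cont_P j) hK hKS hε,
    eventually_all.2 fun i => eventually_all.2 fun j =>
      eventually_abs_sub_le (hs.cont_H i j) hK hKS hε] with h hh ht hP hH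
  have hnorm : ∀ (k : Fin n) (s : ℝ), 0 ≤ s → ‖s • EuclideanSpace.single k (1 : ℝ)‖ = s :=
    fun k s hs => by simp [norm_smul, abs_of_nonneg hs]
  have hspace : ∀ {w : EuclideanSpace ℝ (Fin n) × ℝ → ℝ}
      {Q : Fin n → EuclideanSpace ℝ (Fin n) × ℝ → ℝ},
      (∀ z ∈ cylQ n 2, ∀ σ : EuclideanSpace ℝ (Fin n),
        HasDerivAt (fun s : ℝ => w (z.1 + s • σ, z.2)) (∑ j, σ j * Q j z) 0) →
      (∀ j, ∀ z ∈ Metric.closedBall (0 : EuclideanSpace ℝ (Fin n)) (3 / 2) ×ˢ Icc (-2 : ℝ) 0,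
        ∀ z' ∈ Metric.closedBall (0 : EuclideanSpace ℝ (Fin n)) (3 / 2) ×ˢ Icc (-2 : ℝ) 0,
        ‖z.1 - z'.1‖ ≤ 2 * h → |z.2 - z'.2| ≤ 2 * h → |Q j z - Q j z'| ≤ ε) →
      ∀ z ∈ paraboloid n, ∀ a, ‖a‖ ≤ h → ∀ j, |spaceQuot h j w z - Q j (z.1 + a, z.2)| ≤ ε := by
    intro w Q hw hQ z hz a ha j
    obtain ⟨θ, hθ, he⟩ := exists_spaceQuot_eq (w := w) (Q := Q j) (k := j) hh.1 (z := z)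
      fun s hs => by
        have h1 := hw (z.1 + s • EuclideanSpace.single j (1 : ℝ), z.2) (hKS (by
          simpa using hmem z hz (s • EuclideanSpace.single j 1) 0
            ((hnorm j s hs.1).trans_le (by linarith [hs.2, hh.2])) le_rfl (by norm_num)))
          (EuclideanSpace.single j 1)
        refine h1.congr_deriv ?_
        simp [PiLp.single_apply]
    rw [he]
    refine hQ j _ ?_ _ ?_ ?_ ?_
    · simpa using hmem z hz (θ • EuclideanSpace.single j 1) 0
        ((hnorm j θ hθ.1.le).trans_le (by linarith [hθ.2, hh.2])) le_rfl (by norm_num)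
    · simpa using hmem z hz a 0 (by linarith [hh.2]) le_rfl (by norm_num)
    · dsimp only
      rw [add_sub_add_left_eq_sub]
      refine (norm_sub_le _ _).trans ?_
      rw [hnorm j θ hθ.1.le]
      linarith [hθ.2]
    · simpa using hh.1.le
  refine ⟨fun z hz a ha i j => hspace (hs.hasH i) (hH i) z hz a ha j,
    hspace hs.hasP hP, fun z hz => ?_⟩
  obtain ⟨θ, hθ, he⟩ := exists_timeQuot_eq (w := v) (Q := vt) hh.1 hz.2 fun s hs' => by
    refine hs.has_t (z.1, s) (hKS ?_)
    have := hmem z hz 0 (z.2 - s) (by simp) (by linarith [hs'.2]) (by linarith [hs'.1, hh.2])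
    simpa using this
  rw [he]
  refine ht _ ?_ _ ?_ ?_ ?_
  · simpa using hmem z hz 0 θ (by simp) hθ.1.le (by linarith [hθ.2, hh.2])
  · simpa using hmem z hz 0 0 (by simp) le_rfl (by norm_num)
  · simpa using hh.1.le
  · dsimp only
    rw [sub_sub_cancel_left, abs_neg, abs_of_pos hθ.1]
    linarith [hθ.2, hh.1]

/-- Interior bounds for the time derivative and the gradient of a classical solution. -/
lemma exists_interior_deriv_bound (n : ℕ) (hn : 1 ≤ n) (hlam : 0 < lam) (hΓ : 0 ≤ Γ) :
    ∃ C : ℝ, 0 ≤ C ∧ ∀ (α : EuclideanSpace ℝ (Fin n) → Matrix (Fin n) (Fin n) ℝ)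
      (β : EuclideanSpace ℝ (Fin n) → Fin n → ℝ) (γ g : EuclideanSpace ℝ (Fin n) → ℝ)
      (v vt : EuclideanSpace ℝ (Fin n) × ℝ → ℝ)
      (P : Fin n → EuclideanSpace ℝ (Fin n) × ℝ → ℝ)
      (H : Fin n → Fin n → EuclideanSpace ℝ (Fin n) × ℝ → ℝ) (M N : ℝ),
      CoeffBound (Metric.ball 0 2) lam Γ α β γ → IsClassicalSol 2 α β γ g v vt P H →
      BddLip (Metric.ball 0 2) N g → (∀ z ∈ cylQ n 2, |v z| ≤ M) →
      ∀ z ∈ paraboloid n, parWeight z ^ 4 * vt z ^ 2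
        + ∑ k, parWeight z ^ 2 * P k z ^ 2 ≤ C * (M ^ 2 + N ^ 2) := by
  obtain ⟨C, hC⟩ := exists_quot_bound n hn hlam hΓ
  refine ⟨max C 0, le_max_right _ _, fun α β γ g v vt P H M N hc hs hg hM z hz => ?_⟩
  have hpos : ∀ᶠ h in 𝓝[>] (0 : ℝ), 0 < h ∧ h ≤ 1 / 2 := by
    filter_upwards [Ioo_mem_nhdsGT (show (0 : ℝ) < 1 / 2 by norm_num)] with h hh
      using ⟨hh.1, hh.2.le⟩
  have ht : Tendsto (fun h => timeQuot h v z) (𝓝[>] 0) (𝓝 (vt z)) := by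
    rw [Metric.tendsto_nhds]
    intro ε hε
    filter_upwards [hs.eventually_quotApprox (half_pos hε)] with h ha
    rw [Real.dist_eq]
    exact (ha.time z hz).trans_lt (half_lt_self hε)
  have hP : ∀ k, Tendsto (fun h => spaceQuot h k v z) (𝓝[>] 0) (𝓝 (P k z)) := by
    intro k
    rw [Metric.tendsto_nhds]
    intro ε hε
    filter_upwards [hs.eventually_quotApprox (half_pos hε), hpos] with h ha hh
    rw [Real.dist_eq]
    have := ha.grad z hz 0 (by simpa using hh.1.le) k
    rw [add_zero, Prod.mk.eta] at this
    exact this.trans_lt (half_lt_self hε)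
  have hlim := (((ht.pow 2).const_mul (parWeight z ^ 4)).add
    (tendsto_finsetSum Finset.univ fun k _ => ((hP k).pow 2).const_mul (parWeight z ^ 2)))
  have hε : ∀ ε > 0, parWeight z ^ 4 * vt z ^ 2 + ∑ k, parWeight z ^ 2 * P k z ^ 2 ≤
      C * (M ^ 2 + N ^ 2 + ε ^ 2) := fun ε hε => by
    refine le_of_tendsto hlim ?_
    filter_upwards [hs.eventually_quotApprox hε, hpos] with h ha hh
    exact hC α β γ g v vt P H M N h ε hc hs hg hM hh.1 hh.2 hε.le ha z hz
  have hlim2 : Tendsto (fun ε : ℝ => C * (M ^ 2 + N ^ 2 + ε ^ 2)) (𝓝[>] 0)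
      (𝓝 (C * (M ^ 2 + N ^ 2 + 0 ^ 2))) :=
    Continuous.tendsto (f := fun ε : ℝ => C * (M ^ 2 + N ^ 2 + ε ^ 2)) (by fun_prop) 0 |>.mono_left
      nhdsWithin_le_nhds
  have h1 := ge_of_tendsto hlim2 (by filter_upwards [self_mem_nhdsWithin] with ε hε' using hε ε hε')
  refine h1.trans ?_
  rw [zero_pow two_ne_zero, add_zero]
  gcongr
  exact le_max_left _ _

end Limit

section Oscillation

variable {n : ℕ} {lam Γ : ℝ} {α : EuclideanSpace ℝ (Fin n) → Matrix (Fin n) (Fin n) ℝ}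
  {β : EuclideanSpace ℝ (Fin n) → Fin n → ℝ} {γ g : EuclideanSpace ℝ (Fin n) → ℝ}
  {v vt : EuclideanSpace ℝ (Fin n) × ℝ → ℝ}
  {P : Fin n → EuclideanSpace ℝ (Fin n) × ℝ → ℝ}
  {H : Fin n → Fin n → EuclideanSpace ℝ (Fin n) × ℝ → ℝ}

lemma exists_center_oscillation_bound (n : ℕ) (hn : 1 ≤ n) (hlam : 0 < lam) (hΓ : 0 ≤ Γ) :
    ∃ C : ℝ, 0 ≤ C ∧ ∀ (α : EuclideanSpace ℝ (Fin n) → Matrix (Fin n) (Fin n) ℝ)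
      (β : EuclideanSpace ℝ (Fin n) → Fin n → ℝ) (γ g : EuclideanSpace ℝ (Fin n) → ℝ)
      (v vt : EuclideanSpace ℝ (Fin n) × ℝ → ℝ)
      (P : Fin n → EuclideanSpace ℝ (Fin n) × ℝ → ℝ)
      (H : Fin n → Fin n → EuclideanSpace ℝ (Fin n) × ℝ → ℝ) (M N : ℝ),
      CoeffBound (Metric.ball 0 2) lam Γ α β γ → IsClassicalSol 2 α β γ g v vt P H →
      BddLip (Metric.ball 0 2) N g → (∀ z ∈ cylQ n 2, |v z| ≤ M) →
      ∀ z : EuclideanSpace ℝ (Fin n) × ℝ, ‖z.1‖ ≤ 1 / 2 → -(1 / 4) ≤ z.2 → z.2 ≤ 0 →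
        |v z - v 0| ≤ C * (M + N) * (‖z.1‖ + -z.2) := by
  obtain ⟨C, hC0, hC⟩ := exists_interior_deriv_bound n hn hlam hΓ
  refine ⟨n * (4 * √C) + 4 * √C, by positivity,
    fun α β γ g v vt P H M N hc hs hg hM z hz1 hz2 hz3 => ?_⟩
  have hM0 : 0 ≤ M := (abs_nonneg _).trans (hM 0 (by simp [mem_cylQ]))
  have hN0 : 0 ≤ N := (abs_nonneg _).trans (hg.1 0 (by simp))
  obtain ⟨L, hL⟩ : ∃ L : ℝ, L = 4 * √C * (M + N) := ⟨_, rfl⟩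
  have hL0 : 0 ≤ L := by rw [hL]; positivity
  have hL2 : 16 * (C * (M ^ 2 + N ^ 2)) ≤ L ^ 2 := by
    have : L ^ 2 = 16 * (C * (M + N) ^ 2) := by
      rw [hL, mul_pow, mul_pow, Real.sq_sqrt hC0]; ring
    rw [this]
    gcongr
    nlinarith [mul_nonneg hM0 hN0]
  have hreg : ∀ w : EuclideanSpace ℝ (Fin n) × ℝ, ‖w.1‖ ≤ 1 / 2 → -(1 / 4) ≤ w.2 → w.2 ≤ 0 →
      w ∈ cylQ n 2 ∧ |vt w| ≤ L ∧ ∀ k, |P k w| ≤ L := by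
    intro w h1 h2 h3
    have hw : 1 / 2 ≤ parWeight w := by
      unfold parWeight
      nlinarith [norm_nonneg w.1]
    have hb := hC α β γ g v vt P H M N hc hs hg hM w ⟨by linarith, h3⟩
    have hw2 : 1 / 4 ≤ parWeight w ^ 2 := by nlinarith
    have hw4 : 1 / 16 ≤ parWeight w ^ 4 := by nlinarith
    have ht0 : 0 ≤ parWeight w ^ 4 * vt w ^ 2 := by positivity
    have hk0 : ∀ k, 0 ≤ parWeight w ^ 2 * P k w ^ 2 := fun k => by positivity
    have hS0 := Finset.sum_nonneg fun k (_ : k ∈ Finset.univ) => hk0 k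
    refine ⟨mem_cylQ.2 ⟨by linarith, by linarith, h3⟩, ?_, fun k => ?_⟩
    · refine abs_le_of_sq_le_sq ?_ hL0
      have := mul_le_mul_of_nonneg_right hw4 (sq_nonneg (vt w))
      linarith
    · refine abs_le_of_sq_le_sq ?_ hL0
      have h4 := Finset.single_le_sum (fun k (_ : k ∈ Finset.univ) => hk0 k) (Finset.mem_univ k)
      have := mul_le_mul_of_nonneg_right hw2 (sq_nonneg (P k w))
      have h5 := sq_nonneg (P k w)
      linarith
  have htime : |v (0, z.2) - v 0| ≤ L * -z.2 := by
    have h1 := (convex_Icc (-(1 / 4) : ℝ) 0).norm_image_sub_le_of_norm_hasDerivWithin_le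
      (f := fun s => v ((0 : EuclideanSpace ℝ (Fin n)), s)) (f' := fun s => vt (0, s)) (C := L)
      (fun s hs' => (hs.has_t (0, s) (hreg (0, s) (by simp) hs'.1 hs'.2).1).mono fun _ h => h.2)
      (fun s hs' => (hreg (0, s) (by simp) hs'.1 hs'.2).2.1) (x := 0) (y := z.2)
      ⟨by norm_num, le_rfl⟩ ⟨hz2, hz3⟩
    rw [Real.norm_eq_abs, Real.norm_eq_abs, sub_zero, abs_of_nonpos hz3] at h1
    exact h1
  have hspace : |v z - v (0, z.2)| ≤ n * L * ‖z.1‖ := by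
    have hsn : ∀ s ∈ Icc (0 : ℝ) 1, ‖s • z.1‖ ≤ 1 / 2 := fun s hs' => by
      rw [norm_smul, Real.norm_eq_abs, abs_of_nonneg hs'.1]
      nlinarith [norm_nonneg z.1, hs'.1, hs'.2]
    have h1 := (convex_Icc (0 : ℝ) 1).norm_image_sub_le_of_norm_hasDerivWithin_le
      (f := fun s : ℝ => v (0 + s • z.1, z.2)) (f' := fun s : ℝ => ∑ j, z.1 j * P j (s • z.1, z.2))
      (C := n * L * ‖z.1‖)
      (fun s hs' => (hasDerivAt_line (f := fun x => v (x, z.2)) (by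
        have := hs.hasP (s • z.1, z.2) (hreg (s • z.1, z.2) (hsn s hs') hz2 hz3).1 z.1
        simpa using this)).hasDerivWithinAt)
      (fun s hs' => by
        refine (norm_sum_le _ _).trans ?_
        calc ∑ j, ‖z.1 j * P j (s • z.1, z.2)‖ ≤ ∑ _j : Fin n, ‖z.1‖ * L := by
              refine Finset.sum_le_sum fun j _ => ?_
              rw [norm_mul]
              gcongr
              · exact PiLp.norm_apply_le z.1 j
              · exact (hreg (s • z.1, z.2) (hsn s hs') hz2 hz3).2.2 j
          _ = n * L * ‖z.1‖ := by
            simp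
            ring) (x := 0) (y := 1) (by simp) (by simp)
    simpa using h1
  have h3 : |v z - v 0| ≤ n * L * ‖z.1‖ + L * -z.2 := by
    have := abs_add_le (v z - v (0, z.2)) (v (0, z.2) - v 0)
    rw [sub_add_sub_cancel] at this
    linarith
  refine h3.trans ?_
  have h4 : (n * (4 * √C) + 4 * √C) * (M + N) = n * L + L := by rw [hL]; ring
  rw [h4]
  have h5 : 0 ≤ n * L * -z.2 := mul_nonneg (by positivity) (by linarith)
  have h6 : 0 ≤ L * ‖z.1‖ := by positivity
  linarith

/-- Parabolic rescaling of a classical solution. -/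
lemma IsClassicalSol.rescale {R : ℝ} (hs : IsClassicalSol R α β γ g v vt P H)
    (z₀ : EuclideanSpace ℝ (Fin n) × ℝ) {κ : ℝ} (hz₀ : z₀.2 ≤ 0)
    (hsub : ∀ z ∈ cylQ n 2, (z₀.1 + κ • z.1, z₀.2 + κ ^ 2 * z.2) ∈ cylQ n R) :
    IsClassicalSol 2 (fun x => α (z₀.1 + κ • x)) (fun x j => κ * β (z₀.1 + κ • x) j)
      (fun x => κ ^ 2 * γ (z₀.1 + κ • x)) (fun x => κ ^ 2 * g (z₀.1 + κ • x))
      (fun z => v (z₀.1 + κ • z.1, z₀.2 + κ ^ 2 * z.2))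
      (fun z => κ ^ 2 * vt (z₀.1 + κ • z.1, z₀.2 + κ ^ 2 * z.2))
      (fun i z => κ * P i (z₀.1 + κ • z.1, z₀.2 + κ ^ 2 * z.2))
      (fun i j z => κ ^ 2 * H i j (z₀.1 + κ • z.1, z₀.2 + κ ^ 2 * z.2)) := by
  have hcomp : ∀ {f : EuclideanSpace ℝ (Fin n) × ℝ → ℝ}, ContinuousOn f (cylQ n R) →
      ContinuousOn (fun z : EuclideanSpace ℝ (Fin n) × ℝ =>
        f (z₀.1 + κ • z.1, z₀.2 + κ ^ 2 * z.2)) (cylQ n 2) := fun {f} hf =>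
    hf.comp (f := fun z : EuclideanSpace ℝ (Fin n) × ℝ =>
      (z₀.1 + κ • z.1, z₀.2 + κ ^ 2 * z.2)) (by fun_prop) hsub
  have hline : ∀ (f : EuclideanSpace ℝ (Fin n) × ℝ → ℝ) (z : EuclideanSpace ℝ (Fin n) × ℝ)
      (σ : EuclideanSpace ℝ (Fin n)) (s : ℝ),
      f (z₀.1 + κ • (z.1 + s • σ), z₀.2 + κ ^ 2 * z.2) =
        f (z₀.1 + κ • z.1 + s • κ • σ, z₀.2 + κ ^ 2 * z.2) := fun f z σ s => by
    rw [smul_add, smul_comm κ s, add_assoc]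
  refine ⟨hcomp hs.cont, continuousOn_const.mul (hcomp hs.cont_t),
    fun i => continuousOn_const.mul (hcomp (hs.cont_P i)),
    fun i j => continuousOn_const.mul (hcomp (hs.cont_H i j)), fun z hz σ => ?_,
    fun i z hz σ => ?_, fun z hz => ?_, fun z hz => ?_⟩
  · simp only [hline]
    refine (hs.hasP _ (hsub z hz) (κ • σ)).congr_deriv (Finset.sum_congr rfl fun j _ => ?_)
    simp
    ring
  · simp only [hline]
    refine ((hs.hasH i _ (hsub z hz) (κ • σ)).const_mul κ).congr_deriv ?_
    rw [Finset.mul_sum]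
    refine Finset.sum_congr rfl fun j _ => ?_
    simp
    ring
  · have h1 : HasDerivWithinAt (fun s : ℝ => z₀.2 + κ ^ 2 * s) (κ ^ 2) (Iic 0) z.2 := by
      simpa using (((hasDerivAt_id z.2).const_mul (κ ^ 2)).const_add z₀.2).hasDerivWithinAt
    have hm : MapsTo (fun s : ℝ => z₀.2 + κ ^ 2 * s) (Iic 0) (Iic 0) := fun s hs => by
      have := mem_Iic.1 hs
      simp only [mem_Iic]
      nlinarith [sq_nonneg κ]
    have h2 := (hs.has_t _ (hsub z hz)).scomp z.2 h1 hm
    rw [smul_eq_mul] at h2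
    exact h2
  · beta_reduce
    rw [hs.eqn _ (hsub z hz)]
    have h1 : ∑ i, ∑ j, α (z₀.1 + κ • z.1) i j *
        (κ ^ 2 * H i j (z₀.1 + κ • z.1, z₀.2 + κ ^ 2 * z.2)) =
        κ ^ 2 * ∑ i, ∑ j, α (z₀.1 + κ • z.1) i j *
          H i j (z₀.1 + κ • z.1, z₀.2 + κ ^ 2 * z.2) := by
      simp only [Finset.mul_sum]
      exact Finset.sum_congr rfl fun i _ => Finset.sum_congr rfl fun j _ => by ring
    have h2 : ∑ j, κ * β (z₀.1 + κ • z.1) j *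
        (κ * P j (z₀.1 + κ • z.1, z₀.2 + κ ^ 2 * z.2)) =
        κ ^ 2 * ∑ j, β (z₀.1 + κ • z.1) j * P j (z₀.1 + κ • z.1, z₀.2 + κ ^ 2 * z.2) := by
      simp only [Finset.mul_sum]
      exact Finset.sum_congr rfl fun j _ => by ring
    rw [h1, h2]
    ring

lemma BddLip.rescale {S T : Set (EuclideanSpace ℝ (Fin n))} {C : ℝ} (hC : 0 ≤ C)
    {f : EuclideanSpace ℝ (Fin n) → ℝ} (hf : BddLip S C f) (x₀ : EuclideanSpace ℝ (Fin n))
    {κ c : ℝ} (hκ : 0 ≤ κ) (hκ1 : κ ≤ 1) (hc : 0 ≤ c) (h : ∀ x ∈ T, x₀ + κ • x ∈ S) :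
    BddLip T (c * C) fun x => c * f (x₀ + κ • x) := by
  refine ⟨fun x hx => ?_, fun x hx y hy => ?_⟩
  · rw [abs_mul, abs_of_nonneg hc]
    gcongr
    exact hf.1 _ (h x hx)
  · rw [← mul_sub, abs_mul, abs_of_nonneg hc, mul_assoc]
    gcongr
    refine (hf.2 _ (h x hx) _ (h y hy)).trans ?_
    rw [add_sub_add_left_eq_sub, ← smul_sub, norm_smul, Real.norm_eq_abs, abs_of_nonneg hκ]
    gcongr
    exact mul_le_of_le_one_left (norm_nonneg _) hκ1

lemma BddLip.mono_set {E : Type*} [NormedAddCommGroup E] {S T : Set E} {C : ℝ} {f : E → ℝ}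
    (hf : BddLip S C f) (h : T ⊆ S) : BddLip T C f :=
  ⟨fun x hx => hf.1 x (h hx), fun x hx y hy => hf.2 x (h hx) y (h hy)⟩

lemma BddLip.mono_const {S : Set (EuclideanSpace ℝ (Fin n))} {C C' : ℝ} (h : C ≤ C')
    {f : EuclideanSpace ℝ (Fin n) → ℝ} (hf : BddLip S C f) : BddLip S C' f :=
  ⟨fun x hx => (hf.1 x hx).trans h, fun x hx y hy => (hf.2 x hx y hy).trans (by gcongr)⟩

lemma CoeffBound.rescale {S T : Set (EuclideanSpace ℝ (Fin n))} (hΓ : 0 ≤ Γ)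
    (hc : CoeffBound S lam Γ α β γ) (x₀ : EuclideanSpace ℝ (Fin n)) {κ : ℝ} (hκ : 0 ≤ κ)
    (hκ1 : κ ≤ 1) (h : ∀ x ∈ T, x₀ + κ • x ∈ S) :
    CoeffBound T lam Γ (fun x => α (x₀ + κ • x)) (fun x j => κ * β (x₀ + κ • x) j)
      (fun x => κ ^ 2 * γ (x₀ + κ • x)) where
  symm x hx := hc.symm _ (h x hx)
  ellip x hx := hc.ellip _ (h x hx)
  bddA i j := by
    simpa using (hc.bddA i j).rescale hΓ x₀ hκ hκ1 zero_le_one h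
  bddB j := ((hc.bddB j).rescale hΓ x₀ hκ hκ1 hκ h).mono_const (mul_le_of_le_one_left hΓ hκ1)
  bddC := (hc.bddC.rescale hΓ x₀ hκ hκ1 (sq_nonneg κ) h).mono_const
    (mul_le_of_le_one_left hΓ (pow_le_one₀ hκ hκ1))

lemma exists_oscillation_bound (n : ℕ) (hn : 1 ≤ n) (hlam : 0 < lam) (hΓ : 0 ≤ Γ) :
    ∃ C : ℝ, 0 ≤ C ∧ ∀ (α : EuclideanSpace ℝ (Fin n) → Matrix (Fin n) (Fin n) ℝ)
      (β : EuclideanSpace ℝ (Fin n) → Fin n → ℝ) (γ g : EuclideanSpace ℝ (Fin n) → ℝ)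
      (v vt : EuclideanSpace ℝ (Fin n) × ℝ → ℝ)
      (P : Fin n → EuclideanSpace ℝ (Fin n) × ℝ → ℝ)
      (H : Fin n → Fin n → EuclideanSpace ℝ (Fin n) × ℝ → ℝ) (R M N κ : ℝ)
      (z₀ : EuclideanSpace ℝ (Fin n) × ℝ),
      CoeffBound (Metric.ball 0 R) lam Γ α β γ → IsClassicalSol R α β γ g v vt P H →
      BddLip (Metric.ball 0 R) N g → 0 ≤ N → 0 < κ → κ ≤ 1 → z₀.2 ≤ 0 →
      (∀ z : EuclideanSpace ℝ (Fin n) × ℝ, ‖z.1 - z₀.1‖ < 2 * κ → z₀.2 - 4 * κ ^ 2 < z.2 →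
        z.2 ≤ z₀.2 → z ∈ cylQ n R ∧ |v z| ≤ M) →
      ∀ z : EuclideanSpace ℝ (Fin n) × ℝ, ‖z.1 - z₀.1‖ ≤ κ / 2 → z₀.2 - κ ^ 2 / 4 ≤ z.2 →
        z.2 ≤ z₀.2 →
        |v z - v z₀| ≤ C * (M + κ ^ 2 * N) * (‖z.1 - z₀.1‖ / κ + (z₀.2 - z.2) / κ ^ 2) := by
  obtain ⟨C, hC0, hC⟩ := exists_center_oscillation_bound n hn hlam hΓ
  refine ⟨C, hC0, fun α β γ g v vt P H R M N κ z₀ hc hs hg hN hκ hκ1 hz₀ hM z h1 h2 h3 => ?_⟩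
  have hmem : ∀ z ∈ cylQ n 2, (z₀.1 + κ • z.1, z₀.2 + κ ^ 2 * z.2) ∈ cylQ n R ∧
      |v (z₀.1 + κ • z.1, z₀.2 + κ ^ 2 * z.2)| ≤ M := by
    intro z hz
    obtain ⟨k1, k2, k3⟩ := mem_cylQ.1 hz
    have hκ2 : 0 < κ ^ 2 := by positivity
    refine hM _ ?_ ?_ ?_
    · dsimp only
      rw [add_sub_cancel_left, norm_smul, Real.norm_eq_abs, abs_of_pos hκ]
      nlinarith
    · dsimp only
      nlinarith
    · dsimp only
      nlinarith
  have hball : ∀ x ∈ Metric.ball (0 : EuclideanSpace ℝ (Fin n)) 2,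
      z₀.1 + κ • x ∈ Metric.ball (0 : EuclideanSpace ℝ (Fin n)) R := by
    intro x hx
    have := (hmem (x, 0) (mem_cylQ.2 ⟨by simpa using hx, by norm_num, le_rfl⟩)).1
    simpa using (mem_cylQ.1 this).1
  have hk : |κ⁻¹| = κ⁻¹ := abs_of_pos (inv_pos.2 hκ)
  have hκ2 : 0 < κ ^ 2 := by positivity
  have hx : ‖κ⁻¹ • (z.1 - z₀.1)‖ = ‖z.1 - z₀.1‖ / κ := by
    rw [norm_smul, Real.norm_eq_abs, hk, div_eq_inv_mul]
  have h := hC _ _ _ _ _ _ _ _ M (κ ^ 2 * N) (hc.rescale hΓ z₀.1 hκ.le hκ1 hball)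
    (hs.rescale z₀ hz₀ fun z hz => (hmem z hz).1) (hg.rescale hN z₀.1 hκ.le hκ1 hκ2.le hball)
    (fun z hz => (hmem z hz).2) (κ⁻¹ • (z.1 - z₀.1), (z.2 - z₀.2) / κ ^ 2) ?_ ?_ ?_
  · have e1 : κ ^ 2 * ((z.2 - z₀.2) / κ ^ 2) = z.2 - z₀.2 := by field_simp
    have e2 : -((z.2 - z₀.2) / κ ^ 2) = (z₀.2 - z.2) / κ ^ 2 := by ring
    dsimp only at h
    rw [smul_inv_smul₀ hκ.ne', e1, e2, hx] at h
    simpa using h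
  · dsimp only
    rw [hx, div_le_iff₀ hκ]
    linarith
  · dsimp only
    rw [le_div_iff₀ hκ2]
    linarith
  · exact div_nonpos_of_nonpos_of_nonneg (by linarith) hκ2.le

end Oscillation

section LocalBound

variable {n : ℕ} {lam Γ : ℝ}

lemma volume_real_ball_prod_Ioc (x : EuclideanSpace ℝ (Fin n)) (t : ℝ) {s a : ℝ} (hs : 0 < s)
    (ha : 0 ≤ a) :
    volume.real (Metric.ball x s ×ˢ Ioc (t - a) t) =
      volume.real (Metric.ball (0 : EuclideanSpace ℝ (Fin n)) 1) * s ^ n * a := by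
  rw [Measure.volume_eq_prod, measureReal_prod_prod, Real.volume_real_Ioc_of_le (by linarith),
    measureReal_def, Measure.addHaar_ball_of_pos _ _ hs, finrank_euclideanSpace_fin, ENNReal.toReal_mul,
    ENNReal.toReal_ofReal (by positivity), measureReal_def]
  ring

lemma volume_real_cylQ {ρ : ℝ} (hρ : 0 < ρ) :
    volume.real (cylQ n ρ) =
      volume.real (Metric.ball (0 : EuclideanSpace ℝ (Fin n)) 1) * ρ ^ (n + 2) := by
  have := volume_real_ball_prod_Ioc (0 : EuclideanSpace ℝ (Fin n)) 0 hρ (sq_nonneg ρ)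
  rw [zero_sub] at this
  rw [cylQ, this]
  ring

lemma volume_real_unitBall_pos (n : ℕ) :
    0 < volume.real (Metric.ball (0 : EuclideanSpace ℝ (Fin n)) 1) :=
  ENNReal.toReal_pos (Metric.measure_ball_pos _ _ one_pos).ne' measure_ball_lt_top.ne

lemma measurableSet_cylQ (r : ℝ) : MeasurableSet (cylQ n r) :=
  measurableSet_ball.prod measurableSet_Ioc

lemma volume_cylQ_ne_top (r : ℝ) : volume (cylQ n r) ≠ ⊤ := by
  rw [cylQ, Measure.volume_eq_prod, Measure.prod_prod]
  exact ENNReal.mul_ne_top measure_ball_lt_top.ne measure_Ioc_lt_top.ne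

set_option maxHeartbeats 1000000 in
/-- Local boundedness of solutions in terms of their `L²` norm. -/
lemma exists_local_bound (n : ℕ) (hn : 1 ≤ n) (hlam : 0 < lam) (hΓ : 0 ≤ Γ) :
    ∃ C : ℝ, 0 ≤ C ∧ ∀ (α : EuclideanSpace ℝ (Fin n) → Matrix (Fin n) (Fin n) ℝ)
      (β : EuclideanSpace ℝ (Fin n) → Fin n → ℝ) (γ g : EuclideanSpace ℝ (Fin n) → ℝ)
      (v vt : EuclideanSpace ℝ (Fin n) × ℝ → ℝ)
      (P : Fin n → EuclideanSpace ℝ (Fin n) × ℝ → ℝ)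
      (H : Fin n → Fin n → EuclideanSpace ℝ (Fin n) × ℝ → ℝ) (r N : ℝ),
      0 < r → r ≤ 1 → 0 ≤ N →
      CoeffBound (Metric.ball 0 r) lam Γ α β γ → IsClassicalSol r α β γ g v vt P H →
      BddLip (Metric.ball 0 r) N g → IntegrableOn (fun z => v z ^ 2) (cylQ n r) →
      ∀ z : EuclideanSpace ℝ (Fin n) × ℝ, ‖z.1‖ ≤ r / 8 → -(r ^ 2 / 64) ≤ z.2 → z.2 ≤ 0 →
        r ^ (n + 2) * v z ^ 2 ≤ C * ((∫ z in cylQ n r, v z ^ 2) + r ^ (n + 6) * N ^ 2) := by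
  obtain ⟨C₀, hC₀, hosc⟩ := exists_oscillation_bound n hn hlam hΓ
  obtain ⟨ω, hω⟩ : ∃ ω, ω = volume.real (Metric.ball (0 : EuclideanSpace ℝ (Fin n)) 1) := ⟨_, rfl⟩
  have hω0 : 0 < ω := hω ▸ volume_real_unitBall_pos n
  obtain ⟨q, hq⟩ : ∃ q : ℝ, q = C₀ * (2 ^ (n + 2) + 1) := ⟨_, rfl⟩
  have hq0 : 0 ≤ q := by rw [hq]; positivity
  obtain ⟨θ, hθ⟩ : ∃ θ : ℝ, θ = 1 / (4 * (q + 1)) := ⟨_, rfl⟩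
  have hθ0 : 0 < θ := by rw [hθ]; positivity
  have hθ1 : θ ≤ 1 / 4 := by
    rw [hθ]
    exact one_div_le_one_div_of_le (by norm_num) (by linarith)
  have hqθ : q * (2 * θ) ≤ 1 / 2 := by
    have : 4 * (q + 1) * θ = 1 := by rw [hθ]; field_simp
    linarith
  obtain ⟨C₁, hC₁⟩ : ∃ C₁ : ℝ, C₁ = 4 * 8 ^ (n + 2) / (ω * θ ^ (n + 1)) := ⟨_, rfl⟩
  have hC₁0 : 0 ≤ C₁ := by rw [hC₁]; positivity
  refine ⟨4 ^ (n + 2) * (C₁ + 1), by positivity,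
    fun α β γ g v vt P H r N hr hr1 hN hc hs hg hInt z hz1 hz2 hz3 => ?_⟩
  obtain ⟨I, hI⟩ : ∃ I, I = ∫ z in cylQ n r, v z ^ 2 := ⟨_, rfl⟩
  have hI0 : 0 ≤ I := hI ▸ integral_nonneg fun z => sq_nonneg _
  rw [← hI]
  obtain ⟨d, hd⟩ : ∃ d : EuclideanSpace ℝ (Fin n) × ℝ → ℝ,
    d = fun z => r / 2 - ‖z.1‖ - √(-z.2) := ⟨_, rfl⟩
  have hdc : Continuous d := by rw [hd]; fun_prop
  obtain ⟨D, hD⟩ : ∃ D : Set (EuclideanSpace ℝ (Fin n) × ℝ),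
    D = {z | 0 ≤ d z} ∩ {z | z.2 ≤ 0} := ⟨_, rfl⟩
  have hDb : ∀ z ∈ D, ‖z.1‖ ≤ r / 2 ∧ -(r ^ 2 / 4) ≤ z.2 ∧ z.2 ≤ 0 := by
    intro z hz
    rw [hD, hd] at hz
    obtain ⟨h1, h2⟩ := hz
    rw [mem_ofPred_eq] at h1 h2
    have h3 := Real.sqrt_nonneg (-z.2)
    have h4 := Real.sq_sqrt (show 0 ≤ -z.2 by linarith)
    have h5 := norm_nonneg z.1
    refine ⟨by linarith, ?_, h2⟩
    nlinarith
  have hDQ : D ⊆ cylQ n r := fun z hz => by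
    obtain ⟨h1, h2, h3⟩ := hDb z hz
    exact mem_cylQ.2 ⟨by linarith, by nlinarith, h3⟩
  have hDcl : IsClosed D := by
    rw [hD]
    exact (isClosed_le continuous_const hdc).inter (isClosed_le continuous_snd continuous_const)
  have hDc : IsCompact D :=
    ((isCompact_closedBall (0 : EuclideanSpace ℝ (Fin n)) (r / 2)).prod
      (isCompact_Icc (a := -(r ^ 2 / 4)) (b := 0))).of_isClosed_subset hDcl fun z hz => by
        obtain ⟨h1, h2, h3⟩ := hDb z hz
        exact ⟨by simpa using h1, h2, h3⟩
  have hzd : r / 4 ≤ d z := by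
    have : √(-z.2) ≤ r / 8 := Real.sqrt_le_iff.2 ⟨by positivity, by nlinarith⟩
    rw [hd]
    dsimp only
    linarith
  have hzD : z ∈ D := by
    rw [hD]
    exact ⟨by rw [mem_ofPred_eq]; linarith, hz3⟩
  obtain ⟨z₀, hz₀D, hmax⟩ := hDc.exists_isMaxOn ⟨z, hzD⟩
    (f := fun z => d z ^ (n + 2) * v z ^ 2)
    ((hdc.pow _).continuousOn.mul ((hs.cont.mono hDQ).pow 2))
  have hmax' : ∀ z ∈ D, d z ^ (n + 2) * v z ^ 2 ≤ d z₀ ^ (n + 2) * v z₀ ^ 2 := fun z hz => hmax hz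
  have hd₀ : 0 ≤ d z₀ := by
    rw [hD] at hz₀D
    exact hz₀D.1
  have ht₀ : z₀.2 ≤ 0 := (hDb z₀ hz₀D).2.2
  have hdr : d z₀ ≤ r / 2 := by
    rw [hd]
    dsimp only
    linarith [norm_nonneg z₀.1, Real.sqrt_nonneg (-z₀.2)]
  suffices hkey : d z₀ ^ (n + 2) * v z₀ ^ 2 ≤ (C₁ + 1) * (I + r ^ (n + 6) * N ^ 2) by
    have h1 : (r / 4) ^ (n + 2) * v z ^ 2 ≤ d z ^ (n + 2) * v z ^ 2 := by gcongr
    have h2 : r ^ (n + 2) * v z ^ 2 = 4 ^ (n + 2) * ((r / 4) ^ (n + 2) * v z ^ 2) := by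
      rw [div_pow]
      field_simp
    rw [h2, mul_assoc]
    exact mul_le_mul_of_nonneg_left ((h1.trans (hmax' z hzD)).trans hkey) (by positivity)
  have hrN : 0 ≤ r ^ (n + 6) * N ^ 2 := by positivity
  rcases hd₀.eq_or_lt with hd0 | hd0
  · rw [← hd0]
    simp only [ne_eq, Nat.add_eq_zero_iff, OfNat.ofNat_ne_zero, and_false, not_false_eq_true,
      zero_pow, zero_mul]
    positivity
  obtain ⟨κ, hκ⟩ : ∃ κ, κ = d z₀ / 8 := ⟨_, rfl⟩
  have hκ0 : 0 < κ := by rw [hκ]; positivity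
  have hdκ : d z₀ = 8 * κ := by rw [hκ]; ring
  have hreg : ∀ z : EuclideanSpace ℝ (Fin n) × ℝ, ‖z.1 - z₀.1‖ < 2 * κ →
      z₀.2 - 4 * κ ^ 2 < z.2 → z.2 ≤ z₀.2 →
        z ∈ cylQ n r ∧ |v z| ≤ 2 ^ (n + 2) * |v z₀| := by
    intro w h1 h2 h3
    have h4 : √(-w.2) ≤ √(-z₀.2) + 2 * κ := by
      refine Real.sqrt_le_iff.2 ⟨by positivity, ?_⟩
      nlinarith [Real.sq_sqrt (show 0 ≤ -z₀.2 by linarith), Real.sqrt_nonneg (-z₀.2)]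
    have h5 : ‖w.1‖ ≤ ‖z₀.1‖ + 2 * κ := by
      linarith [norm_le_norm_add_norm_sub' w.1 z₀.1]
    have h6 : d z₀ / 2 ≤ d w := by
      have : d w ≥ d z₀ - 4 * κ := by
        rw [hd]
        dsimp only
        linarith
      linarith
    have hwD : w ∈ D := by
      rw [hD]
      exact ⟨by rw [mem_ofPred_eq]; linarith, h3.trans ht₀⟩
    refine ⟨hDQ hwD, ?_⟩
    have h7 : (d z₀ / 2) ^ (n + 2) * v w ^ 2 ≤ d w ^ (n + 2) * v w ^ 2 := by gcongr
    have h8 := h7.trans (hmax' w hwD)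
    have h9 : v w ^ 2 ≤ 2 ^ (n + 2) * v z₀ ^ 2 := by
      have : d z₀ ^ (n + 2) * v w ^ 2 ≤ d z₀ ^ (n + 2) * (2 ^ (n + 2) * v z₀ ^ 2) := by
        rw [div_pow, div_mul_eq_mul_div, div_le_iff₀ (by positivity)] at h8
        linarith
      exact le_of_mul_le_mul_left this (by positivity)
    refine abs_le_of_sq_le_sq ?_ (by positivity)
    rw [mul_pow, sq_abs]
    refine h9.trans ?_
    gcongr
    exact le_self_pow₀ (one_le_pow₀ (by norm_num)) (by norm_num)
  have hκr : κ ≤ r := by linarith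
  by_cases hcase : κ ^ 2 * N ≤ |v z₀|
  · have hlow : ∀ w ∈ Metric.ball z₀.1 (θ * κ) ×ˢ Ioc (z₀.2 - θ * κ ^ 2) z₀.2,
        w ∈ cylQ n r ∧ v z₀ ^ 2 / 4 ≤ v w ^ 2 := by
      intro w hw
      obtain ⟨h1, h2, h3⟩ := hw
      rw [Metric.mem_ball, dist_eq_norm] at h1
      have k1 : θ * κ ≤ 1 / 4 * κ := by gcongr
      have k2 : θ * κ ^ 2 ≤ 1 / 4 * κ ^ 2 := by gcongr
      have hκ2 : 0 < κ ^ 2 := by positivity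
      refine ⟨(hreg w (by linarith) (by linarith) h3).1, ?_⟩
      have h4 := hosc α β γ g v vt P H r _ N κ z₀ hc hs hg hN hκ0 (by linarith) ht₀ hreg w
        (by linarith) (by linarith) h3
      have h5 : ‖w.1 - z₀.1‖ / κ + (z₀.2 - w.2) / κ ^ 2 ≤ 2 * θ := by
        have e1 : ‖w.1 - z₀.1‖ / κ ≤ θ := by
          rw [div_le_iff₀ hκ0]
          exact h1.le
        have e2 : (z₀.2 - w.2) / κ ^ 2 ≤ θ := by
          rw [div_le_iff₀ hκ2]
          linarith
        linarith
      have h6 : |v w - v z₀| ≤ |v z₀| / 2 := by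
        calc |v w - v z₀| ≤ _ := h4
          _ ≤ C₀ * (2 ^ (n + 2) * |v z₀| + |v z₀|) * (2 * θ) := by gcongr
          _ = q * (2 * θ) * |v z₀| := by rw [hq]; ring
          _ ≤ 1 / 2 * |v z₀| := by gcongr
          _ = |v z₀| / 2 := by ring
      have h7 : |v z₀| / 2 ≤ |v w| := by
        have := abs_sub_abs_le_abs_sub (v z₀) (v w)
        rw [abs_sub_comm] at this
        linarith
      have h8 := pow_le_pow_left₀ (by positivity) h7 2
      rw [sq_abs, div_pow, sq_abs] at h8
      linarith
    have hlb : v z₀ ^ 2 / 4 * (ω * (θ * κ) ^ n * (θ * κ ^ 2)) ≤ I := by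
      have hm : MeasurableSet (Metric.ball z₀.1 (θ * κ) ×ˢ Ioc (z₀.2 - θ * κ ^ 2) z₀.2) :=
        measurableSet_ball.prod measurableSet_Ioc
      have hsub : Metric.ball z₀.1 (θ * κ) ×ˢ Ioc (z₀.2 - θ * κ ^ 2) z₀.2 ⊆ cylQ n r :=
        fun w hw => (hlow w hw).1
      have h1 := setIntegral_ge_of_const_le_real hm (measure_ne_top_of_subset hsub
        (volume_cylQ_ne_top r)) (fun w hw => (hlow w hw).2) (hInt.mono_set hsub)
      rw [volume_real_ball_prod_Ioc _ _ (by positivity) (by positivity), ← hω] at h1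
      refine h1.trans (hI ▸ ?_)
      exact setIntegral_mono_set hInt (ae_of_all _ fun z => sq_nonneg _) hsub.eventuallyLE
    have h2 : d z₀ ^ (n + 2) * v z₀ ^ 2 =
        C₁ * (v z₀ ^ 2 / 4 * (ω * (θ * κ) ^ n * (θ * κ ^ 2))) := by
      rw [hC₁, hdκ]
      field_simp
      ring
    rw [h2]
    have h3 := mul_le_mul_of_nonneg_left hlb hC₁0
    nlinarith [mul_nonneg hC₁0 hrN]
  · push Not at hcase
    have h1 : v z₀ ^ 2 ≤ (r ^ 2 * N) ^ 2 := by
      rw [← sq_abs]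
      have : κ ^ 2 * N ≤ r ^ 2 * N := by gcongr
      gcongr
      linarith
    calc d z₀ ^ (n + 2) * v z₀ ^ 2 ≤ r ^ (n + 2) * (r ^ 2 * N) ^ 2 := by
          gcongr
          linarith
      _ = r ^ (n + 6) * N ^ 2 := by ring
      _ ≤ (C₁ + 1) * (I + r ^ (n + 6) * N ^ 2) := by
        nlinarith [mul_nonneg hC₁0 hrN, mul_nonneg hC₁0 hI0]

/-- Decay of the oscillation of solutions in terms of their `L²` norm. -/
lemma exists_decay_bound (n : ℕ) (hn : 1 ≤ n) (hlam : 0 < lam) (hΓ : 0 ≤ Γ) :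
    ∃ C : ℝ, 0 ≤ C ∧ ∀ (α : EuclideanSpace ℝ (Fin n) → Matrix (Fin n) (Fin n) ℝ)
      (β : EuclideanSpace ℝ (Fin n) → Fin n → ℝ) (γ g : EuclideanSpace ℝ (Fin n) → ℝ)
      (v vt : EuclideanSpace ℝ (Fin n) × ℝ → ℝ)
      (P : Fin n → EuclideanSpace ℝ (Fin n) × ℝ → ℝ)
      (H : Fin n → Fin n → EuclideanSpace ℝ (Fin n) × ℝ → ℝ) (r N : ℝ),
      0 < r → r ≤ 1 → 0 ≤ N →
      CoeffBound (Metric.ball 0 r) lam Γ α β γ → IsClassicalSol r α β γ g v vt P H →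
      BddLip (Metric.ball 0 r) N g → IntegrableOn (fun z => v z ^ 2) (cylQ n r) →
      ∀ ρ : ℝ, 0 < ρ → ρ ≤ r / 32 → ∀ z ∈ cylQ n ρ,
        r ^ (n + 2) * (v z - v 0) ^ 2 ≤
          C * (ρ / r) ^ 2 * ((∫ z in cylQ n r, v z ^ 2) + r ^ (n + 6) * N ^ 2) := by
  obtain ⟨C₀, hC₀, hosc⟩ := exists_oscillation_bound n hn hlam hΓ
  obtain ⟨C₁, hC₁, hloc⟩ := exists_local_bound n hn hlam hΓ
  refine ⟨576 * C₀ ^ 2 * (2 * C₁ + 2), by positivity,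
    fun α β γ g v vt P H r N hr hr1 hN hc hs hg hInt ρ hρ hρr z hz => ?_⟩
  have hloc' := hloc α β γ g v vt P H r N hr hr1 hN hc hs hg hInt
  obtain ⟨J, hJ⟩ : ∃ J, J = (∫ z in cylQ n r, v z ^ 2) + r ^ (n + 6) * N ^ 2 := ⟨_, rfl⟩
  have hI0 : 0 ≤ ∫ z in cylQ n r, v z ^ 2 := integral_nonneg fun z => sq_nonneg _
  have hrN : 0 ≤ r ^ (n + 6) * N ^ 2 := by positivity
  have hJ0 : 0 ≤ J := by rw [hJ]; positivity
  have hNJ : r ^ (n + 6) * N ^ 2 ≤ J := by rw [hJ]; linarith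
  rw [← hJ] at hloc' ⊢
  obtain ⟨M, hM⟩ : ∃ M, M = √(C₁ * J / r ^ (n + 2)) := ⟨_, rfl⟩
  have hM0 : 0 ≤ M := hM ▸ Real.sqrt_nonneg _
  have hrn : 0 < r ^ (n + 2) := by positivity
  have hM2 : r ^ (n + 2) * M ^ 2 = C₁ * J := by
    rw [hM, Real.sq_sqrt (by positivity)]
    field_simp
  obtain ⟨h1, h2, h3⟩ := mem_cylQ.1 hz
  have hρ2 : ρ ^ 2 ≤ (r / 32) ^ 2 := by gcongr
  have h4 := hosc α β γ g v vt P H r M N (r / 16) 0 hc hs hg hN (by positivity) (by linarith)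
    le_rfl (fun w k1 k2 k3 => ?_) z (by simp; linarith) (by simp; linarith) h3
  · simp only [Prod.fst_zero, Prod.snd_zero, sub_zero, zero_sub] at h4
    have h5 : ‖z.1‖ / (r / 16) + -z.2 / (r / 16) ^ 2 ≤ 24 * (ρ / r) := by
      have e1 : ‖z.1‖ / (r / 16) ≤ 16 * (ρ / r) := by
        rw [div_le_iff₀ (by positivity)]
        field_simp
        linarith
      have e2 : -z.2 / (r / 16) ^ 2 ≤ 8 * (ρ / r) := by
        rw [div_le_iff₀ (by positivity)]
        have : 8 * (ρ / r) * (r / 16) ^ 2 = ρ * (r / 32) := by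
          field_simp
          ring
        rw [this]
        nlinarith
      linarith
    have h6 : |v z - v 0| ≤ C₀ * (M + r ^ 2 * N) * (24 * (ρ / r)) := by
      have h7 : 0 ≤ 24 * (ρ / r) := by positivity
      refine h4.trans ((mul_le_mul_of_nonneg_left h5 (by positivity)).trans ?_)
      gcongr
      linarith
    calc r ^ (n + 2) * (v z - v 0) ^ 2
        ≤ r ^ (n + 2) * (C₀ * (M + r ^ 2 * N) * (24 * (ρ / r))) ^ 2 := by
          rw [← sq_abs (v z - v 0)]
          gcongr
      _ = 576 * C₀ ^ 2 * (ρ / r) ^ 2 * (r ^ (n + 2) * (M + r ^ 2 * N) ^ 2) := by ring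
      _ ≤ 576 * C₀ ^ 2 * (ρ / r) ^ 2 * ((2 * C₁ + 2) * J) := by
        refine mul_le_mul_of_nonneg_left ?_ (by positivity)
        calc r ^ (n + 2) * (M + r ^ 2 * N) ^ 2
            ≤ r ^ (n + 2) * (2 * M ^ 2 + 2 * (r ^ 2 * N) ^ 2) := by
              gcongr
              nlinarith [sq_nonneg (M - r ^ 2 * N)]
          _ = 2 * (r ^ (n + 2) * M ^ 2) + 2 * (r ^ (n + 6) * N ^ 2) := by ring
          _ ≤ (2 * C₁ + 2) * J := by
            rw [hM2]
            linarith
      _ = _ := by ring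
  · simp only [Prod.fst_zero, Prod.snd_zero, sub_zero, zero_sub] at k1 k2 k3
    refine ⟨mem_cylQ.2 ⟨by linarith, by nlinarith, k3⟩, abs_le_of_sq_le_sq ?_ hM0⟩
    have := hloc' w (by linarith) (by linarith) k3
    rw [← hM2] at this
    exact le_of_mul_le_mul_left this hrn

end LocalBound

section TimeDerivative

variable {n : ℕ} {lam Γ : ℝ} {α : EuclideanSpace ℝ (Fin n) → Matrix (Fin n) (Fin n) ℝ}
  {β : EuclideanSpace ℝ (Fin n) → Fin n → ℝ} {γ g : EuclideanSpace ℝ (Fin n) → ℝ}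
  {v vt : EuclideanSpace ℝ (Fin n) × ℝ → ℝ}
  {P : Fin n → EuclideanSpace ℝ (Fin n) × ℝ → ℝ}
  {H : Fin n → Fin n → EuclideanSpace ℝ (Fin n) × ℝ → ℝ}

lemma cylQ_subset_cylQ {r R : ℝ} (hr : 0 ≤ r) (h : r ≤ R) : cylQ n r ⊆ cylQ n R := by
  intro z hz
  obtain ⟨h1, h2, h3⟩ := mem_cylQ.1 hz
  have : r ^ 2 ≤ R ^ 2 := by gcongr
  exact mem_cylQ.2 ⟨by linarith, by linarith, h3⟩

lemma IsClassicalSol.timeQuot_sub_const {R r h : ℝ} (hs : IsClassicalSol R α β γ g v vt P H)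
    (hr : 0 ≤ r) (hrR : r ≤ R) (hh : 0 ≤ h) (hrh : r ^ 2 + h ≤ R ^ 2) (c : ℝ) :
    IsClassicalSol r α β γ (fun x => -(γ x * c)) (fun z => timeQuot h v z - c) (timeQuot h vt)
      (fun i => timeQuot h (P i)) (fun i j => timeQuot h (H i j)) := by
  have h1 : cylQ n r ⊆ cylQ n R := cylQ_subset_cylQ hr hrR
  have h2 : ∀ z ∈ cylQ n r, (z.1, z.2 - h) ∈ cylQ n R := fun z hz => by
    obtain ⟨k1, k2, k3⟩ := mem_cylQ.1 hz
    exact mem_cylQ.2 ⟨k1.trans_le hrR, by dsimp only; linarith, by dsimp only; linarith⟩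
  refine ⟨(continuousOn_timeQuot hs.cont h1 h2).sub continuousOn_const,
    continuousOn_timeQuot hs.cont_t h1 h2, fun i => continuousOn_timeQuot (hs.cont_P i) h1 h2,
    fun i j => continuousOn_timeQuot (hs.cont_H i j) h1 h2, fun z hz σ => ?_,
    fun i z hz σ => ?_, fun z hz => ?_, fun z hz => ?_⟩
  · refine ((((hs.hasP z (h1 hz) σ).sub (hs.hasP _ (h2 z hz) σ)).const_mul h⁻¹).sub_const
      c).congr_deriv ?_
    rw [← Finset.sum_sub_distrib, Finset.mul_sum]
    refine Finset.sum_congr rfl fun j _ => ?_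
    unfold timeQuot
    ring
  · refine (((hs.hasH i z (h1 hz) σ).sub (hs.hasH i _ (h2 z hz) σ)).const_mul h⁻¹).congr_deriv ?_
    rw [← Finset.sum_sub_distrib, Finset.mul_sum]
    refine Finset.sum_congr rfl fun j _ => ?_
    unfold timeQuot
    ring
  · have k1 : HasDerivWithinAt (fun s : ℝ => s - h) 1 (Iic 0) z.2 :=
      ((hasDerivAt_id z.2).sub_const h).hasDerivWithinAt
    have hm : MapsTo (fun s : ℝ => s - h) (Iic 0) (Iic 0) := fun s hs => by
      have := mem_Iic.1 hs
      exact mem_Iic.2 (by linarith)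
    have k2 := (hs.has_t _ (h2 z hz)).scomp z.2 k1 hm
    rw [one_smul] at k2
    exact (((hs.has_t z (h1 hz)).sub k2).const_mul h⁻¹).sub_const c
  · simp only [timeQuot]
    rw [hs.eqn z (h1 hz), hs.eqn _ (h2 z hz)]
    have e1 : ∑ i, ∑ j, α z.1 i j * (h⁻¹ * (H i j z - H i j (z.1, z.2 - h))) =
        h⁻¹ * (∑ i, ∑ j, α z.1 i j * H i j z - ∑ i, ∑ j, α z.1 i j * H i j (z.1, z.2 - h)) := by
      simp only [← Finset.sum_sub_distrib, Finset.mul_sum]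
      exact Finset.sum_congr rfl fun i _ => Finset.sum_congr rfl fun j _ => by ring
    have e2 : ∑ j, β z.1 j * (h⁻¹ * (P j z - P j (z.1, z.2 - h))) =
        h⁻¹ * (∑ j, β z.1 j * P j z - ∑ j, β z.1 j * P j (z.1, z.2 - h)) := by
      simp only [← Finset.sum_sub_distrib, Finset.mul_sum]
      exact Finset.sum_congr rfl fun j _ => by ring
    rw [e1, e2]
    ring

lemma IsClassicalSol.eventually_timeQuot_sub_le {R r ε : ℝ}
    (hs : IsClassicalSol R α β γ g v vt P H) (hr : 0 < r) (hrR : r < R) (hε : 0 < ε) :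
    ∀ᶠ h in 𝓝[>] (0 : ℝ), ∀ z ∈ cylQ n r, |timeQuot h v z - vt z| ≤ ε := by
  obtain ⟨a, ha⟩ : ∃ a, a = (R ^ 2 - r ^ 2) / 2 := ⟨_, rfl⟩
  have ha0 : 0 < a := by
    rw [ha]
    nlinarith
  have hK : IsCompact (Metric.closedBall (0 : EuclideanSpace ℝ (Fin n)) r ×ˢ
      Icc (-(r ^ 2 + a)) 0) := (isCompact_closedBall _ _).prod isCompact_Icc
  have hKS : Metric.closedBall (0 : EuclideanSpace ℝ (Fin n)) r ×ˢ Icc (-(r ^ 2 + a)) 0 ⊆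
      cylQ n R := by
    rintro z ⟨h1, h2, h3⟩
    rw [mem_closedBall_zero_iff] at h1
    exact mem_cylQ.2 ⟨by linarith, by linarith, h3⟩
  filter_upwards [Ioo_mem_nhdsGT ha0, eventually_abs_sub_le hs.cont_t hK hKS hε] with h hh hu z hz
  obtain ⟨k1, k2, k3⟩ := mem_cylQ.1 hz
  have hmem : ∀ s ∈ Icc (z.2 - h) z.2, (z.1, s) ∈
      Metric.closedBall (0 : EuclideanSpace ℝ (Fin n)) r ×ˢ Icc (-(r ^ 2 + a)) 0 := fun s hs' =>
    ⟨by simpa using k1.le, by dsimp only; linarith [hs'.1, hh.2], by dsimp only; linarith [hs'.2]⟩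
  obtain ⟨θ, hθ, he⟩ := exists_timeQuot_eq (w := v) (Q := vt) hh.1 (z := z) k3
    fun s hs' => hs.has_t (z.1, s) (hKS (hmem s hs'))
  rw [he]
  refine hu _ (hmem (z.2 - θ) ⟨by linarith [hθ.2], by linarith [hθ.1]⟩) z
    (hmem z.2 ⟨by linarith [hh.1], le_rfl⟩) (by simpa using hh.1.le) ?_
  dsimp only
  rw [sub_sub_cancel_left, abs_neg, abs_of_pos hθ.1]
  linarith [hθ.2, hh.1]

/-- Decay of the oscillation of the time derivative of a solution. -/
lemma exists_time_deriv_decay_bound (n : ℕ) (hn : 1 ≤ n) (hlam : 0 < lam) (hΓ : 0 ≤ Γ) :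
    ∃ C : ℝ, 0 ≤ C ∧ ∀ (α : EuclideanSpace ℝ (Fin n) → Matrix (Fin n) (Fin n) ℝ)
      (β : EuclideanSpace ℝ (Fin n) → Fin n → ℝ) (γ g : EuclideanSpace ℝ (Fin n) → ℝ)
      (v vt : EuclideanSpace ℝ (Fin n) × ℝ → ℝ)
      (P : Fin n → EuclideanSpace ℝ (Fin n) × ℝ → ℝ)
      (H : Fin n → Fin n → EuclideanSpace ℝ (Fin n) × ℝ → ℝ) (R N c : ℝ),
      0 < R → R ≤ 1 → 0 ≤ N →
      CoeffBound (Metric.ball 0 R) lam Γ α β γ → IsClassicalSol R α β γ g v vt P H →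
      BddLip (Metric.ball 0 R) N (fun x => -(γ x * c)) →
      IntegrableOn (fun z => (vt z - c) ^ 2) (cylQ n R) →
      ∀ ρ : ℝ, 0 < ρ → ρ ≤ R / 64 → ∀ z ∈ cylQ n ρ,
        R ^ (n + 2) * (vt z - vt 0) ^ 2 ≤
          C * (ρ / R) ^ 2 * ((∫ z in cylQ n R, (vt z - c) ^ 2) + R ^ (n + 6) * N ^ 2) := by
  obtain ⟨C, hC0, hC⟩ := exists_decay_bound n hn hlam hΓ
  refine ⟨2 ^ (n + 2) * (16 * C), by positivity,
    fun α β γ g v vt P H R N c hR hR1 hN hc hs hg hInt ρ hρ hρR z hz => ?_⟩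
  obtain ⟨r, hr⟩ : ∃ r, r = R / 2 := ⟨_, rfl⟩
  have hr0 : 0 < r := by rw [hr]; positivity
  have hrR : r < R := by rw [hr]; linarith
  have hRr : R = 2 * r := by rw [hr]; ring
  obtain ⟨I, hI⟩ : ∃ I, I = ∫ z in cylQ n R, (vt z - c) ^ 2 := ⟨_, rfl⟩
  obtain ⟨V, hV⟩ : ∃ V, V = volume.real (cylQ n r) := ⟨_, rfl⟩
  rw [← hI]
  have hsub : cylQ n r ⊆ cylQ n R := cylQ_subset_cylQ hr0.le hrR.le
  have hIr : ∫ z in cylQ n r, (vt z - c) ^ 2 ≤ I := by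
    rw [hI]
    exact setIntegral_mono_set hInt (ae_of_all _ fun z => sq_nonneg _) hsub.eventuallyLE
  have hρr : ρ ≤ r / 32 := by rw [hr]; linarith
  have hzr : z ∈ cylQ n r := cylQ_subset_cylQ hρ.le (by linarith) hz
  have h0r : (0 : EuclideanSpace ℝ (Fin n) × ℝ) ∈ cylQ n r :=
    mem_cylQ.2 ⟨by simpa using hr0, by simp; positivity, le_rfl⟩
  have hBR : Metric.ball (0 : EuclideanSpace ℝ (Fin n)) r ⊆ Metric.ball 0 R :=
    Metric.ball_subset_ball hrR.le
  have hc' : CoeffBound (Metric.ball 0 r) lam Γ α β γ :=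
    ⟨fun x hx => hc.symm x (hBR hx), fun x hx => hc.ellip x (hBR hx),
      fun i j => (hc.bddA i j).mono_set hBR, fun j => (hc.bddB j).mono_set hBR,
      hc.bddC.mono_set hBR⟩
  have happrox : ∀ ε : ℝ, 0 < ε → r ^ (n + 2) * (vt z - vt 0) ^ 2 ≤
      2 * C * (ρ / r) ^ 2 * (2 * I + r ^ (n + 6) * N ^ 2) +
        ε ^ 2 * (4 * C * (ρ / r) ^ 2 * V + 8 * r ^ (n + 2)) := by
    intro ε hε
    obtain ⟨h, hclose, hh, hh2⟩ := ((hs.eventually_timeQuot_sub_le hr0 hrR hε).and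
      (Ioo_mem_nhdsGT (show (0 : ℝ) < r ^ 2 by positivity))).exists
    have hsol := hs.timeQuot_sub_const hr0.le hrR.le hh.le
      (by rw [hRr]; nlinarith) c
    have hcK : ContinuousOn (fun z => (timeQuot h v z - c) ^ 2)
        (Metric.closedBall (0 : EuclideanSpace ℝ (Fin n)) r ×ˢ Icc (-(r ^ 2)) 0) := by
      refine ((continuousOn_timeQuot hs.cont ?_ ?_).sub continuousOn_const).pow 2
      · rintro w ⟨k1, k2, k3⟩
        rw [mem_closedBall_zero_iff] at k1
        exact mem_cylQ.2 ⟨by linarith, by rw [hRr]; nlinarith, k3⟩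
      · rintro w ⟨k1, k2, k3⟩
        rw [mem_closedBall_zero_iff] at k1
        exact mem_cylQ.2 ⟨by dsimp only; linarith, by rw [hRr]; dsimp only; nlinarith,
          by dsimp only; linarith⟩
    have hInt' : IntegrableOn (fun z => (timeQuot h v z - c) ^ 2) (cylQ n r) :=
      (hcK.integrableOn_compact ((isCompact_closedBall _ _).prod isCompact_Icc)).mono_set
        (Set.prod_mono Metric.ball_subset_closedBall Ioc_subset_Icc_self)
    have hmain := hC _ _ _ _ _ _ _ _ r N hr0 (by linarith) hN hc' hsol (hg.mono_set hBR) hInt' ρ hρ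
      hρr z hz
    have hI' : ∫ z in cylQ n r, (timeQuot h v z - c) ^ 2 ≤ 2 * I + 2 * ε ^ 2 * V := by
      have hb : IntegrableOn (fun z => 2 * (vt z - c) ^ 2) (cylQ n r) :=
        (hInt.mono_set hsub).const_mul 2
      have hb' : IntegrableOn (fun _ => 2 * ε ^ 2) (cylQ n r) :=
        integrableOn_const (volume_cylQ_ne_top r)
      calc ∫ z in cylQ n r, (timeQuot h v z - c) ^ 2
          ≤ ∫ z in cylQ n r, (2 * (vt z - c) ^ 2 + 2 * ε ^ 2) := by
            refine setIntegral_mono_on hInt' (hb.add hb') (measurableSet_cylQ r) fun w hw => ?_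
            have := sq_le_sq' (abs_le.1 (hclose w hw)).1 (abs_le.1 (hclose w hw)).2
            nlinarith [sq_nonneg ((vt w - c) - (timeQuot h v w - vt w))]
        _ = 2 * (∫ z in cylQ n r, (vt z - c) ^ 2) + 2 * ε ^ 2 * V := by
            rw [integral_add hb hb', integral_const_mul, setIntegral_const, smul_eq_mul, ← hV]
            ring
        _ ≤ 2 * I + 2 * ε ^ 2 * V := by gcongr
    have hdiff : (vt z - vt 0) ^ 2 ≤
        2 * ((timeQuot h v z - c) - (timeQuot h v 0 - c)) ^ 2 + 8 * ε ^ 2 := by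
      have k1 := abs_le.1 (hclose z hzr)
      have k2 := abs_le.1 (hclose 0 h0r)
      have k3 : ((timeQuot h v z - vt z) - (timeQuot h v 0 - vt 0)) ^ 2 ≤ (2 * ε) ^ 2 :=
        sq_le_sq' (by linarith) (by linarith)
      nlinarith [sq_nonneg (((timeQuot h v z - c) - (timeQuot h v 0 - c)) +
        ((timeQuot h v z - vt z) - (timeQuot h v 0 - vt 0)))]
    calc r ^ (n + 2) * (vt z - vt 0) ^ 2
        ≤ r ^ (n + 2) * (2 * ((timeQuot h v z - c) - (timeQuot h v 0 - c)) ^ 2 + 8 * ε ^ 2) := by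
          gcongr
      _ = 2 * (r ^ (n + 2) * ((timeQuot h v z - c) - (timeQuot h v 0 - c)) ^ 2) +
          8 * ε ^ 2 * r ^ (n + 2) := by ring
      _ ≤ 2 * (C * (ρ / r) ^ 2 * ((2 * I + 2 * ε ^ 2 * V) + r ^ (n + 6) * N ^ 2)) +
          8 * ε ^ 2 * r ^ (n + 2) := by
        have : C * (ρ / r) ^ 2 * ((∫ z in cylQ n r, (timeQuot h v z - c) ^ 2) +
            r ^ (n + 6) * N ^ 2) ≤
            C * (ρ / r) ^ 2 * ((2 * I + 2 * ε ^ 2 * V) + r ^ (n + 6) * N ^ 2) := by gcongr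
        linarith
      _ = _ := by ring
  have hlim : r ^ (n + 2) * (vt z - vt 0) ^ 2 ≤
      2 * C * (ρ / r) ^ 2 * (2 * I + r ^ (n + 6) * N ^ 2) := by
    have ht : Tendsto (fun ε : ℝ => 2 * C * (ρ / r) ^ 2 * (2 * I + r ^ (n + 6) * N ^ 2) +
        ε ^ 2 * (4 * C * (ρ / r) ^ 2 * V + 8 * r ^ (n + 2))) (𝓝[>] 0)
        (𝓝 (2 * C * (ρ / r) ^ 2 * (2 * I + r ^ (n + 6) * N ^ 2) +
        0 ^ 2 * (4 * C * (ρ / r) ^ 2 * V + 8 * r ^ (n + 2)))) :=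
      Tendsto.mono_left (Continuous.tendsto (by fun_prop) 0) nhdsWithin_le_nhds
    have := ge_of_tendsto ht (eventually_mem_nhdsWithin.mono happrox)
    simpa using this
  have hρ2 : (ρ / r) ^ 2 = 4 * (ρ / R) ^ 2 := by
    rw [hRr]
    field_simp
    norm_num
  have hI0 : 0 ≤ I := hI ▸ integral_nonneg fun z => sq_nonneg _
  calc R ^ (n + 2) * (vt z - vt 0) ^ 2 = 2 ^ (n + 2) * (r ^ (n + 2) * (vt z - vt 0) ^ 2) := by
        rw [hRr, mul_pow]
        ring
    _ ≤ 2 ^ (n + 2) * (2 * C * (ρ / r) ^ 2 * (2 * I + 2 * (R ^ (n + 6) * N ^ 2))) := by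
      refine mul_le_mul_of_nonneg_left (hlim.trans ?_) (by positivity)
      have k1 : r ^ (n + 6) * N ^ 2 ≤ R ^ (n + 6) * N ^ 2 := by gcongr
      have k2 : 0 ≤ R ^ (n + 6) * N ^ 2 := by positivity
      exact mul_le_mul_of_nonneg_left (by linarith) (by positivity)
    _ = _ := by
      rw [hρ2]
      ring

end TimeDerivative

/-! ### Bounded Lipschitz functions -/

namespace BddLip

variable {E : Type*} [NormedAddCommGroup E] {S : Set E} {C D m : ℝ} {f g : E → ℝ}

lemma add (hf : BddLip S C f) (hg : BddLip S D g) : BddLip S (C + D) fun x => f x + g x := by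
  refine ⟨fun x hx => (abs_add_le _ _).trans (add_le_add (hf.1 x hx) (hg.1 x hx)),
    fun x hx y hy => ?_⟩
  rw [add_sub_add_comm, add_mul]
  exact (abs_add_le _ _).trans (add_le_add (hf.2 x hx y hy) (hg.2 x hx y hy))

lemma mul (hC : 0 ≤ C) (hD : 0 ≤ D) (hf : BddLip S C f) (hg : BddLip S D g) :
    BddLip S (2 * C * D) fun x => f x * g x := by
  refine ⟨fun x hx => ?_, fun x hx y hy => ?_⟩
  · have h : |f x| * |g x| ≤ C * D := mul_le_mul (hf.1 x hx) (hg.1 x hx) (abs_nonneg _) hC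
    rw [abs_mul]
    linarith [mul_nonneg hC hD]
  · have h1 : |f x| * |g x - g y| ≤ C * (D * ‖x - y‖) :=
      mul_le_mul (hf.1 x hx) (hg.2 x hx y hy) (abs_nonneg _) hC
    have h2 : |f x - f y| * |g y| ≤ C * ‖x - y‖ * D :=
      mul_le_mul (hf.2 x hx y hy) (hg.1 y hy) (abs_nonneg _) (by positivity)
    calc |f x * g x - f y * g y| = |f x * (g x - g y) + (f x - f y) * g y| := by ring_nf
      _ ≤ |f x| * |g x - g y| + |f x - f y| * |g y| := by
        rw [← abs_mul, ← abs_mul]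
        exact abs_add_le _ _
      _ ≤ 2 * C * D * ‖x - y‖ := by linarith

lemma const_mul (c : ℝ) (hf : BddLip S C f) : BddLip S (|c| * C) fun x => c * f x := by
  refine ⟨fun x hx => ?_, fun x hx y hy => ?_⟩
  · rw [abs_mul]
    gcongr
    exact hf.1 x hx
  · rw [← mul_sub, abs_mul, mul_assoc]
    gcongr
    exact hf.2 x hx y hy

lemma sum {ι : Type*} (s : Finset ι) {f : ι → E → ℝ} (hf : ∀ i ∈ s, BddLip S C (f i)) :
    BddLip S (s.card * C) fun x => ∑ i ∈ s, f i x := by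
  refine ⟨fun x hx => ?_, fun x hx y hy => ?_⟩
  · refine (Finset.abs_sum_le_sum_abs _ _).trans ?_
    rw [← nsmul_eq_mul]
    exact Finset.sum_le_card_nsmul _ _ _ fun i hi => (hf i hi).1 x hx
  · rw [← Finset.sum_sub_distrib]
    refine (Finset.abs_sum_le_sum_abs _ _).trans ?_
    rw [mul_assoc, ← nsmul_eq_mul]
    exact Finset.sum_le_card_nsmul _ _ _ fun i hi => (hf i hi).2 x hx y hy

lemma inv (hm : 0 < m) (hC : 0 ≤ C) (hf : BddLip S C f) (h : ∀ x ∈ S, m ≤ f x) :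
    BddLip S (m⁻¹ + C / m ^ 2) fun x => (f x)⁻¹ := by
  have hpos : ∀ x ∈ S, 0 < f x := fun x hx => hm.trans_le (h x hx)
  have hinv : ∀ x ∈ S, (f x)⁻¹ ≤ m⁻¹ := fun x hx => inv_anti₀ hm (h x hx)
  refine ⟨fun x hx => ?_, fun x hx y hy => ?_⟩
  · rw [abs_of_pos (inv_pos.2 (hpos x hx))]
    exact (hinv x hx).trans (le_add_of_nonneg_right (by positivity))
  · have hx0 := hpos x hx
    have hy0 := hpos y hy
    have e : (f x)⁻¹ - (f y)⁻¹ = -((f x - f y) * ((f x)⁻¹ * (f y)⁻¹)) := by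
      field_simp
      ring
    rw [e, abs_neg, abs_mul, abs_of_pos (by positivity : 0 < (f x)⁻¹ * (f y)⁻¹)]
    calc |f x - f y| * ((f x)⁻¹ * (f y)⁻¹) ≤ C * ‖x - y‖ * (m⁻¹ * m⁻¹) := by
          gcongr
          · exact hf.2 x hx y hy
          · exact h x hx
          · exact h y hy
      _ = C / m ^ 2 * ‖x - y‖ := by
          field_simp
      _ ≤ _ := by
        gcongr
        exact le_add_of_nonneg_left (by positivity)

end BddLip

section Coefficients

variable {n : ℕ}

lemma clm_apply_eq_sum (L : EuclideanSpace ℝ (Fin n) →L[ℝ] ℝ) (σ : EuclideanSpace ℝ (Fin n)) :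
    L σ = ∑ k, σ k * L (EuclideanSpace.single k 1) := by
  conv_lhs => rw [← (EuclideanSpace.basisFun (Fin n) ℝ).sum_repr σ]
  simp

lemma bddLip_of_pderiv'_le {S : Set (EuclideanSpace ℝ (Fin n))} (hS : Convex ℝ S)
    {f : EuclideanSpace ℝ (Fin n) → ℝ} {K : ℝ} (hK : 0 ≤ K)
    (hd : ∀ x ∈ S, DifferentiableAt ℝ f x) (hf : ∀ x ∈ S, |f x| ≤ K)
    (hf' : ∀ x ∈ S, ∀ k, |pderiv' k f x| ≤ K) : BddLip S ((n + 1) * K) f := by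
  refine ⟨fun x hx => (hf x hx).trans ?_, fun x hx y hy => ?_⟩
  · exact le_mul_of_one_le_left hK (by linarith [n.cast_nonneg (α := ℝ)])
  · have h := hS.norm_image_sub_le_of_norm_fderiv_le (𝕜 := ℝ) hd (C := n * K) (fun z hz => ?_) hy hx
    · refine h.trans ?_
      gcongr
      linarith
    · refine ContinuousLinearMap.opNorm_le_bound _ (by positivity) fun σ => ?_
      rw [clm_apply_eq_sum]
      refine (norm_sum_le _ _).trans ?_
      calc ∑ k, ‖σ k * fderiv ℝ f z (EuclideanSpace.single k 1)‖ ≤ ∑ _k : Fin n, ‖σ‖ * K := by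
            refine Finset.sum_le_sum fun k _ => ?_
            rw [norm_mul]
            gcongr
            · exact PiLp.norm_apply_le σ k
            · exact hf' z hz k
        _ = n * K * ‖σ‖ := by
          simp
          ring

lemma ContDiffAt.differentiableAt_pderiv' {f : EuclideanSpace ℝ (Fin n) → ℝ}
    {x : EuclideanSpace ℝ (Fin n)} (hf : ContDiffAt ℝ 2 f x) (i : Fin n) :
    DifferentiableAt ℝ (pderiv' i f) x := by
  have h : ContDiffAt ℝ 1 (fderiv ℝ f) x := hf.fderiv_right (by norm_num)
  exact (h.differentiableAt (by norm_num)).clm_apply (differentiableAt_const _)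

lemma abs_lastC_le (x : EuclideanSpace ℝ (Fin n)) : |lastC x| ≤ ‖x‖ := by
  unfold lastC
  split_ifs with h
  · exact PiLp.norm_apply_le x _
  · simp

lemma lastC_sub (x y : EuclideanSpace ℝ (Fin n)) : lastC (x - y) = lastC x - lastC y := by
  unfold lastC
  split_ifs <;> simp

lemma bddLip_comp_lastC {φ : ℝ → ℝ} {L R : ℝ} (hR : R ≤ 3 / 4)
    (hd : ∀ t ∈ Icc (-(3 / 4) : ℝ) (3 / 4), DifferentiableAt ℝ φ t)
    (hφ : ∀ t ∈ Icc (-(3 / 4) : ℝ) (3 / 4), |φ t| ≤ L)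
    (hφ' : ∀ t ∈ Icc (-(3 / 4) : ℝ) (3 / 4), |deriv φ t| ≤ L) :
    BddLip (Metric.ball (0 : EuclideanSpace ℝ (Fin n)) R) L fun x => φ (lastC x) := by
  have hmem : ∀ x ∈ Metric.ball (0 : EuclideanSpace ℝ (Fin n)) R,
      lastC x ∈ Icc (-(3 / 4) : ℝ) (3 / 4) := fun x hx => by
    rw [mem_ball_zero_iff] at hx
    exact abs_le.1 ((abs_lastC_le x).trans (by linarith))
  refine ⟨fun x hx => hφ _ (hmem x hx), fun x hx y hy => ?_⟩
  have h := (convex_Icc (-(3 / 4) : ℝ) (3 / 4)).norm_image_sub_le_of_norm_deriv_le hd hφ'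
    (hmem y hy) (hmem x hx)
  have hL : 0 ≤ L := (abs_nonneg _).trans (hφ _ (hmem x hx))
  refine h.trans ?_
  rw [← lastC_sub]
  gcongr
  exact abs_lastC_le _

/-- A solution of a divergence form equation is a classical solution of the corresponding
nondivergence form equation. -/
lemma RegSol.isClassicalSol {R : ℝ} {u ut : EuclideanSpace ℝ (Fin n) × ℝ → ℝ}
    {A : EuclideanSpace ℝ (Fin n) → Matrix (Fin n) (Fin n) ℝ}
    {e q f : EuclideanSpace ℝ (Fin n) → ℝ} (hu : RegSol R u ut)
    (hA : ∀ x ∈ Metric.ball (0 : EuclideanSpace ℝ (Fin n)) R, ∀ i j,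
      DifferentiableAt ℝ (fun y => A y i j) x)
    (hs : ∀ x ∈ Metric.ball (0 : EuclideanSpace ℝ (Fin n)) R, ∀ i j, A x i j = A x j i)
    (he : ∀ x ∈ Metric.ball (0 : EuclideanSpace ℝ (Fin n)) R, e x ≠ 0)
    (heq : ∀ z ∈ cylQ n R, e z.1 * ut z - divAgrad A u z + q z.1 * u z = f z.1) :
    IsClassicalSol R (fun x => (e x)⁻¹ • A x)
      (fun x j => (e x)⁻¹ * ∑ i, pderiv' i (fun y => A y i j) x) (fun x => (e x)⁻¹ * q x)
      (fun x => (e x)⁻¹ * f x) u ut (fun i z => pderiv' i (fun x => u (x, z.2)) z.1)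
      (fun i j z => pderiv' j (pderiv' i fun x => u (x, z.2)) z.1) := by
  obtain ⟨h1, h2, h3, h4, h5, h6⟩ := hu
  have hcd : ∀ z ∈ cylQ n R, ContDiffAt ℝ 2 (fun x => u (x, z.2)) z.1 := fun z hz =>
    (h3 z.2 hz.2).contDiffAt (Metric.isOpen_ball.mem_nhds hz.1)
  refine ⟨h1.mono subset_closure, h2.mono subset_closure, fun i => (h4 i).mono subset_closure,
    fun i j => (h5 j i).mono subset_closure, fun z hz σ => ?_, fun i z hz σ => ?_,
    fun z hz => ?_, fun z hz => ?_⟩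
  · have hd := ((hcd z hz).differentiableAt (by norm_num)).hasFDerivAt.hasLineDerivAt σ
    rw [clm_apply_eq_sum] at hd
    exact hd
  · have hd := ((hcd z hz).differentiableAt_pderiv' i).hasFDerivAt.hasLineDerivAt σ
    rw [clm_apply_eq_sum] at hd
    exact hd
  · exact (h6 z hz).mono_of_mem_nhdsWithin
      (inter_mem (mem_nhdsWithin_of_mem_nhds (Ioi_mem_nhds hz.2.1)) self_mem_nhdsWithin)
  · have he0 := he z.1 hz.1
    have hdiv : divAgrad A u z =
        ∑ i, ∑ j, A z.1 i j * pderiv' j (pderiv' i fun x => u (x, z.2)) z.1 +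
        ∑ j, (∑ i, pderiv' i (fun y => A y i j) z.1) * pderiv' j (fun x => u (x, z.2)) z.1 := by
      have hp : ∀ i, pderiv' i (fun y => ∑ j, A y i j * pderiv' j (fun y' => u (y', z.2)) y) z.1 =
          ∑ j, (A z.1 i j * pderiv' i (pderiv' j fun x => u (x, z.2)) z.1 +
            pderiv' i (fun y => A y i j) z.1 * pderiv' j (fun x => u (x, z.2)) z.1) := by
        intro i
        have hF := HasFDerivAt.fun_sum (u := Finset.univ) fun j _ =>
          (hA z.1 hz.1 i j).hasFDerivAt.mul ((hcd z hz).differentiableAt_pderiv' j).hasFDerivAt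
        refine (DFunLike.congr_fun hF.fderiv (EuclideanSpace.single i 1)).trans ?_
        rw [sum_apply]
        refine Finset.sum_congr rfl fun j _ => ?_
        rw [add_apply, smul_apply,
          smul_apply, smul_eq_mul, smul_eq_mul,
          mul_comm (pderiv' j _ _) (fderiv ℝ _ _ _)]
        rfl
      rw [divAgrad, Finset.sum_congr rfl fun i _ => hp i]
      simp only [Finset.sum_add_distrib]
      congr 1
      · rw [Finset.sum_comm]
        exact Finset.sum_congr rfl fun i _ => Finset.sum_congr rfl fun j _ => by
          rw [hs z.1 hz.1 j i]
      · rw [Finset.sum_comm]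
        simp only [Finset.sum_mul]
    have hz' := heq z hz
    rw [hdiv] at hz'
    simp only [Matrix.smul_apply, smul_eq_mul, mul_assoc, ← Finset.mul_sum]
    rw [← sub_eq_zero]
    field_simp
    linarith

end Coefficients

lemma exists_coeffBound (n : ℕ) {lam Lam bBar K : ℝ} (hlam : 0 < lam) (hlL : lam ≤ Lam)
    (hbBar : lam ≤ bBar) (hK : 0 ≤ K) :
    ∃ Γ : ℝ, 0 ≤ Γ ∧ ∀ (p ℓ R aBar : ℝ) (φ : ℝ → ℝ)
      (A : EuclideanSpace ℝ (Fin n) → Matrix (Fin n) (Fin n) ℝ)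
      (b₁ : EuclideanSpace ℝ (Fin n) → ℝ),
      1 < p → ℓ ∈ Ioo (0 : ℝ) 1 → R < 1 / 2 → lam ≤ aBar → aBar ≤ Lam →
      (∀ t ∈ Icc (-(3 / 4) : ℝ) (3 / 4), DifferentiableAt ℝ φ t) →
      (∀ t ∈ Icc (-(3 / 4) : ℝ) (3 / 4), lam ≤ φ t ∧ φ t ≤ Lam ∧ |deriv φ t| ≤ Lam) →
      (∀ x ∈ Metric.ball (0 : EuclideanSpace ℝ (Fin n)) R, ∀ i j,
        ContDiffAt ℝ 2 (fun y => A y i j) x) →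
      (∀ x ∈ Metric.ball (0 : EuclideanSpace ℝ (Fin n)) R, ∀ i j, A x i j = A x j i) →
      (∀ x ∈ Metric.ball (0 : EuclideanSpace ℝ (Fin n)) R, ∀ ξ : Fin n → ℝ,
        lam * ∑ i, ξ i ^ 2 ≤ ∑ i, ∑ j, A x i j * ξ i * ξ j) →
      (∀ x ∈ Metric.ball (0 : EuclideanSpace ℝ (Fin n)) R, DifferentiableAt ℝ b₁ x) →
      (∀ x ∈ Metric.ball (0 : EuclideanSpace ℝ (Fin n)) R, ∀ i j,
        |A x i j| ≤ K ∧ (∀ k, |pderiv' k (fun y => A y i j) x| ≤ K) ∧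
        (∀ k l, |pderiv' k (pderiv' l fun y => A y i j) x| ≤ K)) →
      (∀ x ∈ Metric.ball (0 : EuclideanSpace ℝ (Fin n)) R,
        |b₁ x| ≤ K ∧ ∀ k, |pderiv' k b₁ x| ≤ K) →
      CoeffBound (Metric.ball (0 : EuclideanSpace ℝ (Fin n)) R) (lam / Lam ^ 2) Γ
        (fun x => (aBar * φ (lastC x))⁻¹ • A x)
        (fun x j => (aBar * φ (lastC x))⁻¹ * ∑ i, pderiv' i (fun y => A y i j) x)
        (fun x => (aBar * φ (lastC x))⁻¹ *
          (ℓ ^ 2 * b₁ x + ℓ ^ (p + 1) * bBar * φ (lastC x))) ∧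
      BddLip (Metric.ball (0 : EuclideanSpace ℝ (Fin n)) R) (ℓ ^ 2 * Γ)
        (fun x => (aBar * φ (lastC x))⁻¹ *
          (ℓ ^ 2 * b₁ x + ℓ ^ (p + 1) * bBar * φ (lastC x))) := by
  have hLam : 0 < Lam := hlam.trans_le hlL
  have hb0 : 0 < bBar := hlam.trans_le hbBar
  obtain ⟨G, hG⟩ : ∃ G, G = (lam * lam)⁻¹ + Lam * Lam / (lam * lam) ^ 2 := ⟨_, rfl⟩
  obtain ⟨T, hT⟩ : ∃ T : ℝ, T = (n + 1) * K := ⟨_, rfl⟩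
  have hG0 : 0 ≤ G := by rw [hG]; positivity
  have hT0 : 0 ≤ T := by rw [hT]; positivity
  obtain ⟨Γ, hΓ⟩ : ∃ Γ : ℝ, Γ = 2 * G * T + 2 * G * (n * T) + 2 * G * (T + bBar * Lam) := ⟨_, rfl⟩
  have hΓ0 : 0 ≤ Γ := by rw [hΓ]; positivity
  have hA0 : 0 ≤ 2 * G * T := by positivity
  have hB0 : 0 ≤ 2 * G * (n * T) := by positivity
  have hC0 : 0 ≤ 2 * G * (T + bBar * Lam) := by positivity
  refine ⟨Γ, hΓ0, fun p ℓ R aBar φ A b₁ hp hℓ hR ha1 ha2 hφd hφ hAd hAs hAe hbd hAK hbK => ?_⟩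
  have ha0 : 0 < aBar := hlam.trans_le ha1
  have hmem : ∀ x ∈ Metric.ball (0 : EuclideanSpace ℝ (Fin n)) R,
      lastC x ∈ Icc (-(3 / 4) : ℝ) (3 / 4) := fun x hx => by
    rw [mem_ball_zero_iff] at hx
    exact abs_le.1 ((abs_lastC_le x).trans (by linarith))
  have hφB : BddLip (Metric.ball (0 : EuclideanSpace ℝ (Fin n)) R) Lam fun x => φ (lastC x) :=
    bddLip_comp_lastC (by linarith) hφd
      (fun t ht => abs_le.2 ⟨by linarith [(hφ t ht).1], (hφ t ht).2.1⟩) fun t ht => (hφ t ht).2.2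
  have hφ0 : ∀ x ∈ Metric.ball (0 : EuclideanSpace ℝ (Fin n)) R, 0 < φ (lastC x) := fun x hx =>
    hlam.trans_le (hφ _ (hmem x hx)).1
  have heB : BddLip (Metric.ball (0 : EuclideanSpace ℝ (Fin n)) R) (Lam * Lam)
      fun x => aBar * φ (lastC x) :=
    (hφB.const_mul aBar).mono_const (by rw [abs_of_pos ha0]; gcongr)
  have hinv : BddLip (Metric.ball (0 : EuclideanSpace ℝ (Fin n)) R) G
      fun x => (aBar * φ (lastC x))⁻¹ := by
    rw [hG]
    exact heB.inv (by positivity) (by positivity) fun x hx =>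
      mul_le_mul ha1 (hφ _ (hmem x hx)).1 hlam.le ha0.le
  have hconv := convex_ball (0 : EuclideanSpace ℝ (Fin n)) R
  have hAB : ∀ i j, BddLip (Metric.ball (0 : EuclideanSpace ℝ (Fin n)) R) T fun x => A x i j :=
    fun i j => hT ▸ bddLip_of_pderiv'_le hconv hK
      (fun x hx => (hAd x hx i j).differentiableAt (by norm_num)) (fun x hx => (hAK x hx i j).1)
      fun x hx => (hAK x hx i j).2.1
  have hA'B : ∀ i j, BddLip (Metric.ball (0 : EuclideanSpace ℝ (Fin n)) R) T
      fun x => pderiv' i (fun y => A y i j) x :=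
    fun i j => hT ▸ bddLip_of_pderiv'_le hconv hK
      (fun x hx => (hAd x hx i j).differentiableAt_pderiv' i) (fun x hx => (hAK x hx i j).2.1 i)
      fun x hx k => (hAK x hx i j).2.2 k i
  have hbB : BddLip (Metric.ball (0 : EuclideanSpace ℝ (Fin n)) R) T b₁ :=
    hT ▸ bddLip_of_pderiv'_le hconv hK hbd (fun x hx => (hbK x hx).1) fun x hx => (hbK x hx).2
  obtain ⟨hℓ0, hℓ1⟩ := hℓ
  have hγB : BddLip (Metric.ball (0 : EuclideanSpace ℝ (Fin n)) R) (ℓ ^ 2 * Γ)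
      (fun x => (aBar * φ (lastC x))⁻¹ *
        (ℓ ^ 2 * b₁ x + ℓ ^ (p + 1) * bBar * φ (lastC x))) := by
    have hpow : ℓ ^ (p + 1) = ℓ ^ 2 * ℓ ^ (p - 1) := by
      rw [← Real.rpow_two, ← Real.rpow_add hℓ0]
      ring_nf
    have hle : ℓ ^ (p - 1) ≤ 1 := Real.rpow_le_one hℓ0.le hℓ1.le (by linarith)
    have hpos : 0 < ℓ ^ (p - 1) := Real.rpow_pos_of_pos hℓ0 _
    have h1 : BddLip (Metric.ball (0 : EuclideanSpace ℝ (Fin n)) R) (T + bBar * Lam)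
        fun x => b₁ x + ℓ ^ (p - 1) * bBar * φ (lastC x) := by
      refine hbB.add ((hφB.const_mul (ℓ ^ (p - 1) * bBar)).mono_const ?_)
      rw [abs_of_pos (by positivity)]
      gcongr
      exact mul_le_of_le_one_left hb0.le hle
    have h2 := (hinv.mul hG0 (by positivity) h1).const_mul (ℓ ^ 2)
    rw [abs_of_pos (by positivity)] at h2
    have h3 : (fun x : EuclideanSpace ℝ (Fin n) => (aBar * φ (lastC x))⁻¹ *
        (ℓ ^ 2 * b₁ x + ℓ ^ (p + 1) * bBar * φ (lastC x))) = fun x => ℓ ^ 2 *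
          ((aBar * φ (lastC x))⁻¹ * (b₁ x + ℓ ^ (p - 1) * bBar * φ (lastC x))) := by
      funext x
      rw [hpow]
      ring
    rw [h3]
    refine h2.mono_const ?_
    gcongr
    rw [hΓ]
    linarith
  refine ⟨⟨fun x hx i j => ?_, fun x hx ξ => ?_, fun i j => ?_, fun j => ?_, ?_⟩, hγB⟩
  · rw [Matrix.smul_apply, Matrix.smul_apply, hAs x hx i j]
  · have he : (Lam ^ 2)⁻¹ ≤ (aBar * φ (lastC x))⁻¹ := by
      have := hφ0 x hx
      rw [sq]
      exact inv_anti₀ (by positivity)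
        (mul_le_mul ha2 (hφ _ (hmem x hx)).2.1 this.le hLam.le)
    have hS : 0 ≤ ∑ i, ξ i ^ 2 := Finset.sum_nonneg fun i _ => sq_nonneg _
    have h1 := hAe x hx ξ
    simp only [Matrix.smul_apply, smul_eq_mul, mul_assoc, ← Finset.mul_sum]
    simp only [mul_assoc] at h1
    calc lam / Lam ^ 2 * ∑ i, ξ i ^ 2 = (Lam ^ 2)⁻¹ * (lam * ∑ i, ξ i ^ 2) := by ring
      _ ≤ (aBar * φ (lastC x))⁻¹ * (lam * ∑ i, ξ i ^ 2) := by gcongr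
      _ ≤ _ := by
        have := hφ0 x hx
        exact mul_le_mul_of_nonneg_left h1 (by positivity)
  · refine (hinv.mul hG0 hT0 (hAB i j)).mono_const ?_
    rw [hΓ]
    linarith
  · have := BddLip.sum Finset.univ fun i _ => hA'B i j
    rw [Finset.card_univ, Fintype.card_fin] at this
    refine (hinv.mul hG0 (by positivity) this).mono_const ?_
    rw [hΓ]
    linarith
  · exact hγB.mono_const (mul_le_of_le_one_left hΓ0 (pow_le_one₀ hℓ0.le hℓ1.le))

/-! ### Mean oscillation -/

section Average

variable {X : Type*} [MeasurableSpace X] {μ : Measure X} {S : Set X} {f : X → ℝ}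

lemma setIntegral_sub_const_sq (hS : μ S ≠ ⊤) (hf : IntegrableOn f S μ)
    (hf2 : IntegrableOn (fun x => f x ^ 2) S μ) (k : ℝ) :
    ∫ x in S, (f x - k) ^ 2 ∂μ =
      (∫ x in S, f x ^ 2 ∂μ) - 2 * k * (μ.real S * ⨍ x in S, f x ∂μ) + k ^ 2 * μ.real S := by
  have hc : IntegrableOn (fun _ => k ^ 2) S μ := integrableOn_const hS
  have h : ∀ x, (f x - k) ^ 2 = f x ^ 2 - 2 * k * f x + k ^ 2 := fun x => by ring
  simp only [h]
  have h1 : IntegrableOn (fun x => f x ^ 2 - 2 * k * f x) S μ := hf2.sub (hf.const_mul _)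
  rw [integral_add h1 hc, integral_sub hf2 (hf.const_mul _),
    integral_const_mul, setIntegral_const, smul_eq_mul, ← measure_smul_setAverage f hS, smul_eq_mul]
  ring

lemma setIntegral_sub_average_sq_le (hS : μ S ≠ ⊤) (hf : IntegrableOn f S μ)
    (hf2 : IntegrableOn (fun x => f x ^ 2) S μ) (k : ℝ) :
    ∫ x in S, (f x - ⨍ y in S, f y ∂μ) ^ 2 ∂μ ≤ ∫ x in S, (f x - k) ^ 2 ∂μ := by
  rw [setIntegral_sub_const_sq hS hf hf2, setIntegral_sub_const_sq hS hf hf2]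
  have h : 0 ≤ μ.real S := measureReal_nonneg
  nlinarith [mul_nonneg h (sq_nonneg (k - ⨍ y in S, f y ∂μ))]

lemma sq_average_mul_le (hS : μ S ≠ ⊤) (hf : IntegrableOn f S μ)
    (hf2 : IntegrableOn (fun x => f x ^ 2) S μ) :
    (⨍ x in S, f x ∂μ) ^ 2 * μ.real S ≤ ∫ x in S, f x ^ 2 ∂μ := by
  have h := setIntegral_sub_const_sq hS hf hf2 (⨍ x in S, f x ∂μ)
  have h0 : 0 ≤ ∫ x in S, (f x - ⨍ y in S, f y ∂μ) ^ 2 ∂μ := integral_nonneg fun x => sq_nonneg _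
  linarith

end Average

lemma isCompact_closure_cylQ (n : ℕ) (R : ℝ) : IsCompact (closure (cylQ n R)) :=
  ((isCompact_closedBall (0 : EuclideanSpace ℝ (Fin n)) R).prod
    (isCompact_Icc (a := -(R ^ 2)) (b := 0))).closure_of_subset
      (Set.prod_mono Metric.ball_subset_closedBall Ioc_subset_Icc_self)

/-- Campanato decay from pointwise decay at scales at most `R / 64`. -/
lemma setIntegral_sub_average_sq_le_of_decay {n : ℕ} {f : EuclideanSpace ℝ (Fin n) × ℝ → ℝ}
    {R ω D E G κ : ℝ} (hR : 0 < R) (hR1 : R ≤ 1)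
    (hf : ContinuousOn f (closure (cylQ n R)))
    (hω : ω = volume.real (Metric.ball (0 : EuclideanSpace ℝ (Fin n)) 1)) (hD : 0 ≤ D)
    (hE : E = ⨍ z in cylQ n R, f z)
    (h : ∀ ρ : ℝ, 0 < ρ → ρ ≤ R / 64 → ∀ z ∈ cylQ n ρ, R ^ (n + 2) * (f z - f 0) ^ 2 ≤
      D * (ρ / R) ^ 2 * ((∫ z in cylQ n R, (f z - E) ^ 2) + R ^ (n + 6) * (κ * G * |E|) ^ 2))
    {ρ : ℝ} (hρ : 0 < ρ) (hρR : ρ ≤ R) :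
    ∫ z in cylQ n ρ, (f z - ⨍ w in cylQ n ρ, f w) ^ 2 ≤
      (D * (ω + G ^ 2) + 64 ^ (n + 4)) * (ρ / R) ^ (n + 4) *
        ((∫ z in cylQ n R, (f z - E) ^ 2) + κ ^ 2 * R ^ 2 * ∫ z in cylQ n R, f z ^ 2) := by
  have hω0 : 0 < ω := hω ▸ volume_real_unitBall_pos n
  have hInt : IntegrableOn f (cylQ n R) :=
    (hf.integrableOn_compact (isCompact_closure_cylQ n R)).mono_set subset_closure
  have hint2 : IntegrableOn (fun z => f z ^ 2) (cylQ n R) :=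
    ((hf.pow 2).integrableOn_compact (isCompact_closure_cylQ n R)).mono_set subset_closure
  have hintk : ∀ k : ℝ, IntegrableOn (fun z => (f z - k) ^ 2) (cylQ n R) := fun k =>
    (((hf.sub continuousOn_const).pow 2).integrableOn_compact
      (isCompact_closure_cylQ n R)).mono_set subset_closure
  have hsub : cylQ n ρ ⊆ cylQ n R := cylQ_subset_cylQ hρ.le hρR
  have havg := fun k => setIntegral_sub_average_sq_le (volume_cylQ_ne_top ρ)
    (hInt.mono_set hsub) (hint2.mono_set hsub) k
  have hcJ := sq_average_mul_le (volume_cylQ_ne_top R) hInt hint2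
  rw [← hE, volume_real_cylQ hR, ← hω] at hcJ
  obtain ⟨I, hI⟩ : ∃ I, I = ∫ z in cylQ n R, (f z - E) ^ 2 := ⟨_, rfl⟩
  obtain ⟨J, hJ⟩ : ∃ J, J = ∫ z in cylQ n R, f z ^ 2 := ⟨_, rfl⟩
  have hI0 : 0 ≤ I := hI ▸ integral_nonneg fun z => sq_nonneg _
  have hJ0 : 0 ≤ J := hJ ▸ integral_nonneg fun z => sq_nonneg _
  rw [← hI] at h
  rw [← hJ] at hcJ
  rw [← hI, ← hJ]
  have hκJ : 0 ≤ κ ^ 2 * R ^ 2 * J := by positivity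
  rcases le_or_gt ρ (R / 64) with hsmall | hlarge
  · obtain ⟨B, hB⟩ : ∃ B, B = D * (ρ / R) ^ 2 * (I + R ^ (n + 6) * (κ * G * |E|) ^ 2) := ⟨_, rfl⟩
    have h1 : ∫ z in cylQ n ρ, (f z - f 0) ^ 2 ≤ ω * ρ ^ (n + 2) * (B / R ^ (n + 2)) := by
      calc ∫ z in cylQ n ρ, (f z - f 0) ^ 2 ≤ ∫ _z in cylQ n ρ, B / R ^ (n + 2) := by
            refine setIntegral_mono_on ((hintk _).mono_set hsub)
              (integrableOn_const (volume_cylQ_ne_top ρ)) (measurableSet_cylQ ρ) fun z hz => ?_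
            rw [le_div_iff₀ (by positivity), mul_comm, hB]
            exact h ρ hρ hsmall z hz
        _ = _ := by rw [setIntegral_const, smul_eq_mul, volume_real_cylQ hρ, hω]
    have h2 : ω * (R ^ (n + 6) * (κ * G * |E|) ^ 2) ≤ G ^ 2 * (κ ^ 2 * R ^ 2 * J) := by
      calc ω * (R ^ (n + 6) * (κ * G * |E|) ^ 2) =
            G ^ 2 * (κ ^ 2 * R ^ 4 * (E ^ 2 * (ω * R ^ (n + 2)))) := by
            rw [mul_pow, sq_abs]
            ring
        _ ≤ G ^ 2 * (κ ^ 2 * R ^ 2 * J) := by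
            have : R ^ 4 ≤ R ^ 2 := pow_le_pow_of_le_one hR.le hR1 (by norm_num)
            gcongr
    calc ∫ z in cylQ n ρ, (f z - ⨍ w in cylQ n ρ, f w) ^ 2
        ≤ ω * ρ ^ (n + 2) * (B / R ^ (n + 2)) := (havg (f 0)).trans h1
      _ = D * (ρ / R) ^ (n + 4) * (ω * I + ω * (R ^ (n + 6) * (κ * G * |E|) ^ 2)) := by
        rw [hB, div_pow, div_pow]
        field_simp
        ring
      _ ≤ D * (ρ / R) ^ (n + 4) * ((ω + G ^ 2) * (I + κ ^ 2 * R ^ 2 * J)) := by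
        refine mul_le_mul_of_nonneg_left ?_ (by positivity)
        nlinarith [mul_nonneg hω0.le hκJ, mul_nonneg (sq_nonneg G) hI0]
      _ = D * (ω + G ^ 2) * (ρ / R) ^ (n + 4) * (I + κ ^ 2 * R ^ 2 * J) := by ring
      _ ≤ _ := by
        gcongr
        exact le_add_of_nonneg_right (by positivity)
  · have h1 : ∫ z in cylQ n ρ, (f z - E) ^ 2 ≤ I := by
      rw [hI]
      exact setIntegral_mono_set (hintk E) (ae_of_all _ fun z => sq_nonneg _) hsub.eventuallyLE
    have h2 : 1 ≤ 64 ^ (n + 4) * (ρ / R) ^ (n + 4) := by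
      rw [← mul_pow]
      refine one_le_pow₀ ?_
      rw [← mul_div_assoc, le_div_iff₀ hR]
      linarith
    calc ∫ z in cylQ n ρ, (f z - ⨍ w in cylQ n ρ, f w) ^ 2 ≤ I := (havg E).trans h1
      _ ≤ I + κ ^ 2 * R ^ 2 * J := le_add_of_nonneg_right hκJ
      _ ≤ 64 ^ (n + 4) * (ρ / R) ^ (n + 4) * (I + κ ^ 2 * R ^ 2 * J) :=
        le_mul_of_one_le_left (by positivity) h2
      _ ≤ _ := by
        gcongr
        exact le_add_of_nonneg_left (by positivity)

end

/-- Constant-coefficient oscillation decay for `∂ₜu` (part (i) of Proposition C.3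
of the paper).  The constant `C` depends only on `n`, `λ`, `Λ`, `|b̄|` and
(an upper bound `K` for) the `C²`-norms of `A` and `b₁` on `closure B₁` —
but not on `ℓ`. -/
theorem stmt18 (n : ℕ) (hn : 1 ≤ n) (lam Lam bBar K : ℝ)
    (hlam : 0 < lam) (hlL : lam ≤ Lam) (hbBar : lam ≤ bBar) (hK : 0 ≤ K) :
    ∃ C : ℝ, 0 < C ∧
      ∀ (p ℓ R aBar fBar : ℝ) (φ : ℝ → ℝ)
        (A : EuclideanSpace ℝ (Fin n) → Matrix (Fin n) (Fin n) ℝ)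
        (b₁ : EuclideanSpace ℝ (Fin n) → ℝ)
        (u ut : EuclideanSpace ℝ (Fin n) × ℝ → ℝ),
        1 < p → ℓ ∈ Set.Ioo (0 : ℝ) 1 → 0 < R → R < 1 / 2 →
        lam ≤ aBar → aBar ≤ Lam →
        -- `φ` is smooth on `(-1,1)`, with `λ ≤ φ ≤ Λ` and `‖φ‖_{C²} ≤ Λ` on `[-3/4,3/4]`
        ContDiffOn ℝ (⊤ : ℕ∞) φ (Set.Ioo (-1 : ℝ) 1) →
        (∀ t ∈ Set.Icc (-(3 / 4) : ℝ) (3 / 4),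
          lam ≤ φ t ∧ φ t ≤ Lam ∧ |deriv φ t| ≤ Lam ∧ |deriv (deriv φ) t| ≤ Lam) →
        -- `A` has `C³` symmetric entries and is uniformly elliptic
        (∀ i j, ContDiffOn ℝ 3 (fun x => A x i j)
          (closure (Metric.ball (0 : EuclideanSpace ℝ (Fin n)) 1))) →
        (∀ x ∈ closure (Metric.ball (0 : EuclideanSpace ℝ (Fin n)) 1),
          ∀ i j, A x i j = A x j i) →
        (∀ x ∈ closure (Metric.ball (0 : EuclideanSpace ℝ (Fin n)) 1),
          ∀ ξ : Fin n → ℝ,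
            lam * ∑ i, ξ i ^ 2 ≤ ∑ i, ∑ j, A x i j * ξ i * ξ j ∧
            ∑ i, ∑ j, A x i j * ξ i * ξ j ≤ Lam * ∑ i, ξ i ^ 2) →
        -- `b₁ ∈ C³(closure B₁)`
        ContDiffOn ℝ 3 b₁ (closure (Metric.ball (0 : EuclideanSpace ℝ (Fin n)) 1)) →
        -- `C²`-norms of `A` and `b₁` bounded by `K`
        (∀ x ∈ closure (Metric.ball (0 : EuclideanSpace ℝ (Fin n)) 1), ∀ i j,
          |A x i j| ≤ K ∧ (∀ k, |pderiv' k (fun y => A y i j) x| ≤ K) ∧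
          (∀ k l, |pderiv' k (pderiv' l fun y => A y i j) x| ≤ K)) →
        (∀ x ∈ closure (Metric.ball (0 : EuclideanSpace ℝ (Fin n)) 1),
          |b₁ x| ≤ K ∧ (∀ k, |pderiv' k b₁ x| ≤ K) ∧
          (∀ k l, |pderiv' k (pderiv' l b₁) x| ≤ K)) →
        -- regularity of `u` on `closure Q_R`
        RegSol R u ut →
        -- the constant-coefficient equation in `Q_R`
        (∀ z ∈ cylQ n R,
          aBar * φ (lastC z.1) * ut z - divAgrad A u z + ℓ ^ 2 * b₁ z.1 * u z +
              ℓ ^ (p + 1) * bBar * φ (lastC z.1) * u z =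
            ℓ ^ (p + 1) * φ (lastC z.1) * fBar) →
        -- conclusion
        ∀ ρ : ℝ, 0 < ρ → ρ ≤ R →
          (∫ z in cylQ n ρ, (ut z - ⨍ w in cylQ n ρ, ut w) ^ 2) ≤
            C * (ρ / R) ^ (n + 4) *
              ((∫ z in cylQ n R, (ut z - ⨍ w in cylQ n R, ut w) ^ 2) +
                ℓ ^ 4 * R ^ 2 * ∫ z in cylQ n R, (ut z) ^ 2) := by
  have hLam : 0 < Lam := hlam.trans_le hlL
  obtain ⟨Γ, hΓ, hcoeff⟩ := exists_coeffBound n hlam hlL hbBar hK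
  have hlam' : 0 < lam / Lam ^ 2 := by positivity
  obtain ⟨D, hD, hdecay⟩ := exists_time_deriv_decay_bound n hn hlam' hΓ
  have hω := volume_real_unitBall_pos n
  refine ⟨D * (volume.real (Metric.ball (0 : EuclideanSpace ℝ (Fin n)) 1) + Γ ^ 2) + 64 ^ (n + 4),
    by positivity, fun p ℓ R aBar fBar φ A b₁ u ut hp hℓ hR hR2 ha1 ha2 hφs hφ hAd hAs hAe hbd
      hAK hbK hu heq ρ hρ hρR => ?_⟩
  have hsub1 : Metric.ball (0 : EuclideanSpace ℝ (Fin n)) R ⊆ Metric.ball 0 1 :=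
    Metric.ball_subset_ball (by linarith)
  have hsub : Metric.ball (0 : EuclideanSpace ℝ (Fin n)) R ⊆ closure (Metric.ball 0 1) :=
    hsub1.trans subset_closure
  have hnhds : ∀ x ∈ Metric.ball (0 : EuclideanSpace ℝ (Fin n)) R,
      closure (Metric.ball (0 : EuclideanSpace ℝ (Fin n)) 1) ∈ nhds x := fun x hx =>
    Filter.mem_of_superset (Metric.isOpen_ball.mem_nhds (hsub1 hx)) subset_closure
  have hA2 : ∀ x ∈ Metric.ball (0 : EuclideanSpace ℝ (Fin n)) R, ∀ i j,
      ContDiffAt ℝ 2 (fun y => A y i j) x := fun x hx i j =>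
    ((hAd i j).contDiffAt (hnhds x hx)).of_le (by norm_num)
  have hsymm : ∀ x ∈ Metric.ball (0 : EuclideanSpace ℝ (Fin n)) R, ∀ i j, A x i j = A x j i :=
    fun x hx => hAs x (hsub hx)
  have hmem : ∀ x ∈ Metric.ball (0 : EuclideanSpace ℝ (Fin n)) R,
      lastC x ∈ Icc (-(3 / 4) : ℝ) (3 / 4) := fun x hx => by
    rw [mem_ball_zero_iff] at hx
    exact abs_le.1 ((abs_lastC_le x).trans (by linarith))
  have he : ∀ x ∈ Metric.ball (0 : EuclideanSpace ℝ (Fin n)) R, aBar * φ (lastC x) ≠ 0 :=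
    fun x hx => (mul_pos (hlam.trans_le ha1) (hlam.trans_le (hφ _ (hmem x hx)).1)).ne'
  obtain ⟨hcb, hγB⟩ := hcoeff p ℓ R aBar φ A b₁ hp hℓ hR2 ha1 ha2
    (fun t ht => (hφs.contDiffAt (Ioo_mem_nhds (by linarith [ht.1]) (by linarith [ht.2]))
      ).differentiableAt (by simp))
    (fun t ht => ⟨(hφ t ht).1, (hφ t ht).2.1, (hφ t ht).2.2.1⟩) hA2 hsymm
    (fun x hx ξ => (hAe x (hsub hx) ξ).1)
    (fun x hx => (hbd.contDiffAt (hnhds x hx)).differentiableAt (by norm_num))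
    (fun x hx => hAK x (hsub hx)) (fun x hx => ⟨(hbK x (hsub hx)).1, (hbK x (hsub hx)).2.1⟩)
  have hsol := hu.isClassicalSol
    (fun x hx i j => (hA2 x hx i j).differentiableAt (by norm_num)) hsymm he
    (q := fun x => ℓ ^ 2 * b₁ x + ℓ ^ (p + 1) * bBar * φ (lastC x))
    (f := fun x => ℓ ^ (p + 1) * φ (lastC x) * fBar) fun z hz => by
      rw [← heq z hz]
      ring
  have hcont : ContinuousOn ut (closure (cylQ n R)) := hu.2.1
  obtain ⟨c, hc⟩ : ∃ c, c = ⨍ z in cylQ n R, ut z := ⟨_, rfl⟩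
  have hN : BddLip (Metric.ball (0 : EuclideanSpace ℝ (Fin n)) R) (ℓ ^ 2 * Γ * |c|) fun x =>
      -((aBar * φ (lastC x))⁻¹ * (ℓ ^ 2 * b₁ x + ℓ ^ (p + 1) * bBar * φ (lastC x)) * c) := by
    convert hγB.const_mul (-c) using 1
    · rw [abs_neg, mul_comm]
    · funext x
      ring
  have hInt : IntegrableOn (fun z => (ut z - c) ^ 2) (cylQ n R) :=
    (((hcont.sub continuousOn_const).pow 2).integrableOn_compact
      (isCompact_closure_cylQ n R)).mono_set subset_closure
  have hfin := setIntegral_sub_average_sq_le_of_decay hR (by linarith) hcont rfl hD hc (fun r hr hrR z hz =>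
      hdecay _ _ _ _ _ _ _ _ _ _ _ hR (by linarith) (by positivity) hcb hsol hN hInt r hr hrR z hz)
    hρ hρR
  rw [← hc]
  convert hfin using 4
  ring
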